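/- Let (n_t, n_p, n_m) be a triple of nonnegative integers with n_ℝ := n_t + n_p + n_m satisfying one of: n_ℝ ∈ {0, 2, 4, 6}; or n_ℝ = 8 and n_t ≠ 1; or n_ℝ = 10 and n_t ∈ {5, 6, 7, 8, 9, 10}. Then there exists an invertible 4×4 matrix M with real entries such that the set S(M) = {(t₁, t₂, s₁, s₂) ∈ ℂ⁴ : F(t₁, t₂, s₁, s₂; M) = 0, t₁ ≠ t₂, s₁ ≠ s₂} has exactly 40 elements, the Jacobian of F(·; M) is invertible at each of them, exactly 4·n_t of these elements are totally real, exactly 4·n_p are partially real, and exactly 4·n_m are minimally real. -/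

import Mathlib

open Matrix

noncomputable section

/-- `v(a) = (1, a, a², a³) ∈ ℂ⁴`. -/
def tcv (a : ℂ) : Fin 4 → ℂ := ![1, a, a ^ 2, a ^ 3]

/-- `pᵢ(s; M)`, the `i`-th coordinate of `M·v(s)`. -/
def pc (M : Matrix (Fin 4) (Fin 4) ℂ) (i : Fin 4) (s : ℂ) : ℂ := M.mulVec (tcv s) i

/-- `f₁(t₁, t₂, s; M) = p₃(s; M) − (t₁ + t₂)p₂(s; M) + t₁t₂p₁(s; M)`. -/
def f₁ (M : Matrix (Fin 4) (Fin 4) ℂ) (t₁ t₂ s : ℂ) : ℂ :=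
  pc M 2 s - (t₁ + t₂) * pc M 1 s + t₁ * t₂ * pc M 0 s

/-- `f₂(t₁, t₂, s; M) = p₄(s; M) − (t₁ + t₂)p₃(s; M) + t₁t₂p₂(s; M)`. -/
def f₂ (M : Matrix (Fin 4) (Fin 4) ℂ) (t₁ t₂ s : ℂ) : ℂ :=
  pc M 3 s - (t₁ + t₂) * pc M 2 s + t₁ * t₂ * pc M 1 s

/-- The square polynomial system `F(·; M)` viewed as a map `ℂ⁴ → ℂ⁴`, with the
variables ordered `(t₁, t₂, s₁, s₂)`. -/
def Fmap (M : Matrix (Fin 4) (Fin 4) ℂ) (x : Fin 4 → ℂ) : Fin 4 → ℂ :=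
  ![f₁ M (x 0) (x 1) (x 2), f₁ M (x 0) (x 1) (x 3),
    f₂ M (x 0) (x 1) (x 2), f₂ M (x 0) (x 1) (x 3)]

/-- `S(M)`: solutions of `F(·; M) = 0` with `t₁ ≠ t₂` and `s₁ ≠ s₂`. -/
def Ssol (M : Matrix (Fin 4) (Fin 4) ℂ) : Set (Fin 4 → ℂ) :=
  {x | Fmap M x = 0 ∧ x 0 ≠ x 1 ∧ x 2 ≠ x 3}

/-- The 4×4 Jacobian matrix of `F(·; M)` with respect to `(t₁, t₂, s₁, s₂)`. -/
def Jac (M : Matrix (Fin 4) (Fin 4) ℂ) (x : Fin 4 → ℂ) : Matrix (Fin 4) (Fin 4) ℂ :=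
  fun i j => deriv (fun z => Fmap M (Function.update x j z) i) (x j)

/-- A real matrix viewed as a complex matrix. -/
def cm (M : Matrix (Fin 4) (Fin 4) ℝ) : Matrix (Fin 4) (Fin 4) ℂ :=
  M.map Complex.ofReal

/-- A solution `(t₁, t₂, s₁, s₂)` is totally real if all coordinates are real. -/
def TotallyReal (x : Fin 4 → ℂ) : Prop := ∀ i, (x i).im = 0

/-- A solution `(t₁, t₂, s₁, s₂)` is partially real if `t₁, t₂ ∈ ℝ` and `s₁ ∉ ℝ` with
`s₂ = conj s₁`, or `s₁, s₂ ∈ ℝ` and `t₁ ∉ ℝ` with `t₂ = conj t₁`. -/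
def PartiallyReal (x : Fin 4 → ℂ) : Prop :=
  ((x 0).im = 0 ∧ (x 1).im = 0 ∧ (x 2).im ≠ 0 ∧ x 3 = (starRingEnd ℂ) (x 2)) ∨
  ((x 2).im = 0 ∧ (x 3).im = 0 ∧ (x 0).im ≠ 0 ∧ x 1 = (starRingEnd ℂ) (x 0))

/-- A solution `(t₁, t₂, s₁, s₂)` is minimally real if `t₁ ∉ ℝ`, `t₂ = conj t₁`,
`s₁ ∉ ℝ`, and `s₂ = conj s₁`. -/
def MinimallyReal (x : Fin 4 → ℂ) : Prop :=
  (x 0).im ≠ 0 ∧ x 1 = (starRingEnd ℂ) (x 0) ∧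
  (x 2).im ≠ 0 ∧ x 3 = (starRingEnd ℂ) (x 2)

theorem norm_mulVec_le_of_row_sum_le {n : Type*} [Fintype n] {B : Matrix n n ℂ} {c : ℝ}
    (hc : 0 ≤ c) (hB : ∀ i, ∑ j, ‖B i j‖ ≤ c) (h : n → ℂ) : ‖B *ᵥ h‖ ≤ c * ‖h‖ := by
  refine (pi_norm_le_iff_of_nonneg (by positivity)).2 fun i => ?_
  calc ‖∑ j, B i j * h j‖ ≤ ∑ j, ‖B i j‖ * ‖h‖ :=
        norm_sum_le_of_le _ fun j _ => by
          rw [norm_mul]; gcongr; exact norm_le_pi_norm h j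
    _ = (∑ j, ‖B i j‖) * ‖h‖ := (Finset.sum_mul ..).symm
    _ ≤ c * ‖h‖ := by gcongr; exact hB i

/-- A simplified Newton–Kantorovich theorem for maps with an explicit difference quotient
matrix `D`. -/
theorem exists_unique_zero_of_difference_quotient {n : Type*} [Fintype n] [DecidableEq n]
    {f : (n → ℂ) → n → ℂ} {D : (n → ℂ) → (n → ℂ) → Matrix n n ℂ} {A J : Matrix n n ℂ}
    {z : n → ℂ} {r a δ : ℝ} (hr : 0 ≤ r)
    (hD : ∀ w w', f w - f w' = D w w' *ᵥ (w - w')) (hA : A * J = 1)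
    (hδ : ∀ w ∈ Metric.closedBall z r, ∀ w' ∈ Metric.closedBall z r,
      ∀ i, ∑ j, ‖(J - D w w') i j‖ ≤ δ)
    (ha : ∀ i, ∑ j, ‖A i j‖ ≤ a) (haδ : a * δ ≤ 1 / 2) (ha0 : 0 ≤ a) (hδ0 : 0 ≤ δ)
    (hf : ‖A *ᵥ f z‖ ≤ r / 2) :
    ∃ w ∈ Metric.closedBall z r, f w = 0 ∧ IsUnit (D w w) ∧
      ∀ w' ∈ Metric.closedBall z r, f w' = 0 → w' = w := by
  have key : ∀ w ∈ Metric.closedBall z r, ∀ w' ∈ Metric.closedBall z r, ∀ h : n → ℂ,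
      ‖h - A *ᵥ (D w w' *ᵥ h)‖ ≤ 1 / 2 * ‖h‖ := fun w hw w' hw' h => by
    have e : h - A *ᵥ (D w w' *ᵥ h) = A *ᵥ ((J - D w w') *ᵥ h) := by
      rw [sub_mulVec, mulVec_sub, mulVec_mulVec _ A J, hA, one_mulVec]
    rw [e]
    calc _ ≤ a * ‖(J - D w w') *ᵥ h‖ := norm_mulVec_le_of_row_sum_le ha0 ha _
      _ ≤ a * (δ * ‖h‖) := by
        gcongr; exact norm_mulVec_le_of_row_sum_le hδ0 (hδ w hw w' hw') _
      _ = a * δ * ‖h‖ := by ring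
      _ ≤ _ := by gcongr
  have eq_zero : ∀ w ∈ Metric.closedBall z r, ∀ w' ∈ Metric.closedBall z r, ∀ h : n → ℂ,
      D w w' *ᵥ h = 0 → h = 0 := fun w hw w' hw' h h0 => by
    have := key w hw w' hw' h
    rw [h0, mulVec_zero, sub_zero] at this
    exact norm_le_zero_iff.1 (by linarith [norm_nonneg h])
  set T : (n → ℂ) → n → ℂ := fun w => w - A *ᵥ f w with hT
  have hzmem : z ∈ Metric.closedBall z r := Metric.mem_closedBall_self hr
  have hTdist : ∀ w ∈ Metric.closedBall z r, ∀ w' ∈ Metric.closedBall z r,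
      dist (T w) (T w') ≤ 1 / 2 * dist w w' := fun w hw w' hw' => by
    have e : T w - T w' = (w - w') - A *ᵥ (D w w' *ᵥ (w - w')) := by
      rw [← hD, mulVec_sub]; simp only [hT]; abel
    rw [dist_eq_norm, dist_eq_norm, e]
    exact key w hw w' hw' _
  have hTmaps : Set.MapsTo T (Metric.closedBall z r) (Metric.closedBall z r) := fun w hw => by
    have h1 := hTdist w hw z hzmem
    have h2 : dist (T z) z ≤ r / 2 := by
      rw [dist_eq_norm]; simpa [hT] using hf
    have h3 := Metric.mem_closedBall.1 hw
    rw [Metric.mem_closedBall]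
    linarith [dist_triangle (T w) (T z) z]
  have hTc : ContractingWith (1 / 2) (hTmaps.restrict T _ _) := by
    refine ⟨by rw [← NNReal.coe_lt_coe]; norm_num, LipschitzWith.of_dist_le_mul fun w w' => ?_⟩
    simpa [Subtype.dist_eq] using hTdist w w.2 w' w'.2
  obtain ⟨w, hw, hfix, -⟩ := hTc.exists_fixedPoint' Metric.isClosed_closedBall.isComplete
    hTmaps hzmem (edist_ne_top _ _)
  have hfw : f w = 0 := by
    have h1 : A *ᵥ f w = 0 := by simpa [hT, Function.IsFixedPt] using hfix
    have h2 := congrArg (fun v => J *ᵥ v) h1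
    simpa [mulVec_mulVec, mul_eq_one_comm.1 hA] using h2
  refine ⟨w, hw, hfw, ?_, fun w' hw' h0 => ?_⟩
  · rw [← mulVec_injective_iff_isUnit]
    intro h h' he
    exact sub_eq_zero.1 (eq_zero w hw w hw _ (by rw [mulVec_sub]; exact sub_eq_zero.2 he))
  · refine sub_eq_zero.1 (eq_zero w' hw' w hw _ ?_)
    rw [← hD, h0, hfw, sub_zero]

/-- Four elements of a type: a point, a row of a `4 × 4` matrix, or the rows of one. -/
structure Quad (α : Type) where
  a : α
  b : α
  c : α
  d : α

namespace Quad

variable {α β : Type}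

def vec (q : Quad α) : Fin 4 → α := ![q.a, q.b, q.c, q.d]

def ofVec (v : Fin 4 → α) : Quad α := ⟨v 0, v 1, v 2, v 3⟩

def map (f : α → β) (q : Quad α) : Quad β := ⟨f q.a, f q.b, f q.c, f q.d⟩

def mat (q : Quad (Quad α)) : Matrix (Fin 4) (Fin 4) α := Matrix.of fun i => (q.vec i).vec

@[simp] theorem vec_ofVec (v : Fin 4 → α) : (ofVec v).vec = v := by
  ext i; fin_cases i <;> rfl

@[simp] theorem ofVec_vec (q : Quad α) : ofVec q.vec = q := rfl

end Quad

section Equations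

variable {R S : Type} [CommRing R] [CommRing S]

/-- For the cubic with coefficients `m`, the constant coefficient of its remainder modulo
`s² - (u / N) s + v / N`, multiplied by `N²`; here `w = (x, y, u, v)`. -/
def remConst (N : R) (m w : Quad R) : R := N * (N * m.a) - N * (m.c * w.d) - m.d * (w.c * w.d)

/-- The linear coefficient of the same remainder, multiplied by `N²`. -/
def remLin (N : R) (m w : Quad R) : R :=
  N * (N * m.b) + N * (m.c * w.c) + m.d * (w.c * w.c - N * w.d)

/-- The equations for a line to be a common secant: `w = (x, y, u, v)` holds `N` times the
elementary symmetric functions of `t₁, t₂` and of `s₁, s₂`. -/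
def lineEqs (N : R) (M : Quad (Quad R)) (w : Quad R) : Quad R :=
  ⟨N * remConst N M.c w - w.a * remConst N M.b w + w.b * remConst N M.a w,
   N * remConst N M.d w - w.a * remConst N M.c w + w.b * remConst N M.b w,
   N * remLin N M.c w - w.a * remLin N M.b w + w.b * remLin N M.a w,
   N * remLin N M.d w - w.a * remLin N M.c w + w.b * remLin N M.b w⟩

/-- A row of the difference quotient of `lineEqs`. -/
def diffQuotRow (N x y : R) (p q pu qu ru pv qv rv : R) : Quad R :=
  ⟨-q, p, N * ru - x * qu + y * pu, N * rv - x * qv + y * pv⟩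

/-- A difference quotient matrix of `lineEqs`; on the diagonal it is the Jacobian matrix. -/
def diffQuot (N : R) (M : Quad (Quad R)) (w w' : Quad R) : Quad (Quad R) :=
  let f (m : Quad R) := remConst N m w
  let fu (m : Quad R) := -(m.d * w.d)
  let fv (m : Quad R) := -(N * m.c + m.d * w'.c)
  let g (m : Quad R) := remLin N m w
  let gu (m : Quad R) := N * m.c + m.d * (w.c + w'.c)
  let gv (m : Quad R) := -(N * m.d)
  let row := diffQuotRow N w'.a w'.b
  ⟨row (f M.a) (f M.b) (fu M.a) (fu M.b) (fu M.c) (fv M.a) (fv M.b) (fv M.c),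
   row (f M.b) (f M.c) (fu M.b) (fu M.c) (fu M.d) (fv M.b) (fv M.c) (fv M.d),
   row (g M.a) (g M.b) (gu M.a) (gu M.b) (gu M.c) (gv M.a) (gv M.b) (gv M.c),
   row (g M.b) (g M.c) (gu M.b) (gu M.c) (gu M.d) (gv M.b) (gv M.c) (gv M.d)⟩

theorem lineEqs_sub (N : R) (M : Quad (Quad R)) (w w' : Quad R) :
    (lineEqs N M w).vec - (lineEqs N M w').vec
      = (diffQuot N M w w').mat *ᵥ (w.vec - w'.vec) := by
  ext i
  fin_cases i <;>
  · simp [Quad.mat, Quad.vec, lineEqs, diffQuot, diffQuotRow, remConst, remLin, mulVec, dotProduct,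
      Fin.sum_univ_four]
    ring

/-- The `2 × 2` minors of two rows. -/
structure Minors (R : Type) where
  ab : R
  ac : R
  ad : R
  bc : R
  bd : R
  cd : R

def minors (p q : Quad R) : Minors R :=
  ⟨p.a * q.b - q.a * p.b, p.a * q.c - q.a * p.c, p.a * q.d - q.a * p.d,
   p.b * q.c - q.b * p.c, p.b * q.d - q.b * p.d, p.c * q.d - q.c * p.d⟩

/-- Laplace expansion of a `4 × 4` determinant along two pairs of rows. -/
def laplaceDet (s c : Minors R) : R :=
  s.ab * c.cd - s.ac * c.bd + s.ad * c.bc + s.bc * c.ad - s.bd * c.ac + s.cd * c.ab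

def detQuad (m : Quad (Quad R)) : R := laplaceDet (minors m.a m.b) (minors m.c m.d)

def adjQuadAux (m : Quad (Quad R)) (s c : Minors R) : Quad (Quad R) :=
  ⟨⟨m.b.b * c.cd - m.b.c * c.bd + m.b.d * c.bc, -(m.a.b * c.cd) + m.a.c * c.bd - m.a.d * c.bc,
    m.d.b * s.cd - m.d.c * s.bd + m.d.d * s.bc, -(m.c.b * s.cd) + m.c.c * s.bd - m.c.d * s.bc⟩,
   ⟨-(m.b.a * c.cd) + m.b.c * c.ad - m.b.d * c.ac, m.a.a * c.cd - m.a.c * c.ad + m.a.d * c.ac,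
    -(m.d.a * s.cd) + m.d.c * s.ad - m.d.d * s.ac, m.c.a * s.cd - m.c.c * s.ad + m.c.d * s.ac⟩,
   ⟨m.b.a * c.bd - m.b.b * c.ad + m.b.d * c.ab, -(m.a.a * c.bd) + m.a.b * c.ad - m.a.d * c.ab,
    m.d.a * s.bd - m.d.b * s.ad + m.d.d * s.ab, -(m.c.a * s.bd) + m.c.b * s.ad - m.c.d * s.ab⟩,
   ⟨-(m.b.a * c.bc) + m.b.b * c.ac - m.b.c * c.ab, m.a.a * c.bc - m.a.b * c.ac + m.a.c * c.ab,
    -(m.d.a * s.bc) + m.d.b * s.ac - m.d.c * s.ab, m.c.a * s.bc - m.c.b * s.ac + m.c.c * s.ab⟩⟩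

/-- The adjugate of a `4 × 4` matrix. -/
def adjQuad (m : Quad (Quad R)) : Quad (Quad R) :=
  adjQuadAux m (minors m.a m.b) (minors m.c m.d)

theorem adjQuad_mul (m : Quad (Quad R)) : (adjQuad m).mat * m.mat = detQuad m • 1 := by
  ext i j
  fin_cases i <;> fin_cases j <;>
  · simp [Quad.mat, Quad.vec, adjQuad, adjQuadAux, detQuad, laplaceDet, minors, Matrix.mul_apply,
      Fin.sum_univ_four]
    ring

variable (φ : R →+* S)

theorem map_lineEqs (N : R) (M : Quad (Quad R)) (w : Quad R) :
    (lineEqs N M w).map φ = lineEqs (φ N) (M.map (Quad.map φ)) (w.map φ) := by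
  simp [lineEqs, Quad.map, remConst, remLin]

theorem map_diffQuot (N : R) (M : Quad (Quad R)) (w w' : Quad R) :
    (diffQuot N M w w').map (Quad.map φ)
      = diffQuot (φ N) (M.map (Quad.map φ)) (w.map φ) (w'.map φ) := by
  simp [diffQuot, diffQuotRow, Quad.map, remConst, remLin]

theorem map_adjQuad (m : Quad (Quad R)) :
    (adjQuad m).map (Quad.map φ) = adjQuad (m.map (Quad.map φ)) := by
  simp [adjQuad, adjQuadAux, minors, Quad.map]

theorem map_detQuad (m : Quad (Quad R)) : φ (detQuad m) = detQuad (m.map (Quad.map φ)) := by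
  simp [detQuad, laplaceDet, minors, Quad.map]

end Equations

theorem norm_mul_sub_mul_le {p q p₀ q₀ : ℂ} {r X Q δ : ℝ} (hp : ‖p - p₀‖ ≤ r) (hp₀ : ‖p₀‖ ≤ X)
    (hq : ‖q‖ ≤ Q) (hq₀ : ‖q - q₀‖ ≤ δ) : ‖p * q - p₀ * q₀‖ ≤ r * Q + X * δ := by
  have hr := (norm_nonneg _).trans hp
  have hX := (norm_nonneg _).trans hp₀
  calc ‖p * q - p₀ * q₀‖ = ‖(p - p₀) * q + p₀ * (q - q₀)‖ := by ring_nf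
    _ ≤ ‖p - p₀‖ * ‖q‖ + ‖p₀‖ * ‖q - q₀‖ := by
      simpa only [norm_mul] using norm_add_le ((p - p₀) * q) (p₀ * (q - q₀))
    _ ≤ _ := by gcongr

theorem norm_sub_add_le_of_le {x y z : ℂ} {a b c : ℝ} (hx : ‖x‖ ≤ a) (hy : ‖y‖ ≤ b) (hz : ‖z‖ ≤ c) :
    ‖x - y + z‖ ≤ a + b + c :=
  (norm_add_le_of_le (norm_sub_le_of_le hx hy) hz)

theorem sum_norm_diffQuotRow_sub_le
    {N x y x₀ y₀ p q pu qu ru pv qv rv p₀ q₀ pu₀ qu₀ ru₀ pv₀ qv₀ rv₀ : ℂ}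
    {n r X δ δu δv U V : ℝ} (hN : ‖N‖ ≤ n) (hx : ‖x - x₀‖ ≤ r) (hy : ‖y - y₀‖ ≤ r)
    (hx₀ : ‖x₀‖ ≤ X) (hy₀ : ‖y₀‖ ≤ X) (hp : ‖p - p₀‖ ≤ δ) (hq : ‖q - q₀‖ ≤ δ)
    (hpu : ‖pu - pu₀‖ ≤ δu) (hqu : ‖qu - qu₀‖ ≤ δu) (hru : ‖ru - ru₀‖ ≤ δu)
    (hpu' : ‖pu‖ ≤ U) (hqu' : ‖qu‖ ≤ U)
    (hpv : ‖pv - pv₀‖ ≤ δv) (hqv : ‖qv - qv₀‖ ≤ δv) (hrv : ‖rv - rv₀‖ ≤ δv)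
    (hpv' : ‖pv‖ ≤ V) (hqv' : ‖qv‖ ≤ V) :
    ∑ j, ‖(diffQuotRow N x₀ y₀ p₀ q₀ pu₀ qu₀ ru₀ pv₀ qv₀ rv₀).vec j
        - (diffQuotRow N x y p q pu qu ru pv qv rv).vec j‖
      ≤ 2 * δ + (n * δu + 2 * (r * U + X * δu)) + (n * δv + 2 * (r * V + X * δv)) := by
  have entry : ∀ {p q s p₀ q₀ s₀ : ℂ} {δ Q : ℝ}, ‖p - p₀‖ ≤ δ → ‖q - q₀‖ ≤ δ → ‖s - s₀‖ ≤ δ →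
      ‖p‖ ≤ Q → ‖q‖ ≤ Q → ‖N * s₀ - x₀ * q₀ + y₀ * p₀ - (N * s - x * q + y * p)‖
        ≤ n * δ + 2 * (r * Q + X * δ) := fun {p q s p₀ q₀ s₀ δ Q} h₁ h₂ h₃ h₄ h₅ => by
    rw [norm_sub_rev]
    have e : N * s - x * q + y * p - (N * s₀ - x₀ * q₀ + y₀ * p₀)
      = N * (s - s₀) - (x * q - x₀ * q₀) + (y * p - y₀ * p₀) := by ring
    rw [e]
    have hs : ‖N * (s - s₀)‖ ≤ n * δ := by
      rw [norm_mul]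
      exact mul_le_mul hN h₃ (norm_nonneg _) ((norm_nonneg _).trans hN)
    have := norm_sub_add_le_of_le hs (norm_mul_sub_mul_le hx hx₀ h₅ h₂)
      (norm_mul_sub_mul_le hy hy₀ h₄ h₁)
    linarith
  have hu := entry hpu hqu hru hpu' hqu'
  have hv := entry hpv hqv hrv hpv' hqv'
  have hq' : ‖-q₀ - -q‖ ≤ δ := by rwa [neg_sub_neg]
  rw [norm_sub_rev] at hp
  simp only [Fin.sum_univ_four, Quad.vec, diffQuotRow, cons_val]
  linarith

section Bounds

variable {N : ℂ} {n C b r : ℝ} {m w w' z : Quad ℂ}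

theorem norm_remConst_sub_le (hN : ‖N‖ ≤ n) (hm : ‖m.vec‖ ≤ C) (hw : ‖w.vec‖ ≤ b * n)
    (hz : ‖z.vec‖ ≤ b * n) (hwz : ‖w.vec - z.vec‖ ≤ r) :
    ‖remConst N m w - remConst N m z‖ ≤ n * C * r * (2 + 2 * b) := by
  have hn := (norm_nonneg _).trans hN
  have hC := (norm_nonneg _).trans hm
  have hr := (norm_nonneg _).trans hwz
  have hmc : ‖m.c‖ ≤ C := (norm_le_pi_norm m.vec 2).trans hm
  have hmd : ‖m.d‖ ≤ C := (norm_le_pi_norm m.vec 3).trans hm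
  have h₁ : ‖w.d - z.d‖ ≤ r := (norm_le_pi_norm (w.vec - z.vec) 3).trans hwz
  have h₂ := norm_mul_sub_mul_le ((norm_le_pi_norm (w.vec - z.vec) 2).trans hwz)
    ((norm_le_pi_norm z.vec 2).trans hz) ((norm_le_pi_norm w.vec 3).trans hw) h₁
  change ‖w.c * w.d - z.c * z.d‖ ≤ r * (b * n) + b * n * r at h₂
  calc ‖remConst N m w - remConst N m z‖
      = ‖N * (m.c * (w.d - z.d)) + m.d * (w.c * w.d - z.c * z.d)‖ := by
        rw [← norm_neg]; simp only [remConst]; ring_nf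
    _ ≤ n * (C * r) + C * (r * (b * n) + b * n * r) := by
        refine norm_add_le_of_le ?_ ?_ <;> simp only [norm_mul] <;> gcongr
    _ ≤ _ := by nlinarith [mul_nonneg (mul_nonneg hn hC) hr]

theorem norm_remLin_sub_le (hN : ‖N‖ ≤ n) (hm : ‖m.vec‖ ≤ C) (hw : ‖w.vec‖ ≤ b * n)
    (hz : ‖z.vec‖ ≤ b * n) (hwz : ‖w.vec - z.vec‖ ≤ r) :
    ‖remLin N m w - remLin N m z‖ ≤ n * C * r * (2 + 2 * b) := by
  have hn := (norm_nonneg _).trans hN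
  have hC := (norm_nonneg _).trans hm
  have hmc : ‖m.c‖ ≤ C := (norm_le_pi_norm m.vec 2).trans hm
  have hmd : ‖m.d‖ ≤ C := (norm_le_pi_norm m.vec 3).trans hm
  have h₁ : ‖w.c - z.c‖ ≤ r := (norm_le_pi_norm (w.vec - z.vec) 2).trans hwz
  have h₃ : ‖w.d - z.d‖ ≤ r := (norm_le_pi_norm (w.vec - z.vec) 3).trans hwz
  have h₂ := norm_mul_sub_mul_le h₁
    ((norm_le_pi_norm z.vec 2).trans hz) ((norm_le_pi_norm w.vec 2).trans hw) h₁
  change ‖w.c * w.c - z.c * z.c‖ ≤ r * (b * n) + b * n * r at h₂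
  calc ‖remLin N m w - remLin N m z‖
      = ‖N * (m.c * (w.c - z.c)) + m.d * ((w.c * w.c - z.c * z.c) - N * (w.d - z.d))‖ := by
        simp only [remLin]; ring_nf
    _ ≤ n * (C * r) + C * (r * (b * n) + b * n * r + n * r) := by
        refine norm_add_le_of_le ?_ ?_
        · simp only [norm_mul]; gcongr
        · rw [norm_mul]
          gcongr
          refine norm_sub_le_of_le h₂ ?_
          rw [norm_mul]; gcongr
    _ = _ := by ring

theorem sum_norm_diffQuot_sub_le {M : Quad (Quad ℂ)} (hN : ‖N‖ ≤ n)
    (hM : ∀ i, ‖(M.vec i).vec‖ ≤ C) (hw : ‖w.vec‖ ≤ b * n) (hw' : ‖w'.vec‖ ≤ b * n)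
    (hz : ‖z.vec‖ ≤ b * n) (hwz : ‖w.vec - z.vec‖ ≤ r) (hwz' : ‖w'.vec - z.vec‖ ≤ r) (i : Fin 4) :
    ∑ j, ‖((diffQuot N M z z).mat - (diffQuot N M w w').mat) i j‖
      ≤ n * C * r * (10 + 12 * b) := by
  have hn := (norm_nonneg _).trans hN
  have hC := (norm_nonneg _).trans (hM 0)
  have hr := (norm_nonneg _).trans hwz
  have hx : ‖w'.a - z.a‖ ≤ r := (norm_le_pi_norm (w'.vec - z.vec) 0).trans hwz'
  have hy : ‖w'.b - z.b‖ ≤ r := (norm_le_pi_norm (w'.vec - z.vec) 1).trans hwz'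
  have hu' : ‖w'.c - z.c‖ ≤ r := (norm_le_pi_norm (w'.vec - z.vec) 2).trans hwz'
  have hu : ‖w.c - z.c‖ ≤ r := (norm_le_pi_norm (w.vec - z.vec) 2).trans hwz
  have hv : ‖w.d - z.d‖ ≤ r := (norm_le_pi_norm (w.vec - z.vec) 3).trans hwz
  have hx₀ : ‖z.a‖ ≤ b * n := (norm_le_pi_norm z.vec 0).trans hz
  have hy₀ : ‖z.b‖ ≤ b * n := (norm_le_pi_norm z.vec 1).trans hz
  have hwc : ‖w.c‖ ≤ b * n := (norm_le_pi_norm w.vec 2).trans hw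
  have hwd : ‖w.d‖ ≤ b * n := (norm_le_pi_norm w.vec 3).trans hw
  have hwc' : ‖w'.c‖ ≤ b * n := (norm_le_pi_norm w'.vec 2).trans hw'
  have hf : ∀ k, ‖remConst N (M.vec k) w - remConst N (M.vec k) z‖ ≤ n * C * r * (2 + 2 * b) :=
    fun k => norm_remConst_sub_le hN (hM k) hw hz hwz
  have hg : ∀ k, ‖remLin N (M.vec k) w - remLin N (M.vec k) z‖ ≤ n * C * r * (2 + 2 * b) :=
    fun k => norm_remLin_sub_le hN (hM k) hw hz hwz
  have hc : ∀ k, ‖(M.vec k).c‖ ≤ C := fun k => (norm_le_pi_norm (M.vec k).vec 2).trans (hM k)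
  have hd : ∀ k, ‖(M.vec k).d‖ ≤ C := fun k => (norm_le_pi_norm (M.vec k).vec 3).trans (hM k)
  have fu : ∀ k, ‖-((M.vec k).d * w.d) - -((M.vec k).d * z.d)‖ ≤ C * r := fun k => by
    rw [neg_sub_neg, ← mul_sub, norm_mul, norm_sub_rev]
    gcongr
    exact hd k
  have fu' : ∀ k, ‖-((M.vec k).d * w.d)‖ ≤ C * (b * n) := fun k => by
    rw [norm_neg, norm_mul]
    gcongr
    exact hd k
  have fv : ∀ k, ‖-(N * (M.vec k).c + (M.vec k).d * w'.c)
      - -(N * (M.vec k).c + (M.vec k).d * z.c)‖ ≤ C * r := fun k => by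
    rw [neg_sub_neg, add_sub_add_left_eq_sub, ← mul_sub, norm_mul, norm_sub_rev]
    gcongr
    exact hd k
  have fv' : ∀ k, ‖-(N * (M.vec k).c + (M.vec k).d * w'.c)‖ ≤ n * C + C * (b * n) := fun k => by
    rw [norm_neg]
    refine norm_add_le_of_le ?_ ?_ <;> rw [norm_mul] <;> gcongr
    exacts [hc k, hd k]
  have gu : ∀ k, ‖N * (M.vec k).c + (M.vec k).d * (w.c + w'.c)
      - (N * (M.vec k).c + (M.vec k).d * (z.c + z.c))‖ ≤ C * (r + r) := fun k => by
    rw [add_sub_add_left_eq_sub, ← mul_sub, norm_mul, add_sub_add_comm]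
    gcongr
    exacts [hd k, norm_add_le_of_le hu hu']
  have gu' : ∀ k, ‖N * (M.vec k).c + (M.vec k).d * (w.c + w'.c)‖
      ≤ n * C + C * (b * n + b * n) := fun k => by
    refine norm_add_le_of_le ?_ ?_ <;> rw [norm_mul] <;> gcongr
    exacts [hc k, hd k, norm_add_le_of_le hwc hwc']
  have gv : ∀ k, ‖-(N * (M.vec k).d) - -(N * (M.vec k).d)‖ ≤ 0 := fun k => by simp
  have gv' : ∀ k, ‖-(N * (M.vec k).d)‖ ≤ n * C := fun k => by
    rw [norm_neg, norm_mul]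
    gcongr
    exact hd k
  have hconst : ∀ k l o,
      ∑ j, ‖(diffQuotRow N z.a z.b (remConst N (M.vec k) z) (remConst N (M.vec l) z)
          (-((M.vec k).d * z.d)) (-((M.vec l).d * z.d)) (-((M.vec o).d * z.d))
          (-(N * (M.vec k).c + (M.vec k).d * z.c)) (-(N * (M.vec l).c + (M.vec l).d * z.c))
          (-(N * (M.vec o).c + (M.vec o).d * z.c))).vec j
        - (diffQuotRow N w'.a w'.b (remConst N (M.vec k) w) (remConst N (M.vec l) w)
          (-((M.vec k).d * w.d)) (-((M.vec l).d * w.d)) (-((M.vec o).d * w.d))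
          (-(N * (M.vec k).c + (M.vec k).d * w'.c)) (-(N * (M.vec l).c + (M.vec l).d * w'.c))
          (-(N * (M.vec o).c + (M.vec o).d * w'.c))).vec j‖ ≤ n * C * r * (10 + 12 * b) :=
    fun k l o => (sum_norm_diffQuotRow_sub_le hN hx hy hx₀ hy₀ (hf k) (hf l) (fu k) (fu l) (fu o)
      (fu' k) (fu' l) (fv k) (fv l) (fv o) (fv' k) (fv' l)).trans (by
        nlinarith [mul_nonneg (mul_nonneg hn hC) hr])
  have hlin : ∀ k l o,
      ∑ j, ‖(diffQuotRow N z.a z.b (remLin N (M.vec k) z) (remLin N (M.vec l) z)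
          (N * (M.vec k).c + (M.vec k).d * (z.c + z.c))
          (N * (M.vec l).c + (M.vec l).d * (z.c + z.c))
          (N * (M.vec o).c + (M.vec o).d * (z.c + z.c))
          (-(N * (M.vec k).d)) (-(N * (M.vec l).d)) (-(N * (M.vec o).d))).vec j
        - (diffQuotRow N w'.a w'.b (remLin N (M.vec k) w) (remLin N (M.vec l) w)
          (N * (M.vec k).c + (M.vec k).d * (w.c + w'.c))
          (N * (M.vec l).c + (M.vec l).d * (w.c + w'.c))
          (N * (M.vec o).c + (M.vec o).d * (w.c + w'.c))
          (-(N * (M.vec k).d)) (-(N * (M.vec l).d)) (-(N * (M.vec o).d))).vec j‖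
        ≤ n * C * r * (10 + 12 * b) :=
    fun k l o => (sum_norm_diffQuotRow_sub_le hN hx hy hx₀ hy₀ (hg k) (hg l) (gu k) (gu l) (gu o)
      (gu' k) (gu' l) (gv k) (gv l) (gv o) (gv' k) (gv' l)).trans (by
        nlinarith [mul_nonneg (mul_nonneg hn hC) hr])
  fin_cases i
  exacts [hconst 0 1 2, hconst 1 2 3, hlin 0 1 2, hlin 1 2 3]

end Bounds

/-- The sum of the sizes of the entries. -/
def Quad.sumSize {R : Type} (size : R → ℕ) (q : Quad R) : ℕ :=
  size q.a + size q.b + size q.c + size q.d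

def Quad.dot {R : Type} [CommRing R] (p q : Quad R) : R :=
  p.a * q.a + p.b * q.b + p.c * q.c + p.d * q.d

/-- The bound checked for one row of the inverse Jacobian matrix in a Newton–Kantorovich
certificate. -/
def rowCertified {R : Type} [CommRing R] (size : R → ℕ) (k r d : ℕ) (F A : Quad R) : Bool :=
  decide (4 * (A.sumSize size * k) ≤ d) && decide (4 * size (A.dot F) ≤ r * d)

/-- A Newton–Kantorovich certificate for a zero of `lineEqs` within distance `r` of `z`, where
`b * n` bounds the coordinates of the zero and `C` bounds the entries of the matrix. -/
def certified {R : Type} [CommRing R] (size : R → ℕ) (n b C r : ℕ) (M : Quad (Quad R))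
    (z : Quad R) : Bool :=
  let F := lineEqs (n : R) M z
  let J := diffQuot (n : R) M z z
  let A := adjQuad J
  let d := size (detQuad J)
  let k := n * C * r * (10 + 12 * b)
  decide (0 < d) && decide (z.sumSize size + r ≤ b * n) &&
    (rowCertified size k r d F A.a && rowCertified size k r d F A.b &&
      rowCertified size k r d F A.c && rowCertified size k r d F A.d)

theorem Quad.norm_vec_map_le {R : Type} {φ : R → ℂ} {size : R → ℕ} (h : ∀ x, ‖φ x‖ ≤ size x)
    (q : Quad R) : ‖(q.map φ).vec‖ ≤ q.sumSize size := by
  have ha := h q.a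
  have hb := h q.b
  have hc := h q.c
  have hd := h q.d
  refine (pi_norm_le_iff_of_nonneg (by positivity)).2 fun i => ?_
  simp only [Quad.sumSize, Nat.cast_add]
  fin_cases i <;> simp only [Quad.vec, Quad.map] <;>
    simp <;> linarith [Nat.cast_nonneg (α := ℝ) (size q.a), Nat.cast_nonneg (α := ℝ) (size q.b),
    Nat.cast_nonneg (α := ℝ) (size q.c), Nat.cast_nonneg (α := ℝ) (size q.d)]

theorem Quad.sum_norm_vec_map_le {R : Type} {φ : R → ℂ} {size : R → ℕ} (h : ∀ x, ‖φ x‖ ≤ size x)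
    (q : Quad R) : ∑ j, ‖(q.map φ).vec j‖ ≤ q.sumSize size := by
  have ha := h q.a
  have hb := h q.b
  have hc := h q.c
  have hd := h q.d
  simp only [Fin.sum_univ_four, Quad.vec, Quad.map, cons_val, Quad.sumSize, Nat.cast_add]
  linarith

theorem Quad.vec_map {α β : Type} (f : α → β) (q : Quad α) (i : Fin 4) :
    (q.map f).vec i = f (q.vec i) := by
  fin_cases i <;> rfl

theorem Quad.sum_mul_vec_map {R : Type} [CommRing R] (φ : R →+* ℂ) (p q : Quad R) :
    ∑ j, (p.map φ).vec j * (q.map φ).vec j = φ (p.dot q) := by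
  simp [Fin.sum_univ_four, Quad.vec, Quad.map, Quad.dot]

theorem exists_unique_zero_of_certified {R : Type} [CommRing R] {φ : R →+* ℂ} {size : R → ℕ}
    (h₁ : ∀ x, ‖φ x‖ ≤ size x) (h₂ : ∀ x, size x ≤ 2 * ‖φ x‖) {n b C r : ℕ}
    (hn : 0 < n * C * r) {M : Quad (Quad R)} {z : Quad R}
    (hM : ∀ i, ‖((M.map (Quad.map φ)).vec i).vec‖ ≤ C)
    (hz : certified size n b C r M z) :
    ∃ w : Quad ℂ, ‖w.vec - (z.map φ).vec‖ ≤ r ∧ ‖w.vec‖ ≤ b * n ∧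
      (lineEqs (n : ℂ) (M.map (Quad.map φ)) w).vec = 0 ∧
      IsUnit (diffQuot (n : ℂ) (M.map (Quad.map φ)) w w).mat ∧
      ∀ w' : Quad ℂ, ‖w'.vec - (z.map φ).vec‖ ≤ r →
        (lineEqs (n : ℂ) (M.map (Quad.map φ)) w').vec = 0 → w' = w := by
  simp only [certified, rowCertified, Bool.and_eq_true, decide_eq_true_eq] at hz
  obtain ⟨⟨hd, hb⟩, hrows⟩ := hz
  set J := diffQuot (n : R) M z z with hJ
  set M' := M.map (Quad.map φ) with hM'
  have hJ' : J.map (Quad.map φ) = diffQuot (n : ℂ) M' (z.map φ) (z.map φ) := by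
    rw [hJ, map_diffQuot, map_natCast]
  set d := size (detQuad J) with hdd
  set k : ℕ := n * C * r * (10 + 12 * b) with hk
  have hkpos : (0 : ℝ) < k := by
    exact_mod_cast Nat.mul_pos hn (by positivity)
  set D : ℂ := φ (detQuad J) with hD
  have hD2 : (d : ℝ) ≤ 2 * ‖D‖ := h₂ _
  have hDpos : 0 < ‖D‖ := by
    have : (0 : ℝ) < d := by exact_mod_cast hd
    linarith
  have hball : ∀ w : Fin 4 → ℂ, w ∈ Metric.closedBall (z.map φ).vec (r : ℝ) → ‖w‖ ≤ b * n := by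
    intro w hw
    rw [mem_closedBall_iff_norm] at hw
    have h3 := Quad.norm_vec_map_le h₁ z
    have h4 : (z.sumSize size : ℝ) + r ≤ b * n := by exact_mod_cast hb
    calc ‖w‖ = ‖w - (z.map φ).vec + (z.map φ).vec‖ := by rw [sub_add_cancel]
      _ ≤ r + z.sumSize size := norm_add_le_of_le hw h3
      _ ≤ _ := by linarith
  set A' := (adjQuad J).map (Quad.map φ) with hA'
  have hrow : ∀ i, 4 * (((adjQuad J).vec i).sumSize size * k) ≤ d ∧
      4 * size (((adjQuad J).vec i).dot (lineEqs (n : R) M z)) ≤ r * d := by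
    obtain ⟨⟨⟨ha, hb⟩, hc⟩, hd⟩ := hrows
    intro i
    fin_cases i
    exacts [ha, hb, hc, hd]
  have hA'i : ∀ i, A'.vec i = ((adjQuad J).vec i).map φ := Quad.vec_map _ _
  have hinv : (D⁻¹ • A'.mat) * (diffQuot (n : ℂ) M' (z.map φ) (z.map φ)).mat = 1 := by
    rw [hA', map_adjQuad, hJ', Matrix.smul_mul, adjQuad_mul, ← hJ', ← map_detQuad, ← hD, smul_smul,
      inv_mul_cancel₀ (norm_pos_iff.1 hDpos), one_smul]
  have hF : ((lineEqs (n : R) M z).map φ) = lineEqs (n : ℂ) M' (z.map φ) := by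
    rw [map_lineEqs, map_natCast]
  obtain ⟨w, hw, hw0, hwu, hwuniq⟩ := exists_unique_zero_of_difference_quotient (n := Fin 4)
    (f := fun w => (lineEqs (n : ℂ) M' (.ofVec w)).vec)
    (D := fun w w' => (diffQuot (n : ℂ) M' (.ofVec w) (.ofVec w')).mat)
    (A := D⁻¹ • A'.mat) (J := (diffQuot (n : ℂ) M' (z.map φ) (z.map φ)).mat)
    (z := (z.map φ).vec) (r := r) (a := (2 * k : ℝ)⁻¹) (δ := k) (Nat.cast_nonneg r)
    (fun w w' => by simpa using lineEqs_sub (n : ℂ) M' (.ofVec w) (.ofVec w')) hinv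
    (fun w hw w' hw' i => by
      have := sum_norm_diffQuot_sub_le (N := n) (n := n) (b := b) (C := C) (r := r)
        (w := .ofVec w) (w' := .ofVec w') (z := z.map φ) (by simp) hM
        (by simpa using hball w hw) (by simpa using hball w' hw')
        (hball _ (Metric.mem_closedBall_self (Nat.cast_nonneg r)))
        (mem_closedBall_iff_norm.1 hw)
        (mem_closedBall_iff_norm.1 hw') i
      rw [hk]; push_cast
      exact this)
    (fun i => by
      have h5 : ∑ j, ‖(D⁻¹ • A'.mat) i j‖ = ‖D‖⁻¹ * ∑ j, ‖(A'.vec i).vec j‖ := by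
        simp [Finset.mul_sum, Quad.mat]
      have h6 : ∑ j, ‖(A'.vec i).vec j‖ ≤ ((adjQuad J).vec i).sumSize size := by
        rw [hA'i]; exact Quad.sum_norm_vec_map_le h₁ _
      have h7 : 4 * ((((adjQuad J).vec i).sumSize size : ℝ) * k) ≤ d := by
        exact_mod_cast (hrow i).1
      rw [h5, inv_mul_le_iff₀ hDpos, ← div_eq_mul_inv, le_div_iff₀ (by positivity)]
      nlinarith)
    (by field_simp; rfl)
    (by positivity) (Nat.cast_nonneg k)
    (by
      refine (pi_norm_le_iff_of_nonneg (by positivity)).2 fun i => ?_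
      have h5 : ((D⁻¹ • A'.mat) *ᵥ (lineEqs (n : ℂ) M' (z.map φ)).vec) i
          = D⁻¹ * φ (((adjQuad J).vec i).dot (lineEqs (n : R) M z)) := by
        rw [← Quad.sum_mul_vec_map, ← hA'i, hF, Matrix.smul_mulVec]
        rfl
      have h6 : 4 * (size (((adjQuad J).vec i).dot (lineEqs (n : R) M z)) : ℝ) ≤ r * d := by
        exact_mod_cast (hrow i).2
      have h7 := h₁ (((adjQuad J).vec i).dot (lineEqs (n : R) M z))
      rw [Quad.ofVec_vec, h5, norm_mul, norm_inv, inv_mul_le_iff₀ hDpos]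
      nlinarith [Nat.cast_nonneg (α := ℝ) r])
  refine ⟨.ofVec w, ?_, ?_, hw0, hwu, fun w' h h' => ?_⟩
  · exact mem_closedBall_iff_norm.1 hw
  · simpa using hball w hw
  · rw [← hwuniq w'.vec (mem_closedBall_iff_norm.2 h) h', Quad.ofVec_vec]

/-- The coefficients of `1, u, v, u², u * v, v²` of a quadratic polynomial. -/
structure Quadric (R : Type) where
  one : R
  u : R
  v : R
  uu : R
  uv : R
  vv : R

/-- Five elements of a type: the coefficients of a binary quartic form, or a list of such. -/
structure Quint (α : Type) where
  a : α
  b : α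
  c : α
  d : α
  e : α

def Quint.vec {α : Type} (q : Quint α) : Fin 5 → α := ![q.a, q.b, q.c, q.d, q.e]

def Quint.map {α β : Type} (f : α → β) (q : Quint α) : Quint β :=
  ⟨f q.a, f q.b, f q.c, f q.d, f q.e⟩

def Quint.mat {α : Type} (q : Quint (Quint α)) : Matrix (Fin 5) (Fin 5) α :=
  Matrix.of fun i => (q.vec i).vec

section

variable {R S : Type} [CommRing R] [CommRing S]

namespace Quadric

def eval (p : Quadric R) (u v : R) : R :=
  p.one + p.u * u + p.v * v + p.uu * u ^ 2 + p.uv * (u * v) + p.vv * v ^ 2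

def add (p q : Quadric R) : Quadric R :=
  ⟨p.one + q.one, p.u + q.u, p.v + q.v, p.uu + q.uu, p.uv + q.uv, p.vv + q.vv⟩

theorem eval_add (p q : Quadric R) (u v : R) : (p.add q).eval u v = p.eval u v + q.eval u v := by
  simp only [eval, add]; ring

/-- The leading form of `p * q - r * s`. -/
def leading (p q r s : Quadric R) : Quint R :=
  ⟨p.uu * q.uu - r.uu * s.uu,
   p.uu * q.uv + p.uv * q.uu - (r.uu * s.uv + r.uv * s.uu),
   p.uu * q.vv + p.uv * q.uv + p.vv * q.uu - (r.uu * s.vv + r.uv * s.uv + r.vv * s.uu),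
   p.uv * q.vv + p.vv * q.uv - (r.uv * s.vv + r.vv * s.uv),
   p.vv * q.vv - r.vv * s.vv⟩

end Quadric

/-- The polynomial in `u, v` whose value is the minor formed by the remainders of two cubics
modulo `s² - u s + v`. -/
def remainderMinor (p q : Quad R) : Quadric R :=
  let m := minors p q
  ⟨m.ab, m.ac, m.bc - m.ad, m.ad, m.bd, m.cd⟩

theorem eval_remainderMinor (p q w : Quad R) :
    (remainderMinor p q).eval w.c w.d
      = remConst 1 p w * remLin 1 q w - remConst 1 q w * remLin 1 p w := by
  simp only [remainderMinor, Quadric.eval, minors, remConst, remLin]; ring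

def leadingForms (M : Quad (Quad R)) : Quint (Quint R) :=
  let z₀₀ := remainderMinor M.a M.b
  let z₀₁ := remainderMinor M.a M.c
  let z₀₂ := remainderMinor M.b M.c
  let z₁₁ := (remainderMinor M.a M.d).add (remainderMinor M.b M.c)
  let z₁₂ := remainderMinor M.b M.d
  let z₂₂ := remainderMinor M.c M.d
  ⟨Quadric.leading z₀₀ z₁₁ z₀₁ z₀₁, Quadric.leading z₀₀ z₁₂ z₀₁ z₀₂,
   Quadric.leading z₀₀ z₂₂ z₀₂ z₀₂,
   Quadric.leading z₀₁ z₂₂ z₀₂ z₁₂, Quadric.leading z₁₁ z₂₂ z₁₂ z₁₂⟩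

/-- Expansion of a `5 × 5` determinant along the first row. -/
def detQuint (m : Quint (Quint R)) : R :=
  m.a.a * detQuad ⟨⟨m.b.b, m.b.c, m.b.d, m.b.e⟩, ⟨m.c.b, m.c.c, m.c.d, m.c.e⟩,
    ⟨m.d.b, m.d.c, m.d.d, m.d.e⟩, ⟨m.e.b, m.e.c, m.e.d, m.e.e⟩⟩
  - m.a.b * detQuad ⟨⟨m.b.a, m.b.c, m.b.d, m.b.e⟩, ⟨m.c.a, m.c.c, m.c.d, m.c.e⟩,
    ⟨m.d.a, m.d.c, m.d.d, m.d.e⟩, ⟨m.e.a, m.e.c, m.e.d, m.e.e⟩⟩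
  + m.a.c * detQuad ⟨⟨m.b.a, m.b.b, m.b.d, m.b.e⟩, ⟨m.c.a, m.c.b, m.c.d, m.c.e⟩,
    ⟨m.d.a, m.d.b, m.d.d, m.d.e⟩, ⟨m.e.a, m.e.b, m.e.d, m.e.e⟩⟩
  - m.a.d * detQuad ⟨⟨m.b.a, m.b.b, m.b.c, m.b.e⟩, ⟨m.c.a, m.c.b, m.c.c, m.c.e⟩,
    ⟨m.d.a, m.d.b, m.d.c, m.d.e⟩, ⟨m.e.a, m.e.b, m.e.c, m.e.e⟩⟩
  + m.a.e * detQuad ⟨⟨m.b.a, m.b.b, m.b.c, m.b.d⟩, ⟨m.c.a, m.c.b, m.c.c, m.c.d⟩,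
    ⟨m.d.a, m.d.b, m.d.c, m.d.d⟩, ⟨m.e.a, m.e.b, m.e.c, m.e.d⟩⟩

theorem detQuad_eq_det (m : Quad (Quad R)) : detQuad m = m.mat.det := by
  simp [det_succ_row_zero, Fin.sum_univ_succ, Quad.mat, Quad.vec, detQuad, laplaceDet, minors,
    Fin.succAbove]
  ring

theorem detQuint_eq_det (m : Quint (Quint R)) : detQuint m = m.mat.det := by
  simp only [detQuint, detQuad_eq_det]
  rw [det_succ_row_zero m.mat, Fin.sum_univ_five, sub_eq_add_neg, sub_eq_add_neg]
  congr 1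
  · congr 1
    · congr 1
      · congr 1
        · simp only [Quint.mat, Fin.val_zero, pow_zero, one_mul]
          congr 2
          ext i j; fin_cases i <;> fin_cases j <;> rfl
        · rw [← neg_mul]
          congr 2
          · simp [Quint.mat, Quint.vec]
          · ext i j; fin_cases i <;> fin_cases j <;> rfl
      · congr 2
        · simp [Quint.mat, Quint.vec]
        · ext i j; fin_cases i <;> fin_cases j <;> rfl
    · rw [← neg_mul]
      congr 2
      · simp [Quint.mat, Quint.vec, pow_succ]
      · ext i j; fin_cases i <;> fin_cases j <;> rfl
  · congr 2
    · simp [Quint.mat, Quint.vec, pow_succ]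
    · ext i j; fin_cases i <;> fin_cases j <;> rfl

theorem map_detQuint (φ : R →+* S) (m : Quint (Quint R)) :
    φ (detQuint m) = detQuint (m.map (Quint.map φ)) := by
  simp [detQuint, map_detQuad, Quint.map, Quad.map]

theorem map_leadingForms (φ : R →+* S) (M : Quad (Quad R)) :
    (leadingForms M).map (Quint.map φ) = leadingForms (M.map (Quad.map φ)) := by
  simp [leadingForms, Quadric.leading, remainderMinor, Quadric.add, minors, Quint.map, Quad.map]

end

/-- The ten monomials of degree at most three, on a set of points of the plane. -/
def cubicMonomials (s : Finset (ℂ × ℂ)) : Fin 10 → s → ℂ :=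
  let u : s → ℂ := fun p => p.1.1
  let v : s → ℂ := fun p => p.1.2
  ![1, u, v, u ^ 2, u * v, v ^ 2, u ^ 3, u ^ 2 * v, u * v ^ 2, v ^ 3]

/-- The five monomials of degree four. -/
def quarticMonomials (s : Finset (ℂ × ℂ)) : Fin 5 → s → ℂ :=
  let u : s → ℂ := fun p => p.1.1
  let v : s → ℂ := fun p => p.1.2
  ![u ^ 4, u ^ 3 * v, u ^ 2 * v ^ 2, u * v ^ 3, v ^ 4]

theorem Quadric.sum_leading_mem_span (s : Finset (ℂ × ℂ)) (p q r t : Quadric ℂ)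
    (h : ∀ x ∈ s, p.eval x.1 x.2 * q.eval x.1 x.2 = r.eval x.1 x.2 * t.eval x.1 x.2) :
    ∑ j, (leading p q r t).vec j • quarticMonomials s j
      ∈ Submodule.span ℂ (Set.range (cubicMonomials s)) := by
  let c (p q : Quadric ℂ) : Fin 10 → ℂ := ![p.one * q.one, p.one * q.u + p.u * q.one,
    p.one * q.v + p.v * q.one, p.one * q.uu + p.u * q.u + p.uu * q.one,
    p.one * q.uv + p.u * q.v + p.v * q.u + p.uv * q.one,
    p.one * q.vv + p.v * q.v + p.vv * q.one, p.u * q.uu + p.uu * q.u,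
    p.u * q.uv + p.v * q.uu + p.uu * q.v + p.uv * q.u,
    p.u * q.vv + p.v * q.uv + p.uv * q.v + p.vv * q.u, p.v * q.vv + p.vv * q.v]
  have key : ∑ j, (leading p q r t).vec j • quarticMonomials s j
      = ∑ i, (c r t i - c p q i) • cubicMonomials s i := by
    ext x
    have := h x.1 x.2
    simp only [eval] at this
    simp [Fin.sum_univ_succ, c, leading, Quint.vec, quarticMonomials, cubicMonomials]
    linear_combination this
  rw [key]
  exact Submodule.sum_mem _ fun i _ => Submodule.smul_mem _ _ (Submodule.subset_span ⟨i, rfl⟩)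

theorem card_le_ten_of_quartics (s : Finset (ℂ × ℂ)) (Q : Matrix (Fin 5) (Fin 5) ℂ)
    (hQ : Q.det ≠ 0)
    (h : ∀ k, ∑ j, Q k j • quarticMonomials s j
      ∈ Submodule.span ℂ (Set.range (cubicMonomials s))) : s.card ≤ 10 := by
  classical
  set V := Submodule.span ℂ (Set.range (cubicMonomials s)) with hV
  have h3 (i : Fin 10) : cubicMonomials s i ∈ V := Submodule.subset_span ⟨i, rfl⟩
  have h4 (j : Fin 5) : quarticMonomials s j ∈ V := by
    have : quarticMonomials s j = ∑ k, Q⁻¹ j k • ∑ l, Q k l • quarticMonomials s l := by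
      simp only [Finset.smul_sum, smul_smul]
      rw [Finset.sum_comm]
      simp only [← Finset.sum_smul, ← Matrix.mul_apply,
        Matrix.nonsing_inv_mul Q (isUnit_iff_ne_zero.2 hQ), Matrix.one_apply, ite_smul, one_smul,
        zero_smul, Finset.sum_ite_eq, Finset.mem_univ, if_true]
    rw [this]
    exact Submodule.sum_mem _ fun k _ => Submodule.smul_mem _ _ (h k)
  have hu : ∀ f ∈ V, (fun p : s => p.1.1) * f ∈ V := fun f hf => by
    refine Submodule.span_le (p := V.comap (LinearMap.mulLeft ℂ (fun p : s => p.1.1))).2 ?_ hf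
    rintro _ ⟨i, rfl⟩
    simp only [Submodule.comap_coe, Set.mem_preimage, LinearMap.mulLeft_apply, SetLike.mem_coe]
    fin_cases i
    · convert h3 1 using 1; simp [cubicMonomials]
    · convert h3 3 using 1; simp [cubicMonomials]; ring
    · exact h3 4
    · convert h3 6 using 1; simp [cubicMonomials]; ring
    · convert h3 7 using 1; simp [cubicMonomials]; ring
    · exact h3 8
    · convert h4 0 using 1; simp [cubicMonomials, quarticMonomials]; ring
    · convert h4 1 using 1; simp [cubicMonomials, quarticMonomials]; ring
    · convert h4 2 using 1; simp [cubicMonomials, quarticMonomials]; ring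
    · exact h4 3
  have hv : ∀ f ∈ V, (fun p : s => p.1.2) * f ∈ V := fun f hf => by
    refine Submodule.span_le (p := V.comap (LinearMap.mulLeft ℂ (fun p : s => p.1.2))).2 ?_ hf
    rintro _ ⟨i, rfl⟩
    simp only [Submodule.comap_coe, Set.mem_preimage, LinearMap.mulLeft_apply, SetLike.mem_coe]
    fin_cases i
    · convert h3 2 using 1; simp [cubicMonomials]
    · convert h3 4 using 1; simp [cubicMonomials]; ring
    · convert h3 5 using 1; simp [cubicMonomials]; ring
    · convert h3 7 using 1; simp [cubicMonomials]; ring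
    · convert h3 8 using 1; simp [cubicMonomials]; ring
    · convert h3 9 using 1; simp [cubicMonomials]; ring
    · convert h4 1 using 1; simp [cubicMonomials, quarticMonomials]; ring
    · convert h4 2 using 1; simp [cubicMonomials, quarticMonomials]; ring
    · convert h4 3 using 1; simp [cubicMonomials, quarticMonomials]; ring
    · convert h4 4 using 1; simp [cubicMonomials, quarticMonomials]; ring
  have hind (p : s) : Pi.single p (1 : ℂ) ∈ V := by
    have hsep (q : s) (hq : q ≠ p) : ∃ ℓ : s → ℂ, (∀ f ∈ V, ℓ * f ∈ V) ∧ ℓ q = 0 ∧ ℓ p = 1 := by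
      by_cases h1 : p.1.1 = q.1.1
      · have h2 : p.1.2 - q.1.2 ≠ 0 := fun h2 =>
          hq (Subtype.ext (Prod.ext h1.symm (sub_eq_zero.1 h2).symm))
        refine ⟨fun x => (p.1.2 - q.1.2)⁻¹ * (x.1.2 - q.1.2), fun f hf => ?_, by simp,
          inv_mul_cancel₀ h2⟩
        convert V.smul_mem (p.1.2 - q.1.2)⁻¹ (V.sub_mem (hv f hf) (V.smul_mem q.1.2 hf)) using 1
        ext x; simp; ring
      · have h2 : p.1.1 - q.1.1 ≠ 0 := sub_ne_zero.2 h1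
        refine ⟨fun x => (p.1.1 - q.1.1)⁻¹ * (x.1.1 - q.1.1), fun f hf => ?_, by simp,
          inv_mul_cancel₀ h2⟩
        convert V.smul_mem (p.1.1 - q.1.1)⁻¹ (V.sub_mem (hu f hf) (V.smul_mem q.1.1 hf)) using 1
        ext x; simp; ring
    choose! ℓ hℓ using hsep
    have hprod : ∀ T : Finset s, p ∉ T → ∏ q ∈ T, ℓ q ∈ V := by
      intro T
      induction T using Finset.induction_on with
      | empty => intro _; simpa [cubicMonomials] using h3 0
      | insert q T hqT ih =>
        intro hp
        rw [Finset.prod_insert hqT]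
        simp only [Finset.mem_insert, not_or] at hp
        exact (hℓ q (Ne.symm hp.1)).1 _ (ih hp.2)
    convert hprod (Finset.univ.erase p) (by simp) using 1
    ext x
    rw [Finset.prod_apply]
    by_cases hx : x = p
    · subst hx
      simp only [Pi.single_eq_same]
      exact (Finset.prod_eq_one fun q hq => (hℓ q (Finset.ne_of_mem_erase hq)).2.2).symm
    · rw [Pi.single_eq_of_ne hx]
      exact (Finset.prod_eq_zero (f := fun q => ℓ q x) (Finset.mem_erase.2 ⟨hx, Finset.mem_univ x⟩)
        (hℓ x hx).2.1).symm
  have htop : V = ⊤ := by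
    refine eq_top_iff.2 fun f _ => ?_
    rw [← Finset.univ_sum_single f]
    refine V.sum_mem fun p _ => ?_
    convert V.smul_mem (f p) (hind p) using 1
    rw [← Pi.single_smul, smul_eq_mul, mul_one]
  have := finrank_range_le_card (R := ℂ) (cubicMonomials s)
  rw [Set.finrank, ← hV, htop, finrank_top] at this
  simpa using this

/-- `w` is a common secant line of the two twisted cubics. -/
def IsLine (M : Quad (Quad ℂ)) (w : Quad ℂ) : Prop := (lineEqs 1 M w).vec = 0

theorem isLine_iff {M : Quad (Quad ℂ)} {w : Quad ℂ} : IsLine M w ↔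
    (remConst 1 M.c w = w.a * remConst 1 M.b w - w.b * remConst 1 M.a w ∧
     remConst 1 M.d w = w.a * remConst 1 M.c w - w.b * remConst 1 M.b w) ∧
    (remLin 1 M.c w = w.a * remLin 1 M.b w - w.b * remLin 1 M.a w ∧
     remLin 1 M.d w = w.a * remLin 1 M.c w - w.b * remLin 1 M.b w) := by
  simp only [IsLine, funext_iff, Fin.forall_fin_succ, lineEqs, Quad.vec]
  simp [add_eq_zero_iff_eq_neg, sub_eq_add_neg, and_assoc]
  constructor
  · rintro ⟨h1, h2, h3, h4⟩
    refine ⟨?_, ?_, ?_, ?_⟩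
    · linear_combination h1
    · linear_combination h2
    · linear_combination h3
    · linear_combination h4
  · rintro ⟨h1, h2, h3, h4⟩
    refine ⟨?_, ?_, ?_, ?_⟩
    · linear_combination h1
    · linear_combination h2
    · linear_combination h3
    · linear_combination h4

theorem IsLine.eval_remainderMinor_ne_zero {M : Quad (Quad ℂ)} {w : Quad ℂ} (h : IsLine M w)
    (hM : detQuad M ≠ 0) : (remainderMinor M.a M.b).eval w.c w.d ≠ 0 := by
  rw [eval_remainderMinor]
  obtain ⟨⟨h1, h2⟩, h3, h4⟩ := isLine_iff.1 h
  intro h0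
  have hinj (v : Fin 4 → ℂ) (hv : M.mat *ᵥ v = 0) : v = 0 := by
    have h5 : (adjQuad M).mat *ᵥ (M.mat *ᵥ v) = 0 := by rw [hv, mulVec_zero]
    rw [mulVec_mulVec, adjQuad_mul, smul_mulVec, one_mulVec] at h5
    exact (smul_eq_zero.1 h5).resolve_left hM
  have hp (p q : ℂ) (ha : q * remConst 1 M.a w = p * remLin 1 M.a w)
      (hb : q * remConst 1 M.b w = p * remLin 1 M.b w) : q = 0 ∧ p = 0 := by
    have hc : q * remConst 1 M.c w = p * remLin 1 M.c w := by
      rw [h1, h3]; linear_combination w.a * hb - w.b * ha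
    have hd : q * remConst 1 M.d w = p * remLin 1 M.d w := by
      rw [h2, h4]; linear_combination w.a * hc - w.b * hb
    have hv := hinj ![q, -p, -(q * w.d) - p * w.c, -(q * (w.c * w.d)) - p * (w.c ^ 2 - w.d)] (by
      ext i
      simp only [remConst, remLin] at ha hb hc hd
      fin_cases i
      · simp [mulVec, dotProduct, Fin.sum_univ_four, Quad.mat, Quad.vec]
        linear_combination ha
      · simp [mulVec, dotProduct, Fin.sum_univ_four, Quad.mat, Quad.vec]
        linear_combination hb
      · simp [mulVec, dotProduct, Fin.sum_univ_four, Quad.mat, Quad.vec]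
        linear_combination hc
      · simp [mulVec, dotProduct, Fin.sum_univ_four, Quad.mat, Quad.vec]
        linear_combination hd)
    exact ⟨congrFun hv 0, by simpa using congrFun hv 1⟩
  have ha := hp (remConst 1 M.a w) (remLin 1 M.a w) (by ring) (by linear_combination -h0)
  have hb := hp (remConst 1 M.b w) (remLin 1 M.b w) (by linear_combination h0) (by ring)
  exact one_ne_zero (hp 0 1 (by rw [ha.2]; ring) (by rw [hb.2]; ring)).1

theorem IsLine.mul_eval {M : Quad (Quad ℂ)} {w : Quad ℂ} (h : IsLine M w) :
    let p := (remainderMinor M.a M.b).eval w.c w.d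
    (remainderMinor M.a M.c).eval w.c w.d = w.a * p ∧
    (remainderMinor M.b M.c).eval w.c w.d = w.b * p ∧
    (remainderMinor M.a M.d).eval w.c w.d = (w.a ^ 2 - w.b) * p ∧
    (remainderMinor M.b M.d).eval w.c w.d = w.a * w.b * p ∧
    (remainderMinor M.c M.d).eval w.c w.d = w.b ^ 2 * p := by
  simp only [eval_remainderMinor]
  obtain ⟨⟨h1, h2⟩, h3, h4⟩ := isLine_iff.1 h
  rw [h2, h4, h1, h3]
  refine ⟨?_, ?_, ?_, ?_, ?_⟩ <;> ring

theorem card_le_ten_of_isLine {M : Quad (Quad ℂ)} (hM : detQuad M ≠ 0)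
    (hM' : detQuint (leadingForms M) ≠ 0) (s : Finset (Quad ℂ)) (hs : ∀ w ∈ s, IsLine M w) :
    s.card ≤ 10 := by
  classical
  have hinj : Set.InjOn (fun w : Quad ℂ => (w.c, w.d)) s := by
    intro w hw w' hw' heq
    obtain ⟨hc, hd⟩ := Prod.ext_iff.1 heq
    simp only at hc hd
    have hp := (hs w hw).eval_remainderMinor_ne_zero hM
    obtain ⟨h1, h2, -⟩ := (hs w hw).mul_eval
    obtain ⟨h3, h4, -⟩ := (hs w' hw').mul_eval
    rw [← hc, ← hd, h1] at h3
    rw [← hc, ← hd, h2] at h4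
    rcases w with ⟨a, b, c, d⟩
    rcases w' with ⟨a', b', c', d'⟩
    have ha := mul_right_cancel₀ hp h3
    have hb := mul_right_cancel₀ hp h4
    simp only at ha hb hc hd
    subst ha hb hc hd
    rfl
  rw [← Finset.card_image_of_injOn hinj]
  refine card_le_ten_of_quartics _ (leadingForms M).mat (by rwa [← detQuint_eq_det]) fun k => ?_
  have hx (x : ℂ × ℂ) (hx : x ∈ s.image fun w : Quad ℂ => (w.c, w.d)) :
      ∃ w, IsLine M w ∧ w.c = x.1 ∧ w.d = x.2 := by
    obtain ⟨w, hw, rfl⟩ := Finset.mem_image.1 hx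
    exact ⟨w, hs w hw, rfl, rfl⟩
  have key (p q r t : Quadric ℂ) (h : ∀ w, IsLine M w →
      p.eval w.c w.d * q.eval w.c w.d = r.eval w.c w.d * t.eval w.c w.d) :=
    Quadric.sum_leading_mem_span (s.image fun w : Quad ℂ => (w.c, w.d)) p q r t fun x hxs => by
      obtain ⟨w, hw, h1, h2⟩ := hx x hxs
      rw [← h1, ← h2]
      exact h w hw
  have key' (p q r t : Quadric ℂ) (v : Fin 5 → ℂ) (hv : (Quadric.leading p q r t).vec = v)
      (h : ∀ w, IsLine M w → p.eval w.c w.d * q.eval w.c w.d = r.eval w.c w.d * t.eval w.c w.d) :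
      ∑ j, v j • quarticMonomials (s.image fun w : Quad ℂ => (w.c, w.d)) j ∈ _ :=
    hv ▸ key p q r t h
  fin_cases k
  all_goals
    refine key' _ _ _ _ _ rfl fun w hw => ?_
    obtain ⟨h1, h2, h3, h4, h5⟩ := hw.mul_eval
    simp only [Quadric.eval_add, h1, h2, h3, h4, h5]
    ring

/-- The line of a solution, in terms of the elementary symmetric functions of `t₁, t₂` and of
`s₁, s₂`. -/
def lineOf (x : Fin 4 → ℂ) : Quad ℂ := ⟨x 0 + x 1, x 0 * x 1, x 2 + x 3, x 2 * x 3⟩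

/-- The discriminant of `T² - x T + y`. -/
def discT (w : Quad ℂ) : ℂ := w.a ^ 2 - 4 * w.b

/-- The discriminant of `T² - u T + v`. -/
def discS (w : Quad ℂ) : ℂ := w.c ^ 2 - 4 * w.d

theorem discT_lineOf (x : Fin 4 → ℂ) : discT (lineOf x) = (x 0 - x 1) ^ 2 := by
  simp only [discT, lineOf]; ring

theorem discS_lineOf (x : Fin 4 → ℂ) : discS (lineOf x) = (x 2 - x 3) ^ 2 := by
  simp only [discS, lineOf]; ring

/-- The secant lines that are not tangent to either of the two curves. -/
def secantLines (M : Quad (Quad ℂ)) : Set (Quad ℂ) :=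
  {w | IsLine M w ∧ discT w ≠ 0 ∧ discS w ≠ 0}

theorem pc_mat (M : Quad (Quad ℂ)) (i : Fin 4) (s : ℂ) :
    pc M.mat i s = (M.vec i).a + (M.vec i).b * s + (M.vec i).c * s ^ 2 + (M.vec i).d * s ^ 3 := by
  simp [pc, tcv, mulVec, dotProduct, Fin.sum_univ_four, Quad.mat, Quad.vec]

theorem pc_eq_remainder (M : Quad (Quad ℂ)) (i : Fin 4) {s : ℂ} {w : Quad ℂ}
    (hs : s ^ 2 = w.c * s - w.d) :
    pc M.mat i s = remConst 1 (M.vec i) w + remLin 1 (M.vec i) w * s := by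
  rw [pc_mat, remConst, remLin]
  linear_combination ((M.vec i).c + (M.vec i).d * s + (M.vec i).d * w.c) * hs

theorem f₁_eq (M : Quad (Quad ℂ)) (x : Fin 4 → ℂ) {s : ℂ}
    (hs : s ^ 2 = (lineOf x).c * s - (lineOf x).d) :
    f₁ M.mat (x 0) (x 1) s = (lineEqs 1 M (lineOf x)).a + (lineEqs 1 M (lineOf x)).c * s := by
  simp only [f₁, pc_eq_remainder M _ hs, lineEqs, Quad.vec, cons_val]
  simp only [lineOf]
  ring

theorem f₂_eq (M : Quad (Quad ℂ)) (x : Fin 4 → ℂ) {s : ℂ}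
    (hs : s ^ 2 = (lineOf x).c * s - (lineOf x).d) :
    f₂ M.mat (x 0) (x 1) s = (lineEqs 1 M (lineOf x)).b + (lineEqs 1 M (lineOf x)).d * s := by
  simp only [f₂, pc_eq_remainder M _ hs, lineEqs, Quad.vec, cons_val]
  simp only [lineOf]
  ring

theorem linear_eq_zero_iff {p q s t : ℂ} (hst : s ≠ t) :
    (p + q * s = 0 ∧ p + q * t = 0) ↔ (p = 0 ∧ q = 0) := by
  constructor
  · rintro ⟨h1, h2⟩
    have hq : q = 0 := by
      have : q * (s - t) = 0 := by linear_combination h1 - h2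
      exact (mul_eq_zero.1 this).resolve_right (sub_ne_zero.2 hst)
    exact ⟨by simpa [hq] using h1, hq⟩
  · rintro ⟨rfl, rfl⟩; simp

theorem Ssol_eq_preimage (M : Quad (Quad ℂ)) : Ssol M.mat = lineOf ⁻¹' secantLines M := by
  ext x
  simp only [Ssol, secantLines, Set.mem_ofPred_eq, Set.mem_preimage, discT_lineOf, discS_lineOf,
    ne_eq, pow_eq_zero_iff two_ne_zero, sub_eq_zero]
  refine and_congr_left fun ⟨_, hs⟩ => ?_
  have h2 : x 2 ^ 2 = (lineOf x).c * x 2 - (lineOf x).d := by simp only [lineOf]; ring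
  have h3 : x 3 ^ 2 = (lineOf x).c * x 3 - (lineOf x).d := by simp only [lineOf]; ring
  simp only [Fmap, IsLine, funext_iff, Fin.forall_fin_succ, f₁_eq M x h2, f₁_eq M x h3,
    f₂_eq M x h2, f₂_eq M x h3]
  have hA := linear_eq_zero_iff (p := (lineEqs 1 M (lineOf x)).a)
    (q := (lineEqs 1 M (lineOf x)).c) hs
  have hB := linear_eq_zero_iff (p := (lineEqs 1 M (lineOf x)).b)
    (q := (lineEqs 1 M (lineOf x)).d) hs
  simp only [Quad.vec]
  simp
  tauto

theorem ncard_preimage_lineOf (A : Set (Quad ℂ)) (hA : ∀ w ∈ A, discT w ≠ 0 ∧ discS w ≠ 0) :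
    (lineOf ⁻¹' A).ncard = 4 * A.ncard := by
  choose δ hδ using fun z : ℂ => IsAlgClosed.exists_pow_nat_eq z two_pos
  let sgn (b : Bool) : ℂ := cond b 1 (-1)
  have hsgn (b : Bool) : sgn b ^ 2 = 1 := by cases b <;> simp [sgn]
  have hsgn' {b b' : Bool} {z : ℂ} (hz : z ≠ 0) (h : sgn b * z = sgn b' * z) : b = b' := by
    have := mul_right_cancel₀ hz h
    revert this
    cases b <;> cases b' <;> simp [sgn] <;> norm_num
  let g (p : Quad ℂ × Bool × Bool) : Fin 4 → ℂ :=
    ![(p.1.a + sgn p.2.1 * δ (discT p.1)) / 2, (p.1.a - sgn p.2.1 * δ (discT p.1)) / 2,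
      (p.1.c + sgn p.2.2 * δ (discS p.1)) / 2, (p.1.c - sgn p.2.2 * δ (discS p.1)) / 2]
  have hline (p) : lineOf (g p) = p.1 := by
    obtain ⟨⟨a, b, c, d⟩, e, e'⟩ := p
    have h1 := hδ (discT ⟨a, b, c, d⟩)
    have h2 := hδ (discS ⟨a, b, c, d⟩)
    simp only [lineOf, g, cons_val, Quad.mk.injEq]
    simp only [discT, discS] at h1 h2 ⊢
    refine ⟨by ring, ?_, by ring, ?_⟩
    · linear_combination (-1 / 4 : ℂ) * sgn e ^ 2 * h1 - (a ^ 2 - 4 * b) / 4 * hsgn e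
    · linear_combination (-1 / 4 : ℂ) * sgn e' ^ 2 * h2 - (c ^ 2 - 4 * d) / 4 * hsgn e'
  have hinj : Set.InjOn g (A ×ˢ Set.univ) := by
    rintro ⟨w, e, e'⟩ hw ⟨w', e₁, e₁'⟩ - heq
    obtain rfl : w = w' := by simpa [hline] using congrArg lineOf heq
    obtain ⟨h1, h2⟩ := hA w hw.1
    have h3 := congrFun heq 0
    have h4 := congrFun heq 2
    simp only [g, cons_val] at h3 h4
    have hδ0 {z : ℂ} (hz : z ≠ 0) : δ z ≠ 0 := fun h => hz (by rw [← hδ z, h]; simp)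
    rw [hsgn' (b := e) (b' := e₁) (hδ0 h1) (by linear_combination 2 * h3),
      hsgn' (b := e') (b' := e₁') (hδ0 h2) (by linear_combination 2 * h4)]
  have himage : g '' (A ×ˢ Set.univ) = lineOf ⁻¹' A := by
    ext x
    constructor
    · rintro ⟨p, hp, rfl⟩
      rw [Set.mem_preimage, hline]
      exact hp.1
    · intro hx
      have hroot {p z : ℂ} (h : z ^ 2 = p ^ 2) : ∃ b, sgn b * z = p := by
        rcases sq_eq_sq_iff_eq_or_eq_neg.1 h with h | h
        · exact ⟨true, by simp [sgn, h]⟩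
        · exact ⟨false, by simp [sgn, h]⟩
      obtain ⟨e, he⟩ := hroot ((hδ _).trans (discT_lineOf x))
      obtain ⟨e', he'⟩ := hroot ((hδ _).trans (discS_lineOf x))
      refine ⟨(lineOf x, e, e'), ⟨hx, trivial⟩, ?_⟩
      simp only [g, he, he']
      ext i
      fin_cases i <;> simp [lineOf]
  rw [← himage, hinj.ncard_image, Set.ncard_prod, Set.ncard_univ]
  simp [mul_comm]

theorem real_pair_iff {p q : ℂ} (h : p ≠ q) : (p.im = 0 ∧ q.im = 0) ↔
    ((p + q).im = 0 ∧ (p * q).im = 0) ∧ 0 < ((p - q) ^ 2).re := by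
  obtain ⟨a, b⟩ := p
  obtain ⟨c, d⟩ := q
  simp only [pow_two, Complex.mul_re, Complex.mul_im, Complex.add_im, Complex.sub_re,
    Complex.sub_im]
  constructor
  · rintro ⟨rfl, rfl⟩
    have : a - c ≠ 0 := fun h' => h (by rw [sub_eq_zero.1 h'])
    refine ⟨by simp, ?_⟩
    have := mul_self_pos.2 this
    linarith
  · rintro ⟨⟨h1, h2⟩, h3⟩
    obtain rfl : d = -b := by linarith
    have h4 : b * (c - a) = 0 := by linarith
    rcases mul_eq_zero.1 h4 with rfl | h5
    · simp
    · obtain rfl : c = a := by linarith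
      nlinarith [mul_self_nonneg b]

theorem conj_pair_iff {p q : ℂ} : (p.im ≠ 0 ∧ q = (starRingEnd ℂ) p) ↔
    ((p + q).im = 0 ∧ (p * q).im = 0) ∧ ((p - q) ^ 2).re < 0 := by
  obtain ⟨a, b⟩ := p
  obtain ⟨c, d⟩ := q
  simp only [pow_two, Complex.mul_re, Complex.mul_im, Complex.add_im, Complex.sub_re,
    Complex.sub_im, Complex.ext_iff, Complex.conj_re, Complex.conj_im]
  constructor
  · rintro ⟨h, rfl, rfl⟩
    refine ⟨⟨by ring, by ring⟩, ?_⟩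
    have := mul_self_pos.2 h
    linarith
  · rintro ⟨⟨h1, h2⟩, h3⟩
    obtain rfl : d = -b := by linarith
    have h4 : b * (c - a) = 0 := by linarith
    rcases mul_eq_zero.1 h4 with rfl | h5
    · nlinarith [mul_self_nonneg (a - c)]
    · refine ⟨?_, by linarith, rfl⟩
      rintro rfl
      nlinarith [mul_self_nonneg (a - c)]

def Quad.IsReal (w : Quad ℂ) : Prop := (w.a.im = 0 ∧ w.b.im = 0) ∧ w.c.im = 0 ∧ w.d.im = 0

theorem totallyReal_iff {x : Fin 4 → ℂ} (h₁ : x 0 ≠ x 1) (h₂ : x 2 ≠ x 3) : TotallyReal x ↔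
    (lineOf x).IsReal ∧ 0 < (discT (lineOf x)).re ∧ 0 < (discS (lineOf x)).re := by
  have h3 := real_pair_iff h₁
  have h4 := real_pair_iff h₂
  simp only [discT_lineOf, discS_lineOf, TotallyReal, Fin.forall_fin_succ]
  simp only [lineOf, Quad.IsReal]
  simp
  tauto

theorem partiallyReal_iff {x : Fin 4 → ℂ} (h₁ : x 0 ≠ x 1) (h₂ : x 2 ≠ x 3) : PartiallyReal x ↔
    (lineOf x).IsReal ∧ (0 < (discT (lineOf x)).re ∧ (discS (lineOf x)).re < 0 ∨
      (discT (lineOf x)).re < 0 ∧ 0 < (discS (lineOf x)).re) := by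
  refine ((and_assoc.symm.trans ((real_pair_iff h₁).and conj_pair_iff)).or
    (and_assoc.symm.trans ((real_pair_iff h₂).and conj_pair_iff))).trans ?_
  rw [discT_lineOf, discS_lineOf]
  constructor
  · rintro (⟨⟨hT, h⟩, hS, h'⟩ | ⟨⟨hS, h⟩, hT, h'⟩)
    exacts [⟨⟨hT, hS⟩, .inl ⟨h, h'⟩⟩, ⟨⟨hT, hS⟩, .inr ⟨h', h⟩⟩]
  · rintro ⟨⟨hT, hS⟩, ⟨h, h'⟩ | ⟨h', h⟩⟩
    exacts [.inl ⟨⟨hT, h⟩, hS, h'⟩, .inr ⟨⟨hS, h⟩, hT, h'⟩]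

theorem minimallyReal_iff {x : Fin 4 → ℂ} : MinimallyReal x ↔
    (lineOf x).IsReal ∧ (discT (lineOf x)).re < 0 ∧ (discS (lineOf x)).re < 0 := by
  have h5 := conj_pair_iff (p := x 0) (q := x 1)
  have h6 := conj_pair_iff (p := x 2) (q := x 3)
  simp only [discT_lineOf, discS_lineOf, MinimallyReal]
  simp only [lineOf, Quad.IsReal]
  tauto

/-- The derivative of `pc M i` at `s`. -/
def dpc (M : Quad (Quad ℂ)) (i : Fin 4) (s : ℂ) : ℂ :=
  (M.vec i).b + (M.vec i).c * (2 * s) + (M.vec i).d * (3 * s ^ 2)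

theorem hasDerivAt_pc (M : Quad (Quad ℂ)) (i : Fin 4) (s : ℂ) :
    HasDerivAt (pc M.mat i) (dpc M i s) s := by
  rw [show pc M.mat i = _ from funext (pc_mat M i)]
  have h := (((hasDerivAt_id s).const_mul (M.vec i).b).const_add (M.vec i).a).add
    (((hasDerivAt_pow 2 s).const_mul (M.vec i).c)) |>.add
    ((hasDerivAt_pow 3 s).const_mul (M.vec i).d)
  refine h.congr_deriv ?_
  simp [dpc]

theorem Jac_eq (M : Quad (Quad ℂ)) (x : Fin 4 → ℂ) (p : Fin 4 → ℂ) (q : Fin 4 → ℂ)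
    (dp : Fin 4 → ℂ) (dq : Fin 4 → ℂ) (hp : ∀ i, p i = pc M.mat i (x 2))
    (hq : ∀ i, q i = pc M.mat i (x 3)) (hdp : ∀ i, dp i = dpc M i (x 2))
    (hdq : ∀ i, dq i = dpc M i (x 3)) : Jac M.mat x = Quad.mat
      ⟨⟨-p 1 + x 1 * p 0, -p 1 + x 0 * p 0,
        dp 2 - (x 0 + x 1) * dp 1 + x 0 * x 1 * dp 0, 0⟩,
       ⟨-q 1 + x 1 * q 0, -q 1 + x 0 * q 0, 0,
        dq 2 - (x 0 + x 1) * dq 1 + x 0 * x 1 * dq 0⟩,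
       ⟨-p 2 + x 1 * p 1, -p 2 + x 0 * p 1,
        dp 3 - (x 0 + x 1) * dp 2 + x 0 * x 1 * dp 1, 0⟩,
       ⟨-q 2 + x 1 * q 1, -q 2 + x 0 * q 1, 0,
        dq 3 - (x 0 + x 1) * dq 2 + x 0 * x 1 * dq 1⟩⟩ := by
  have hT (a b c y z : ℂ) : HasDerivAt (fun z => a - (z + y) * b + z * y * c) (-b + y * c) z := by
    have h := (((((hasDerivAt_id z).add_const y).mul_const b).const_sub a)).add
      (((hasDerivAt_id z).mul_const y).mul_const c)
    refine h.congr_deriv ?_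
    ring
  have hT' (a b c y z : ℂ) : HasDerivAt (fun z => a - (y + z) * b + y * z * c) (-b + y * c) z := by
    simpa only [add_comm y, mul_comm y] using hT a b c y z
  have hS (i j k : Fin 4) (y z s : ℂ) :
      HasDerivAt (fun s => pc M.mat i s - (y + z) * pc M.mat j s + y * z * pc M.mat k s)
        (dpc M i s - (y + z) * dpc M j s + y * z * dpc M k s) s :=
    ((hasDerivAt_pc M i s).sub ((hasDerivAt_pc M j s).const_mul _)).add
      ((hasDerivAt_pc M k s).const_mul _)
  simp only [hp, hq, hdp, hdq]
  ext i j
  fin_cases i <;> fin_cases j <;> simp only [Jac, Fmap, f₁, f₂, Quad.mat, Quad.vec,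
    Matrix.of_apply] <;> simp [Function.update]
  exacts [(hT _ _ _ _ _).deriv, (hT' _ _ _ _ _).deriv, (hS _ _ _ _ _ _).deriv,
    (hT _ _ _ _ _).deriv, (hT' _ _ _ _ _).deriv, (hS _ _ _ _ _ _).deriv,
    (hT _ _ _ _ _).deriv, (hT' _ _ _ _ _).deriv, (hS _ _ _ _ _ _).deriv,
    (hT _ _ _ _ _).deriv, (hT' _ _ _ _ _).deriv, (hS _ _ _ _ _ _).deriv]

theorem Jac_eq_mul (M : Quad (Quad ℂ)) (x : Fin 4 → ℂ) (h : IsLine M (lineOf x)) :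
    Jac M.mat x =
      Quad.mat ⟨⟨1, 0, x 2, 0⟩, ⟨1, 0, x 3, 0⟩, ⟨0, 1, 0, x 2⟩, ⟨0, 1, 0, x 3⟩⟩ *
      (diffQuot 1 M (lineOf x) (lineOf x)).mat *
      Quad.mat ⟨⟨1, 1, 0, 0⟩, ⟨x 1, x 0, 0, 0⟩, ⟨0, 0, 1, 1⟩, ⟨0, 0, x 3, x 2⟩⟩ := by
  rw [Jac_eq M x _ _ _ _ (fun i => (pc_mat M i _).symm) (fun i => (pc_mat M i _).symm)
    (fun _ => rfl) (fun _ => rfl)]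
  have h2 : (lineEqs 1 M (lineOf x)).c = 0 := congrFun h 2
  have h3 : (lineEqs 1 M (lineOf x)).d = 0 := congrFun h 3
  simp only [lineEqs, remLin, lineOf] at h2 h3
  ext i j
  fin_cases i <;> fin_cases j <;>
    simp [Matrix.mul_apply, Fin.sum_univ_four, Quad.mat, Quad.vec, dpc, diffQuot,
      diffQuotRow, remConst, remLin, lineOf]
  · ring
  · ring
  · linear_combination h2
  · ring
  · ring
  · ring
  · ring
  · linear_combination h2
  · ring
  · ring
  · linear_combination h3
  · ring
  · ring
  · ring
  · ring
  · linear_combination h3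

theorem isUnit_Jac {M : Quad (Quad ℂ)} {x : Fin 4 → ℂ} (h : IsLine M (lineOf x))
    (h₁ : x 0 ≠ x 1) (h₂ : x 2 ≠ x 3)
    (hu : IsUnit (diffQuot 1 M (lineOf x) (lineOf x)).mat) : IsUnit (Jac M.mat x) := by
  rw [Jac_eq_mul M x h]
  refine (IsUnit.mul ?_ hu).mul ?_ <;> rw [isUnit_iff_isUnit_det, ← detQuad_eq_det,
    isUnit_iff_ne_zero]
  · rw [show detQuad _ = -(x 2 - x 3) ^ 2 by simp [detQuad, laplaceDet, minors]; ring]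
    simpa [sub_eq_zero] using h₂
  · rw [show detQuad _ = (x 0 - x 1) * (x 2 - x 3) by simp [detQuad, laplaceDet, minors]]
    simpa [sub_eq_zero] using ⟨h₁, h₂⟩

theorem lineEqs_smul (n : ℂ) (M : Quad (Quad ℂ)) (w : Quad ℂ) :
    lineEqs n M (w.map (n * ·)) = (lineEqs 1 M w).map (n ^ 3 * ·) := by
  simp only [lineEqs, remConst, remLin, Quad.map, Quad.mk.injEq]
  refine ⟨by ring, by ring, by ring, by ring⟩

theorem diffQuot_smul (n : ℂ) (M : Quad (Quad ℂ)) (w : Quad ℂ) :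
    (diffQuot n M (w.map (n * ·)) (w.map (n * ·))).mat = n ^ 2 • (diffQuot 1 M w w).mat := by
  have h : diffQuot n M (w.map (n * ·)) (w.map (n * ·))
      = (diffQuot 1 M w w).map (Quad.map (n ^ 2 * ·)) := by
    simp only [diffQuot, diffQuotRow, remConst, remLin, Quad.map, Quad.mk.injEq]
    refine ⟨⟨?_, ?_, ?_, ?_⟩, ⟨?_, ?_, ?_, ?_⟩, ⟨?_, ?_, ?_, ?_⟩, ⟨?_, ?_, ?_, ?_⟩⟩ <;> ring
  rw [h]
  ext i j
  simp [Quad.mat, Quad.vec_map]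

/-- `w` is an isolated secant line close to `c / n`. -/
structure IsLineNear (n b r : ℕ) (M : Quad (Quad ℂ)) (c w : Quad ℂ) : Prop where
  isLine : IsLine M w
  isUnit : IsUnit (diffQuot 1 M w w).mat
  norm_le : ∀ i, ‖w.vec i‖ ≤ b
  dist_le : ∀ i, ‖n * w.vec i - c.vec i‖ ≤ r

theorem isLineNear_of_certified {R : Type} [CommRing R] {φ : R →+* ℂ} {size : R → ℕ}
    (h₁ : ∀ x, ‖φ x‖ ≤ size x) (h₂ : ∀ x, size x ≤ 2 * ‖φ x‖) {n b C r : ℕ}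
    (hn : 0 < n * C * r) {M : Quad (Quad R)} {z : Quad R}
    (hM : ∀ i, ‖((M.map (Quad.map φ)).vec i).vec‖ ≤ C) (hz : certified size n b C r M z) :
    ∃ w, IsLineNear n b r (M.map (Quad.map φ)) (z.map φ) w ∧
      ∀ w', IsLine (M.map (Quad.map φ)) w' →
        (∀ i, ‖n * w'.vec i - (z.map φ).vec i‖ ≤ r) → w' = w := by
  obtain ⟨w, hw, hb, h0, hu, hun⟩ := exists_unique_zero_of_certified h₁ h₂ hn hM hz
  have hn0 : n ≠ 0 := fun h => by simp [h] at hn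
  have hn1 : (0 : ℝ) < n := by exact_mod_cast Nat.pos_of_ne_zero hn0
  have hn2 : (n : ℂ) ≠ 0 := by exact_mod_cast hn0
  have hww : w = (w.map ((n : ℂ)⁻¹ * ·)).map ((n : ℂ) * ·) := by
    simp [Quad.map, mul_inv_cancel_left₀ hn2]
  set ℓ := w.map ((n : ℂ)⁻¹ * ·)
  have hvec (q : Quad ℂ) (i : Fin 4) : (q.map ((n : ℂ) * ·)).vec i = n * q.vec i :=
    Quad.vec_map _ _ _
  have hvec3 (q : Quad ℂ) : (q.map ((n : ℂ) ^ 3 * ·)).vec = (n : ℂ) ^ 3 • q.vec :=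
    funext fun _ => Quad.vec_map _ _ _
  refine ⟨ℓ, ⟨?_, ?_, fun i => ?_, fun i => ?_⟩, fun w' h' hd => ?_⟩
  · rw [hww, lineEqs_smul, hvec3] at h0
    exact (smul_eq_zero.1 h0).resolve_left (pow_ne_zero _ hn2)
  · rw [hww, diffQuot_smul] at hu
    have h5 : (n : ℂ) ^ 2 ≠ 0 := pow_ne_zero _ hn2
    simpa [isUnit_iff_isUnit_det, Matrix.det_smul, h5] using hu
  · have h5 := (norm_le_pi_norm _ i).trans hb
    rw [hww, hvec, norm_mul, Complex.norm_natCast, mul_comm] at h5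
    exact le_of_mul_le_mul_right h5 hn1
  · have h5 := (norm_le_pi_norm _ i).trans hw
    rwa [Pi.sub_apply, hww, hvec] at h5
  · have h5 := hun (w'.map ((n : ℂ) * ·))
      ((pi_norm_le_iff_of_nonneg (Nat.cast_nonneg r)).2 fun i => by
        rw [Pi.sub_apply, hvec]; exact hd i)
      (by rw [lineEqs_smul, hvec3, show (lineEqs 1 _ w').vec = 0 from h', smul_zero])
    simp [ℓ, ← h5, Quad.map, inv_mul_cancel_left₀ hn2]

namespace IsLineNear

variable {n b r : ℕ} {M : Quad (Quad ℂ)} {c w : Quad ℂ}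

theorem conj (h : IsLineNear n b r M c w)
    (hM : M.map (Quad.map (starRingEnd ℂ)) = M) :
    IsLineNear n b r M (c.map (starRingEnd ℂ)) (w.map (starRingEnd ℂ)) := by
  refine ⟨?_, ?_, fun i => ?_, fun i => ?_⟩
  · have h5 := map_lineEqs (starRingEnd ℂ) 1 M w
    rw [hM, map_one] at h5
    ext i
    rw [← h5, Quad.vec_map, congrFun h.isLine i]
    simp
  · have h5 := map_diffQuot (starRingEnd ℂ) 1 M w w
    have h6 := h.isUnit
    rw [isUnit_iff_isUnit_det, ← detQuad_eq_det, isUnit_iff_ne_zero] at h6 ⊢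
    rw [hM, map_one] at h5
    rw [← h5, ← map_detQuad]
    simpa using h6
  · rw [Quad.vec_map, RCLike.norm_conj]
    exact h.norm_le i
  · rw [Quad.vec_map, Quad.vec_map, ← RCLike.norm_conj]
    simpa using h.dist_le i

theorem norm_disc_sub_le (h : IsLineNear n b r M c w) (i j : Fin 4) :
    ‖(n : ℂ) ^ 2 * (w.vec i ^ 2 - 4 * w.vec j) - (c.vec i * c.vec i - 4 * (n * c.vec j))‖
      ≤ (r * (2 * (b * n) + r + 4 * n) : ℕ) := by
  have hi := h.dist_le i
  have hj := h.dist_le j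
  have hw : ‖(n : ℂ) * w.vec i‖ ≤ b * n := by
    rw [norm_mul, Complex.norm_natCast, mul_comm]
    exact mul_le_mul_of_nonneg_right (h.norm_le i) (Nat.cast_nonneg n)
  rw [show (n : ℂ) ^ 2 * (w.vec i ^ 2 - 4 * w.vec j) - (c.vec i * c.vec i - 4 * (n * c.vec j)) =
    (n * w.vec i - c.vec i) * (n * w.vec i + n * w.vec i - (n * w.vec i - c.vec i))
      - 4 * n * (n * w.vec j - c.vec j) by ring]
  refine (norm_sub_le _ _).trans ?_
  rw [norm_mul, norm_mul, norm_mul, Complex.norm_natCast]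
  have h5 : ‖(n : ℂ) * w.vec i + n * w.vec i - (n * w.vec i - c.vec i)‖ ≤ b * n + b * n + r :=
    (norm_sub_le _ _).trans (add_le_add ((norm_add_le _ _).trans (add_le_add hw hw)) hi)
  have h6 := mul_le_mul hi h5 (norm_nonneg _) (Nat.cast_nonneg r)
  have h7 := mul_le_mul_of_nonneg_left hj (by positivity : (0 : ℝ) ≤ 4 * n)
  push_cast
  rw [Complex.norm_ofNat]
  linarith

end IsLineNear

def gaussianSize (z : GaussianInt) : ℕ := z.re.natAbs + z.im.natAbs

theorem norm_toComplex_le (z : GaussianInt) : ‖GaussianInt.toComplex z‖ ≤ gaussianSize z := by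
  refine (Complex.norm_le_abs_re_add_abs_im _).trans ?_
  simp [gaussianSize, Nat.cast_natAbs]

theorem gaussianSize_le (z : GaussianInt) : gaussianSize z ≤ 2 * ‖GaussianInt.toComplex z‖ := by
  have h₁ := Complex.abs_re_le_norm (GaussianInt.toComplex z)
  have h₂ := Complex.abs_im_le_norm (GaussianInt.toComplex z)
  rw [← GaussianInt.intCast_re] at h₁
  rw [← GaussianInt.intCast_im] at h₂
  simp only [gaussianSize, Nat.cast_add, Nat.cast_natAbs, Int.cast_abs]
  linarith

/-- `n²` times the discriminant of `T² - (x / n) T + y / n`. -/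
def scaledDisc (n : ℕ) (x y : GaussianInt) : GaussianInt := x * x - (4 * n : ℕ) * y

/-- Whether `w ≠ w'` whenever `w` and `w'` are lines near `z` and `z'`. -/
def separated (r : ℕ) (z z' : Quad GaussianInt) : Bool :=
  decide (4 * r < gaussianSize (z.a - z'.a)) || decide (4 * r < gaussianSize (z.b - z'.b)) ||
    (decide (4 * r < gaussianSize (z.c - z'.c)) || decide (4 * r < gaussianSize (z.d - z'.d)))

def hasRealCoords (z : Quad GaussianInt) : Bool :=
  (decide (z.a.im = 0) && decide (z.b.im = 0)) && (decide (z.c.im = 0) && decide (z.d.im = 0))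

/-- Whether no line near `z` is real. -/
def isFarFromReal (r : ℕ) (z : Quad GaussianInt) : Bool :=
  decide (r < z.a.im.natAbs) || decide (r < z.b.im.natAbs) ||
    (decide (r < z.c.im.natAbs) || decide (r < z.d.im.natAbs))

/-- Whether no line near `z` is tangent to one of the two curves. -/
def discsCertified (n b r : ℕ) (z : Quad GaussianInt) : Bool :=
  let m := 2 * (r * (2 * (b * n) + r + 4 * n))
  decide (m < gaussianSize (scaledDisc n z.a z.b)) &&
    decide (m < gaussianSize (scaledDisc n z.c z.d))

/-- Whether the discriminants at a real `z` have the given signs. -/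
def hasSigns (n : ℕ) (s t : SignType) (z : Quad GaussianInt) : Bool :=
  hasRealCoords z && (decide ((scaledDisc n z.a z.b).re.sign = s) &&
    decide ((scaledDisc n z.c z.d).re.sign = t))

theorem sign_re_eq {X D : ℂ} {m : ℕ} (h : ‖X - D‖ ≤ m) {d : GaussianInt}
    (hd : D = GaussianInt.toComplex d) (him : d.im = 0) (hm : 2 * m < gaussianSize d) :
    (SignType.sign X.re : ℤ) = d.re.sign := by
  have h₁ := (Complex.abs_re_le_norm _).trans h
  simp only [gaussianSize, him, Int.natAbs_zero, add_zero] at hm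
  have h₂ : (2 * m : ℝ) < |(d.re : ℝ)| := by
    rw [← Int.cast_abs, ← Nat.cast_natAbs]; exact_mod_cast hm
  rw [hd, Complex.sub_re, ← GaussianInt.intCast_re] at h₁
  have h₃ := abs_le.1 h₁
  have hm0 : (0 : ℝ) ≤ m := Nat.cast_nonneg m
  rcases lt_abs.1 h₂ with h₄ | h₄
  · rw [sign_pos (by linarith), Int.sign_eq_one_of_pos
      (by exact_mod_cast (by linarith : (0 : ℝ) < d.re))]
    rfl
  · rw [sign_neg (by linarith), Int.sign_eq_neg_one_of_neg
      (by exact_mod_cast (by linarith : (d.re : ℝ) < 0))]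
    rfl

theorem natCast_mul_re (n : ℕ) (z : ℂ) : ((n : ℂ) * z).re = n * z.re := by simp

theorem natCast_mul_im (n : ℕ) (z : ℂ) : ((n : ℂ) * z).im = n * z.im := by simp

namespace IsLineNear

variable {n b r : ℕ} {M : Quad (Quad ℂ)} {z : Quad GaussianInt} {w : Quad ℂ}

theorem not_isReal (h : IsLineNear n b r M (z.map GaussianInt.toComplex) w)
    (hz : isFarFromReal r z) : ¬ w.IsReal := by
  have key (i : Fin 4) (hi : r < (z.vec i).im.natAbs) : (w.vec i).im ≠ 0 := by
    intro h0
    have h₁ := (Complex.abs_im_le_norm _).trans (h.dist_le i)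
    rw [Quad.vec_map, Complex.sub_im, ← GaussianInt.intCast_im, natCast_mul_im, h0,
      mul_zero, zero_sub, abs_neg, ← Int.cast_abs, ← Nat.cast_natAbs] at h₁
    exact hi.not_ge (by exact_mod_cast h₁)
  simp only [isFarFromReal, Bool.or_eq_true, decide_eq_true_eq] at hz
  rintro ⟨⟨ha, hb⟩, hc, hd⟩
  rcases hz with (h | h) | h | h
  exacts [key 0 h ha, key 1 h hb, key 2 h hc, key 3 h hd]

theorem ne_of_separated {z' : Quad GaussianInt} {w' : Quad ℂ}
    (h : IsLineNear n b r M (z.map GaussianInt.toComplex) w)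
    (h' : IsLineNear n b r M (z'.map GaussianInt.toComplex) w') (hz : separated r z z') :
    w ≠ w' := by
  rintro rfl
  have key (i : Fin 4) : ¬ 4 * r < gaussianSize (z.vec i - z'.vec i) := by
    have h₁ := norm_sub_le_of_le (h'.dist_le i) (h.dist_le i)
    rw [sub_sub_sub_cancel_left, Quad.vec_map, Quad.vec_map, ← map_sub] at h₁
    have h₂ := gaussianSize_le (z.vec i - z'.vec i)
    rw [not_lt]
    have : (gaussianSize (z.vec i - z'.vec i) : ℝ) ≤ (4 * r : ℕ) := by push_cast; linarith
    exact_mod_cast this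
  simp only [separated, Bool.or_eq_true, decide_eq_true_eq] at hz
  rcases hz with (h | h) | h | h
  exacts [key 0 h, key 1 h, key 2 h, key 3 h]

theorem norm_disc_sub_toComplex_le (h : IsLineNear n b r M (z.map GaussianInt.toComplex) w)
    (i j : Fin 4) :
    ‖(n : ℂ) ^ 2 * (w.vec i ^ 2 - 4 * w.vec j)
        - GaussianInt.toComplex (scaledDisc n (z.vec i) (z.vec j))‖
      ≤ (r * (2 * (b * n) + r + 4 * n) : ℕ) := by
  have h₁ := h.norm_disc_sub_le i j
  rwa [Quad.vec_map, Quad.vec_map, show GaussianInt.toComplex (z.vec i) *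
    GaussianInt.toComplex (z.vec i) - 4 * (n * GaussianInt.toComplex (z.vec j))
    = GaussianInt.toComplex (scaledDisc n (z.vec i) (z.vec j)) by
      rw [scaledDisc, map_sub, map_mul, map_mul, map_natCast]
      push_cast
      ring] at h₁

theorem disc_ne_zero (h : IsLineNear n b r M (z.map GaussianInt.toComplex) w)
    (hz : discsCertified n b r z) : discT w ≠ 0 ∧ discS w ≠ 0 := by
  have key (i j : Fin 4) (hij : 2 * (r * (2 * (b * n) + r + 4 * n)) <
      gaussianSize (scaledDisc n (z.vec i) (z.vec j))) : w.vec i ^ 2 - 4 * w.vec j ≠ 0 := by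
    intro h0
    have h₁ := h.norm_disc_sub_toComplex_le i j
    rw [h0, mul_zero, zero_sub, norm_neg] at h₁
    have h₂ := gaussianSize_le (scaledDisc n (z.vec i) (z.vec j))
    have h₃ : ((2 * (r * (2 * (b * n) + r + 4 * n)) : ℕ) : ℝ) <
      gaussianSize (scaledDisc n (z.vec i) (z.vec j)) := by exact_mod_cast hij
    rw [Nat.cast_mul, Nat.cast_ofNat] at h₃
    linarith
  simp only [discsCertified, Bool.and_eq_true, decide_eq_true_eq] at hz
  exact ⟨key 0 1 hz.1, key 2 3 hz.2⟩

theorem sign_disc (hn : 0 < n) (h : IsLineNear n b r M (z.map GaussianInt.toComplex) w)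
    (hz : discsCertified n b r z) (hr : hasRealCoords z) :
    (SignType.sign (discT w).re : ℤ) = (scaledDisc n z.a z.b).re.sign ∧
    (SignType.sign (discS w).re : ℤ) = (scaledDisc n z.c z.d).re.sign := by
  have hn' : (0 : ℝ) < n := by exact_mod_cast hn
  have key (i j : Fin 4) (hij : 2 * (r * (2 * (b * n) + r + 4 * n)) <
      gaussianSize (scaledDisc n (z.vec i) (z.vec j))) (hi : (z.vec i).im = 0)
      (hj : (z.vec j).im = 0) : (SignType.sign (w.vec i ^ 2 - 4 * w.vec j).re : ℤ)
        = (scaledDisc n (z.vec i) (z.vec j)).re.sign := by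
    rw [← sign_re_eq (h.norm_disc_sub_toComplex_le i j) rfl (by
      simp [scaledDisc, hi, hj, Zsqrtd.im_mul]) hij]
    rw [← Nat.cast_pow, natCast_mul_re, sign_mul,
      sign_pos (by positivity : (0 : ℝ) < (n ^ 2 : ℕ)), one_mul]
  simp only [discsCertified, hasRealCoords, Bool.and_eq_true, decide_eq_true_eq] at hz hr
  exact ⟨key 0 1 hz.1 hr.1.1 hr.1.2, key 2 3 hz.2 hr.2.1 hr.2.2⟩

theorem hasSigns_iff (hn : 0 < n) (h : IsLineNear n b r M (z.map GaussianInt.toComplex) w)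
    (hz : discsCertified n b r z) (hr : w.IsReal ↔ hasRealCoords z) (s t : SignType) :
    (w.IsReal ∧ SignType.sign (discT w).re = s ∧ SignType.sign (discS w).re = t) ↔
      hasSigns n s t z := by
  simp only [hasSigns, Bool.and_eq_true, decide_eq_true_eq, hr]
  refine and_congr_right fun h₁ => ?_
  obtain ⟨h₂, h₃⟩ := h.sign_disc hn hz h₁
  have key : ∀ s t : SignType, (s : ℤ) = t ↔ s = t := by decide
  rw [← h₂, ← h₃, key, key]

end IsLineNear

def Quad.all {α : Type} (p : α → Bool) (q : Quad α) : Bool := (p q.a && p q.b) && (p q.c && p q.d)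

/-- An integer matrix with `n` times the approximate coordinates of its ten lines: the real ones,
and one from each pair of complex conjugates. -/
structure Witness where
  mat : Quad (Quad ℤ)
  real : List (Quad ℤ)
  cplx : List (Quad GaussianInt)

namespace Witness

def gaussianMat (W : Witness) : Quad (Quad GaussianInt) :=
  W.mat.map (Quad.map (Int.castRingHom GaussianInt))

def centers (W : Witness) : List (Quad GaussianInt) :=
  W.real.map (Quad.map (Int.castRingHom GaussianInt)) ++ (W.cplx ++ W.cplx.map (Quad.map star))

def linesCertified (n b C r : ℕ) (W : Witness) : Bool :=
  W.real.all (certified Int.natAbs n b C r W.mat) &&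
    W.cplx.all fun z => certified gaussianSize n b C r W.gaussianMat z && isFarFromReal r z

def isValid (n b C r : ℕ) (W : Witness) : Bool :=
  (W.mat.all (Quad.all fun x => decide (x.natAbs ≤ C)) &&
    (decide (detQuad W.mat ≠ 0) && decide (detQuint (leadingForms W.mat) ≠ 0))) &&
  (W.linesCertified n b C r &&
    (W.centers.all (discsCertified n b r) &&
      (decide (W.centers.Pairwise fun z z' => separated r z z') &&
        decide (W.centers.length = 10))))

/-- The numbers of totally, partially and minimally real lines. -/
def signature (n : ℕ) (W : Witness) : ℕ × ℕ × ℕ :=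
  (W.centers.countP (hasSigns n 1 1),
    W.centers.countP fun z => hasSigns n 1 (-1) z || hasSigns n (-1) 1 z,
    W.centers.countP (hasSigns n (-1) (-1)))

end Witness

theorem ncard_setOf_mem_map {α β : Type} {l : List α} {f : α → β} (hl : (l.map f).Nodup)
    {P : β → Prop} {p : α → Bool} (h : ∀ a ∈ l, P (f a) ↔ p a) :
    {w | w ∈ l.map f ∧ P w}.ncard = l.countP p := by
  classical
  have h₁ : {w | w ∈ l.map f ∧ P w} = (((l.filter p).map f).toFinset : Set β) := by
    ext w
    simp only [Set.mem_ofPred_eq, List.coe_toFinset, List.mem_map, List.mem_filter]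
    constructor
    · rintro ⟨⟨a, ha, rfl⟩, hP⟩
      exact ⟨a, ⟨ha, (h a ha).1 hP⟩, rfl⟩
    · rintro ⟨a, ⟨ha, hp⟩, rfl⟩
      exact ⟨⟨a, ha, rfl⟩, (h a ha).2 hp⟩
  rw [h₁, Set.ncard_coe_finset, List.toFinset_card_of_nodup, List.length_map,
    List.countP_eq_length_filter]
  exact hl.sublist (List.filter_sublist.map f)

theorem isReal_of_map_conj {w : Quad ℂ} (h : w.map (starRingEnd ℂ) = w) : w.IsReal := by
  obtain ⟨a, b, c, d⟩ := w
  simpa only [Quad.map, Quad.mk.injEq, Complex.conj_eq_iff_im, Quad.IsReal, and_assoc] using h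

theorem not_isReal_map_conj {w : Quad ℂ} (h : ¬ w.IsReal) :
    ¬ (w.map (starRingEnd ℂ)).IsReal := by
  simpa [Quad.IsReal, Quad.map] using h

theorem norm_vec_vec_map_le {R : Type} {φ : R → ℂ} {M : Quad (Quad R)} {C : ℕ}
    (h : ∀ i j, ‖φ ((M.vec i).vec j)‖ ≤ C) (i : Fin 4) :
    ‖((M.map (Quad.map φ)).vec i).vec‖ ≤ C :=
  (pi_norm_le_iff_of_nonneg (Nat.cast_nonneg C)).2 fun j => by
    rw [Quad.vec_map, Quad.vec_map]
    exact h i j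

theorem not_hasRealCoords {r : ℕ} {z : Quad GaussianInt} (h : isFarFromReal r z) :
    ¬ hasRealCoords z := by
  simp only [isFarFromReal, hasRealCoords, Bool.or_eq_true, Bool.and_eq_true,
    decide_eq_true_eq] at h ⊢
  rintro ⟨⟨h₁, h₂⟩, h₃, h₄⟩
  simp [h₁, h₂, h₃, h₄] at h

namespace Witness

variable {n b C r : ℕ} {W : Witness}

/-- The matrix of a witness over the complex numbers. -/
def complexMat (W : Witness) : Quad (Quad ℂ) := W.mat.map (Quad.map (Int.castRingHom ℂ))

theorem complexMat_map_conj (W : Witness) :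
    W.complexMat.map (Quad.map (starRingEnd ℂ)) = W.complexMat := by
  simp [complexMat, Quad.map]

theorem gaussianMat_map_toComplex (W : Witness) :
    W.gaussianMat.map (Quad.map GaussianInt.toComplex) = W.complexMat := by
  simp [complexMat, gaussianMat, Quad.map]

theorem map_intCast_map_toComplex (z : Quad ℤ) :
    (z.map (Int.castRingHom GaussianInt)).map GaussianInt.toComplex
      = z.map (Int.castRingHom ℂ) := by
  simp [Quad.map]

theorem map_star_map_toComplex (z : Quad GaussianInt) :
    (z.map star).map GaussianInt.toComplex
      = (z.map GaussianInt.toComplex).map (starRingEnd ℂ) := by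
  simp [Quad.map, GaussianInt.toComplex_star]

theorem norm_entry_le (hW : W.mat.all (Quad.all fun x => decide (x.natAbs ≤ C))) (i j : Fin 4) :
    ‖(((W.mat.vec i).vec j : ℤ) : ℂ)‖ ≤ C := by
  have h : ((W.mat.vec i).vec j).natAbs ≤ C := by
    simp only [Quad.all, Bool.and_eq_true, decide_eq_true_eq] at hW
    fin_cases i <;> fin_cases j <;> simp only [Quad.vec] <;> simp <;> tauto
  rw [Complex.norm_intCast, ← Int.cast_abs, ← Nat.cast_natAbs]
  exact_mod_cast h

theorem exists_line_of_mem_real (hn : 0 < n * C * r)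
    (hM : ∀ i j, ‖(((W.mat.vec i).vec j : ℤ) : ℂ)‖ ≤ C) {z : Quad ℤ}
    (hz : certified Int.natAbs n b C r W.mat z) :
    ∃ w, IsLineNear n b r W.complexMat
      ((z.map (Int.castRingHom GaussianInt)).map GaussianInt.toComplex) w ∧ w.IsReal := by
  obtain ⟨w, hw, hun⟩ := isLineNear_of_certified (φ := Int.castRingHom ℂ) (size := Int.natAbs)
    (fun x => by simp [Nat.cast_natAbs]) (fun x => by
      simp only [eq_intCast, Complex.norm_intCast, Nat.cast_natAbs, Int.cast_abs]
      linarith [abs_nonneg (x : ℝ)]) hn (norm_vec_vec_map_le hM) hz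
  rw [map_intCast_map_toComplex]
  have h := hw.conj W.complexMat_map_conj
  rw [show (z.map (Int.castRingHom ℂ)).map (starRingEnd ℂ) = z.map (Int.castRingHom ℂ) by
    simp [Quad.map]] at h
  exact ⟨w, hw, isReal_of_map_conj (hun _ h.isLine h.dist_le)⟩

theorem exists_line_of_mem_cplx (hn : 0 < n * C * r)
    (hM : ∀ i j, ‖(((W.mat.vec i).vec j : ℤ) : ℂ)‖ ≤ C) {z : Quad GaussianInt}
    (hz : certified gaussianSize n b C r W.gaussianMat z) (hr : isFarFromReal r z) :
    ∃ w, IsLineNear n b r W.complexMat (z.map GaussianInt.toComplex) w ∧ ¬ w.IsReal := by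
  obtain ⟨w, hw, -⟩ := isLineNear_of_certified norm_toComplex_le gaussianSize_le hn
    (norm_vec_vec_map_le fun i j => by
      simpa [gaussianMat, Quad.vec_map] using hM i j) hz
  rw [gaussianMat_map_toComplex] at hw
  exact ⟨w, hw, hw.not_isReal hr⟩

theorem exists_line (hn : 0 < n * C * r)
    (hM : ∀ i j, ‖(((W.mat.vec i).vec j : ℤ) : ℂ)‖ ≤ C) (hW : W.linesCertified n b C r)
    {z : Quad GaussianInt} (hz : z ∈ W.centers) :
    ∃ w, IsLineNear n b r W.complexMat (z.map GaussianInt.toComplex) w ∧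
      (w.IsReal ↔ hasRealCoords z) := by
  simp only [linesCertified, Bool.and_eq_true, List.all_eq_true] at hW
  simp only [centers, List.mem_append, List.mem_map] at hz
  rcases hz with ⟨y, hy, rfl⟩ | hz | ⟨y, hy, rfl⟩
  · obtain ⟨w, hw, hr⟩ := exists_line_of_mem_real hn hM (hW.1 y hy)
    exact ⟨w, hw, iff_of_true hr (by simp [hasRealCoords, Quad.map])⟩
  · obtain ⟨w, hw, hr⟩ := exists_line_of_mem_cplx hn hM (hW.2 z hz).1 (hW.2 z hz).2
    exact ⟨w, hw, iff_of_false hr (not_hasRealCoords (hW.2 z hz).2)⟩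
  · obtain ⟨w, hw, hr⟩ := exists_line_of_mem_cplx hn hM (hW.2 y hy).1 (hW.2 y hy).2
    refine ⟨w.map (starRingEnd ℂ), ?_, iff_of_false (not_isReal_map_conj hr) ?_⟩
    · rw [map_star_map_toComplex]
      exact hw.conj W.complexMat_map_conj
    · simpa [hasRealCoords, Quad.map] using not_hasRealCoords (hW.2 y hy).2

/-- The ten lines of a valid witness. -/
theorem exists_lines (hn : 0 < n * C * r) (hW : W.isValid n b C r) :
    ∃ f : Quad GaussianInt → Quad ℂ, (W.centers.map f).Nodup ∧ W.centers.length = 10 ∧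
      (∀ w, w ∈ secantLines W.complexMat ↔ w ∈ W.centers.map f) ∧
      (∀ w ∈ secantLines W.complexMat, IsUnit (diffQuot 1 W.complexMat w w).mat) ∧
      ∀ z ∈ W.centers, ∀ s t : SignType,
        ((f z).IsReal ∧ SignType.sign (discT (f z)).re = s ∧ SignType.sign (discS (f z)).re = t) ↔
          hasSigns n s t z := by
  classical
  simp only [isValid, Bool.and_eq_true, decide_eq_true_eq, List.all_eq_true (l := W.centers)] at hW
  obtain ⟨⟨hM, hdet, hforms⟩, hlines, hdisc, hsep, hlen⟩ := hW
  have hdet' : detQuad W.complexMat ≠ 0 := by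
    rw [complexMat, ← map_detQuad]
    simpa using hdet
  have hforms' : detQuint (leadingForms W.complexMat) ≠ 0 := by
    rw [complexMat, ← map_leadingForms, ← map_detQuint]
    simpa using hforms
  have : Nonempty (Quad ℂ) := ⟨⟨0, 0, 0, 0⟩⟩
  choose! f hf hreal using fun z (hz : z ∈ W.centers) =>
    exists_line hn (norm_entry_le hM) hlines hz
  have hnodup : (W.centers.map f).Nodup :=
    List.pairwise_map.2 (hsep.imp_of_mem fun ha hb h => (hf _ ha).ne_of_separated (hf _ hb) h)
  have hmem (w) : w ∈ secantLines W.complexMat ↔ w ∈ W.centers.map f := by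
    constructor
    · intro hw
      by_contra hw'
      have h₁ := card_le_ten_of_isLine hdet' hforms' (insert w (W.centers.map f).toFinset) (by
        simp only [Finset.mem_insert, List.mem_toFinset, List.mem_map]
        rintro _ (rfl | ⟨z, hz, rfl⟩)
        exacts [hw.1, (hf z hz).isLine])
      rw [Finset.card_insert_of_notMem (by simpa using hw'),
        List.toFinset_card_of_nodup hnodup, List.length_map, hlen] at h₁
      omega
    · intro hw
      obtain ⟨z, hz, rfl⟩ := List.mem_map.1 hw
      exact ⟨(hf z hz).isLine, (hf z hz).disc_ne_zero (hdisc z hz)⟩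
  refine ⟨f, hnodup, hlen, hmem, fun w hw => ?_, fun z hz s t => ?_⟩
  · obtain ⟨z, hz, rfl⟩ := List.mem_map.1 ((hmem w).1 hw)
    exact (hf z hz).isUnit
  · exact (hf z hz).hasSigns_iff (Nat.pos_of_mul_pos_right (Nat.pos_of_mul_pos_right hn))
      (hdisc z hz) (hreal z hz) s t

/-- The matrix of a witness over the real numbers. -/
def realMat (W : Witness) : Matrix (Fin 4) (Fin 4) ℝ := W.mat.mat.map Int.cast

theorem cm_realMat (W : Witness) : cm W.realMat = W.complexMat.mat := by
  ext i j
  simp [cm, realMat, complexMat, Quad.mat, Quad.vec_map]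

theorem isUnit_det_realMat (hW : W.isValid n b C r) : IsUnit W.realMat.det := by
  simp only [isValid, Bool.and_eq_true, decide_eq_true_eq] at hW
  have h := hW.1.2.1
  rw [detQuad_eq_det] at h
  rw [isUnit_iff_ne_zero, realMat, ← Int.cast_det]
  exact_mod_cast h

theorem realizes (hn : 0 < n * C * r) (hW : W.isValid n b C r) :
    IsUnit W.realMat.det ∧ (Ssol (cm W.realMat)).ncard = 40 ∧
      (∀ x ∈ Ssol (cm W.realMat), IsUnit (Jac (cm W.realMat) x)) ∧
      {x ∈ Ssol (cm W.realMat) | TotallyReal x}.ncard = 4 * (W.signature n).1 ∧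
      {x ∈ Ssol (cm W.realMat) | PartiallyReal x}.ncard
        = 4 * (W.signature n).2.1 ∧
      {x ∈ Ssol (cm W.realMat) | MinimallyReal x}.ncard = 4 * (W.signature n).2.2 := by
  refine ⟨isUnit_det_realMat hW, ?_⟩
  obtain ⟨f, hnodup, hlen, hmem, hunit, hsigns⟩ := exists_lines hn hW
  rw [cm_realMat, Ssol_eq_preimage]
  have hdisc : ∀ w ∈ secantLines W.complexMat, discT w ≠ 0 ∧ discS w ≠ 0 := fun w hw => hw.2
  have hne : ∀ x ∈ lineOf ⁻¹' secantLines W.complexMat, x 0 ≠ x 1 ∧ x 2 ≠ x 3 := by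
    intro x hx
    rw [← Ssol_eq_preimage] at hx
    exact hx.2
  have hcount (Q : (Fin 4 → ℂ) → Prop) (P : Quad ℂ → Prop) (p : Quad GaussianInt → Bool)
      (hQ : ∀ x ∈ lineOf ⁻¹' secantLines W.complexMat, Q x ↔ P (lineOf x))
      (hp : ∀ z ∈ W.centers, P (f z) ↔ p z) :
      {x ∈ lineOf ⁻¹' secantLines W.complexMat | Q x}.ncard = 4 * W.centers.countP p := by
    rw [← ncard_setOf_mem_map hnodup hp, ← ncard_preimage_lineOf _ fun w hw =>
      hdisc w ((hmem w).2 hw.1)]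
    congr 1
    ext x
    simp only [Set.mem_ofPred_eq, Set.mem_preimage, ← hmem]
    exact and_congr_right fun hx => hQ x hx
  refine ⟨?_, fun x hx => ?_, ?_, ?_, ?_⟩
  · have h := hcount (fun _ => True) (fun _ => True) (fun _ => true) (by simp) (by simp)
    simp only [and_true, List.countP_true, hlen] at h
    exact h
  · exact isUnit_Jac hx.1 (hne x hx).1 (hne x hx).2 (hunit _ hx)
  · refine hcount _ (fun w => w.IsReal ∧ 0 < (discT w).re ∧ 0 < (discS w).re) _
      (fun x hx => totallyReal_iff (hne x hx).1 (hne x hx).2) fun z hz => ?_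
    rw [← hsigns z hz, sign_eq_one_iff, sign_eq_one_iff]
  · refine hcount _ (fun w => w.IsReal ∧ (0 < (discT w).re ∧ (discS w).re < 0 ∨
      (discT w).re < 0 ∧ 0 < (discS w).re)) _
      (fun x hx => partiallyReal_iff (hne x hx).1 (hne x hx).2) fun z hz => ?_
    rw [Bool.or_eq_true, ← hsigns z hz, ← hsigns z hz, ← and_or_left]
    simp only [sign_eq_one_iff, sign_eq_neg_one_iff]
  · refine hcount _ (fun w => w.IsReal ∧ (discT w).re < 0 ∧ (discS w).re < 0) _
      (fun x hx => minimallyReal_iff) fun z hz => ?_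
    rw [← hsigns z hz, sign_eq_neg_one_iff, sign_eq_neg_one_iff]

end Witness

def Witness.realizesSignature (n b C r : ℕ) (p : (ℕ × ℕ × ℕ) × Witness) : Bool :=
  p.2.isValid n b C r && decide (p.2.signature n = p.1)

def realizationsZero : List ((ℕ × ℕ × ℕ) × Witness) :=
  [((0, 0, 0), ⟨⟨⟨-26, -4, 23, 2⟩, ⟨-14, 3, -19, 1⟩, ⟨15, 27, 1, 18⟩, ⟨-18, 99, 19, -9⟩⟩,
      [],
      [⟨⟨-1223466289, 5084979933⟩, ⟨1257455740, -1419916455⟩,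
         ⟨405211094, -260228240⟩, ⟨1707088535, 1048041557⟩⟩,
       ⟨⟨189264326, -638033448⟩, ⟨-2630994676, -596382442⟩,
         ⟨2815597276, 2949479787⟩, ⟨-3472292530, -2108110871⟩⟩,
       ⟨⟨-1037173479, -1053829018⟩, ⟨88825793, -736389743⟩,
         ⟨533867166, 2321783170⟩, ⟨502613565, -121211230⟩⟩,
       ⟨⟨757969376, 314508189⟩, ⟨1658470213, -1410891977⟩,
         ⟨-1507069743, 815112632⟩, ⟨-983186079, 1440345629⟩⟩,
       ⟨⟨1842977406, 984665013⟩, ⟨864773376, -2135399386⟩,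
         ⟨-413751443, 161150096⟩, ⟨-277036597, 1262001992⟩⟩]⟩)]

def realizationsTwo : List ((ℕ × ℕ × ℕ) × Witness) :=
  [((0, 0, 2), ⟨⟨⟨40, 14, 77, 10⟩, ⟨16, 29, -10, -17⟩, ⟨44, 2, -24, 2⟩, ⟨22, -99, 18, -18⟩⟩,
      [⟨-377560863, 739187165, -533759613, 2889100550⟩,
       ⟨1042751077, 2043814229, 188696848, 720494180⟩],
      [⟨⟨1254387652, -643920494⟩, ⟨-727098981, -108002565⟩,
         ⟨2508180986, 2477372150⟩, ⟨-1327514871, -326205675⟩⟩,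
       ⟨⟨110373802, 391383704⟩, ⟨730426874, -406493113⟩,
         ⟨-85419427, 874429391⟩, ⟨2084041190, 485853490⟩⟩,
       ⟨⟨-2058290541, -4874151434⟩, ⟨-598685889, 421497050⟩,
         ⟨14176386, 950434125⟩, ⟨-1865609860, 408236479⟩⟩,
       ⟨⟨-778456949, 945717437⟩, ⟨-1460210760, 21714394⟩,
         ⟨-3997521739, -2366103279⟩, ⟨-1717638967, 849908729⟩⟩]⟩),
    ((0, 1, 1), ⟨⟨⟨-16, 21, 43, 21⟩, ⟨13, -33, 10, -5⟩, ⟨99, 13, 0, 11⟩, ⟨-69, 34, 65, -35⟩⟩,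
      [⟨-3836043262, -762933429, -836025440, 6246230892⟩,
       ⟨-972543691, 2301779994, 63278225, 667099695⟩],
      [⟨⟨-2442487168, -3365068715⟩, ⟨-145128595, 239826801⟩,
         ⟨2097936149, 1033115467⟩, ⟨5070871487, -1647038223⟩⟩,
       ⟨⟨-3235258646, -961927914⟩, ⟨-610123136, 880099161⟩,
         ⟨-2067787656, 1559430227⟩, ⟨5924800076, 2315281209⟩⟩,
       ⟨⟨739393652, 80916633⟩, ⟨-496677736, 547230750⟩,
         ⟨-40503629, 956534685⟩, ⟨-1804389667, -935062981⟩⟩,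
       ⟨⟨100455572, 127018558⟩, ⟨-2062848812, 1576925358⟩,
         ⟨-835881493, 871747768⟩, ⟨-1427018115, 127207598⟩⟩]⟩),
    ((0, 2, 0), ⟨⟨⟨-30, -2, 29, 0⟩, ⟨-12, 3, -19, 2⟩, ⟨16, 20, 2, 21⟩, ⟨-16, 99, 23, -15⟩⟩,
      [⟨288706060, 2635585049, -3003933990, -2640894624⟩,
       ⟨497898960, 1694348518, -1955661784, -1343703181⟩],
      [⟨⟨-2627290144, -4823767810⟩, ⟨1293012188, 674508492⟩,
         ⟨305312050, 319472393⟩, ⟨1355457478, -771586802⟩⟩,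
       ⟨⟨179138904, -760862732⟩, ⟨-2480629703, -645228163⟩,
         ⟨1974175731, 1982247078⟩, ⟨-2704524751, -1364850871⟩⟩,
       ⟨⟨-1142299578, -1314486245⟩, ⟨140678445, -634604322⟩,
         ⟨632385158, 1961580530⟩, ⟨469902083, -231872064⟩⟩,
       ⟨⟨1846987726, 1087369135⟩, ⟨852626322, -2032882207⟩,
         ⟨-382637579, 79735515⟩, ⟨-452051689, 1042509736⟩⟩]⟩),
    ((1, 0, 1), ⟨⟨⟨56, 50, 66, 7⟩, ⟨9, 13, -10, -7⟩, ⟨59, -40, -28, 24⟩, ⟨42, -20, 99, -15⟩⟩,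
      [⟨-645702191, 2477685087, -248271879, 1697367774⟩,
       ⟨599240442, -1184626641, 5818213654, -816020648⟩],
      [⟨⟨-395866261, -415420564⟩, ⟨-111868893, -1199330102⟩,
         ⟨910848792, 3316836349⟩, ⟨2725972186, 410151733⟩⟩,
       ⟨⟨-762485400, -110887917⟩, ⟨536833098, -2038562970⟩,
         ⟨-1776827327, 3167905335⟩, ⟨3359883225, 1854570253⟩⟩,
       ⟨⟨3868099822, -4569164305⟩, ⟨-845426844, 173808126⟩,
         ⟨680932420, 706266245⟩, ⟨-2272163904, -276115455⟩⟩,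
       ⟨⟨-1396106192, -2569845453⟩, ⟨335434433, -582248216⟩,
         ⟨-736868261, 3576308⟩, ⟨-736092000, 1397771098⟩⟩]⟩),
    ((1, 1, 0), ⟨⟨⟨53, -25, 77, 29⟩, ⟨56, -56, 66, 17⟩, ⟨-41, 23, -12, 0⟩, ⟨-74, 99, 59, -13⟩⟩,
      [⟨-43891001, 540851413, -701507065, -469973903⟩,
       ⟨-663415273, -374168459, 510099687, -7417658183⟩],
      [⟨⟨748246926, 649307191⟩, ⟨935706960, 1277973600⟩,
         ⟨226429252, 648709204⟩, ⟨461957902, 451250726⟩⟩,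
       ⟨⟨182735147, 1160246216⟩, ⟨286921214, 1127049489⟩,
         ⟨271463225, 1446402971⟩, ⟨707901359, 1051663520⟩⟩,
       ⟨⟨1878130628, 5682223983⟩, ⟨-4657026342, -5798809690⟩,
         ⟨-3388272450, -808515959⟩, ⟨-1167522643, 2658391653⟩⟩,
       ⟨⟨1583221891, 6812916079⟩, ⟨1210312563, 2640297578⟩,
         ⟨-6531005043, 1223562496⟩, ⟨-2409419085, 6731904415⟩⟩]⟩),
    ((2, 0, 0), ⟨⟨⟨-5, 0, 6, 0⟩, ⟨-12, 1, -4, 2⟩, ⟨30, 13, 2, 4⟩, ⟨-17, 99, -1, -7⟩⟩,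
      [⟨-1036091435, -4768157805, 3199417458, -3656029182⟩,
       ⟨1404166251, -4992757002, 725521597, -3344018092⟩],
      [⟨⟨-1414679706, -2227688531⟩, ⟨2446966435, -3182996923⟩,
         ⟨694224679, 3197833601⟩, ⟨2930348534, -1188103783⟩⟩,
       ⟨⟨-476529781, -944076701⟩, ⟨2851985584, -3191187848⟩,
         ⟨-1000008759, 4941958339⟩, ⟨3207494186, 1950236725⟩⟩,
       ⟨⟨-1687670542, -4713594143⟩, ⟨3807436955, -1759271293⟩,
         ⟨502576035, 1587583018⟩, ⟨2587780812, -2080862586⟩⟩,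
       ⟨⟨1747023959, 1798287297⟩, ⟨-411391881, -4382018676⟩,
         ⟨-358319538, 169176076⟩, ⟨-1110590484, 3426664697⟩⟩]⟩)]

def realizationsFour : List ((ℕ × ℕ × ℕ) × Witness) :=
  [((0, 0, 4), ⟨⟨⟨25, 15, 81, 13⟩, ⟨25, 37, -9, -19⟩, ⟨51, 2, -34, 3⟩, ⟨15, -99, 38, -18⟩⟩,
      [⟨137387852, 577830725, 948760674, 2340872829⟩,
       ⟨578949504, 1559273488, 199610012, 723587209⟩,
       ⟨-562933775, 1039448278, -617970843, 2192403685⟩,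
       ⟨6174325, 902785462, 238879376, 1718144712⟩],
      [⟨⟨742920123, -680867267⟩, ⟨-1204665668, -507084041⟩,
         ⟨-1975268970, 6437932245⟩, ⟨-319868235, -2243644922⟩⟩,
       ⟨⟨-2493224150, -1571435074⟩, ⟨-1037765509, 503493400⟩,
         ⟨-1310176493, 1374671731⟩, ⟨-2563072318, 166476339⟩⟩,
       ⟨⟨2679443096, -3058768110⟩, ⟨-401319127, -87167332⟩,
         ⟨761630883, 530867589⟩, ⟨-1305907804, 150874330⟩⟩]⟩),
    ((0, 1, 3), ⟨⟨⟨-13, 34, 79, -9⟩, ⟨63, -16, -32, -69⟩, ⟨99, 34, -62, 46⟩, ⟨28, -40, 49, 32⟩⟩,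
      [⟨452867885, 1485388984, -401921142, 1158418467⟩,
       ⟨-234774182, 1669862289, -1281995884, 2118353413⟩,
       ⟨-652741430, 841780000, -6138067, -7902582171⟩,
       ⟨143540177, 566914829, 1071335718, 1975502904⟩],
      [⟨⟨177309412, -377232013⟩, ⟨403154770, -124592223⟩,
         ⟨1014634845, 664416872⟩, ⟨1535699009, 887425031⟩⟩,
       ⟨⟨400259857, 692764572⟩, ⟨-1061176327, 446248269⟩,
         ⟨70368717, 421669552⟩, ⟨-576073618, -38531715⟩⟩,
       ⟨⟨1425907203, 223970086⟩, ⟨1357345484, -1577841270⟩,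
         ⟨-548162007, 1004952754⟩, ⟨694665614, -617478946⟩⟩]⟩),
    ((0, 2, 2), ⟨⟨⟨-13, 13, 95, -15⟩, ⟨-13, 16, 22, -1⟩, ⟨99, 20, -10, 26⟩, ⟨7, -38, 4, -44⟩⟩,
      [⟨-973273949, 9698395997, 8046378849, 1090920262⟩,
       ⟨-365120060, 1310452287, -323823774, 640332646⟩,
       ⟨-396388406, 2133437365, -276419131, 325410708⟩,
       ⟨-1158905482, 7992156971, 8058406265, -2250775681⟩],
      [⟨⟨471222101, 4937659684⟩, ⟨86738358, 1468214281⟩,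
         ⟨1803199355, 315802567⟩, ⟨2811429166, 585525505⟩⟩,
       ⟨⟨109107739, -2306508327⟩, ⟨-165863816, -484283451⟩,
         ⟨-201277752, 1398721553⟩, ⟨-1459165899, -982465505⟩⟩,
       ⟨⟨-809787427, 2026151539⟩, ⟨-46452129, 442345538⟩,
         ⟨-701455337, 1372522355⟩, ⟨-3883621, -2459029020⟩⟩]⟩),
    ((0, 3, 1), ⟨⟨⟨-5, 18, 36, 21⟩, ⟨12, -31, 10, -6⟩, ⟨99, 12, 1, 11⟩, ⟨-72, 23, 60, -32⟩⟩,
      [⟨-7711800448, 23124353, 1218415213, 5234841535⟩,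
       ⟨-3212392708, -832034793, -968673595, 5041012044⟩,
       ⟨-1080777105, 2641829361, 199969485, 830541781⟩,
       ⟨-4878310482, -246971810, 511507374, 5495058920⟩],
      [⟨⟨-3210613441, -1231005509⟩, ⟨-240680923, 521735214⟩,
         ⟨-251479869, 2280673210⟩, ⟨7054608581, 683454511⟩⟩,
       ⟨⟨740315614, 86102769⟩, ⟨-465976622, 518696530⟩,
         ⟨-33927841, 1082156271⟩, ⟨-1850861559, -1118626277⟩⟩,
       ⟨⟨-36971080, 185934453⟩, ⟨-1885664718, 1641405447⟩,
         ⟨-727731559, 1025779271⟩, ⟨-1329139847, 98536725⟩⟩]⟩),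
    ((0, 4, 0), ⟨⟨⟨1, 2, 99, -43⟩, ⟨65, 22, 5, 10⟩, ⟨-27, 57, 11, 43⟩, ⟨-53, 19, -99, -37⟩⟩,
      [⟨-311243237, -524487096, 449667833, 858949183⟩,
       ⟨-1314274909, -416421799, 821273215, 1561126832⟩,
       ⟨696406975, 1230023112, -263117917, -531212303⟩,
       ⟨-2296580713, 129220158, 366328462, 2132326434⟩],
      [⟨⟨2664532652, -2840061363⟩, ⟨-1881350021, 599956187⟩,
         ⟨-514373376, 213006666⟩, ⟨995555627, -387382266⟩⟩,
       ⟨⟨-259790103, 294740094⟩, ⟨689632761, -156996465⟩,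
         ⟨-3560454547, 2645753302⟩, ⟨-1092734489, -481150463⟩⟩,
       ⟨⟨-739151441, 30683193⟩, ⟨1391019798, -504744159⟩,
         ⟨4805645874, 5461475852⟩, ⟨-2300177038, -37277539⟩⟩]⟩),
    ((1, 0, 3), ⟨⟨⟨64, 70, 80, 5⟩, ⟨15, 3, -12, -5⟩, ⟨99, -45, -43, 45⟩, ⟨44, -38, 85, -20⟩⟩,
      [⟨-448745742, 1063006353, 909849131, 2161421719⟩,
       ⟨-233136228, 1970838779, 95998131, 1953716943⟩,
       ⟨-27776866, 3320950494, -457334945, 1606105682⟩,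
       ⟨244827398, -1171442269, 4202177074, 567766322⟩],
      [⟨⟨84971986, -126240445⟩, ⟨-1028167401, -982194129⟩,
         ⟨3688935260, 2100603479⟩, ⟨1367471503, -1088606987⟩⟩,
       ⟨⟨3663253039, -1541293165⟩, ⟨-399706071, -278819140⟩,
         ⟨186980063, 722050437⟩, ⟨-1342356918, -589575606⟩⟩,
       ⟨⟨-3783455654, 2556878643⟩, ⟨539680302, 410011967⟩,
         ⟨-429844984, 675439746⟩, ⟨-1322353591, -1317834494⟩⟩]⟩),
    ((1, 1, 2), ⟨⟨⟨56, -25, 60, 28⟩, ⟨53, -44, 55, 15⟩, ⟨-34, 14, -13, 0⟩, ⟨-70, 99, 63, -13⟩⟩,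
      [⟨1242357642, 2268134790, 133491742, 447263510⟩,
       ⟨-99827475, 441897257, -847538131, -546716715⟩,
       ⟨-628570934, -325791058, 1287571982, -7827284089⟩,
       ⟨1576803848, 4305478104, 422278144, 619155095⟩],
      [⟨⟨-114699529, 1851688879⟩, ⟨92164625, 1487070671⟩,
         ⟨639614926, 1433622173⟩, ⟨1117934513, 960520736⟩⟩,
       ⟨⟨1911578123, 7049727258⟩, ⟨1283533013, 2537876821⟩,
         ⟨-6825183483, 1767987162⟩, ⟨-1320758164, 7243378479⟩⟩,
       ⟨⟨1562042892, 6675373279⟩, ⟨-4066654748, -6382563954⟩,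
         ⟨-3012143215, -880473873⟩, ⟨-1195210587, 2627067380⟩⟩]⟩),
    ((1, 2, 1), ⟨⟨⟨-18, 41, 31, -6⟩, ⟨5, -1, 2, 1⟩, ⟨99, 0, 0, 4⟩, ⟨13, -1, 0, -4⟩⟩,
      [⟨357355048, 4321908631, 6995224231, -857317060⟩,
       ⟨-15967954, 818589061, -1366138241, 3167103479⟩,
       ⟨-214319624, -6179032931, -938000266, -919269832⟩,
       ⟨600504049, 5110872534, 5786122207, -7595532468⟩],
      [⟨⟨119061931, 1859856694⟩, ⟨-4205474, 62998985⟩,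
         ⟨2727346986, 525723809⟩, ⟨7199944637, 2743601544⟩⟩,
       ⟨⟨1078725274, -1851197918⟩, ⟨-33657945, -185233866⟩,
         ⟨-1583062181, -2131156931⟩, ⟨-1868478148, 6782533973⟩⟩,
       ⟨⟨-339858184, -2434745138⟩, ⟨88614893, -164796563⟩,
         ⟨-1043839765, 2727697454⟩, ⟨-6244230114, -5683821298⟩⟩]⟩),
    ((1, 3, 0), ⟨⟨⟨-14, 21, 99, -19⟩, ⟨7, 67, -10, -5⟩, ⟨-54, 56, 8, 40⟩, ⟨-45, 8, -32, -60⟩⟩,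
      [⟨-891406820, -7900836172, 3957631692, -1300534267⟩,
       ⟨-1990918135, 124397170, -230847014, 6985992057⟩,
       ⟨971754078, 1420189257, -193932355, -521053169⟩,
       ⟨-2215824485, 5596551028, 7758413573, 1924690451⟩],
      [⟨⟨-815684937, -592128661⟩, ⟨-673674333, -56381220⟩,
         ⟨991783802, 586642401⟩, ⟨1406398110, 944268953⟩⟩,
       ⟨⟨732915828, -516255379⟩, ⟨-642793692, -324029563⟩,
         ⟨-482529360, 524727458⟩, ⟨626813561, -184021269⟩⟩,
       ⟨⟨314788858, 781102865⟩, ⟨931416287, -34383373⟩,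
         ⟨-694504769, 804820689⟩, ⟨-799511788, 136810434⟩⟩]⟩),
    ((2, 0, 2), ⟨⟨⟨37, 9, 78, 9⟩, ⟨16, 29, -11, -18⟩, ⟨44, 5, -25, 3⟩, ⟨20, -99, 19, -17⟩⟩,
      [⟨-363822101, 731673469, -502586787, 2896979084⟩,
       ⟨-1834731529, -1049511371, -2840127642, -2310533634⟩,
       ⟨1109895011, 2205426540, 207095207, 641532315⟩,
       ⟨987534383, -830703727, 6051887734, -1632538314⟩],
      [⟨⟨75178052, -385001052⟩, ⟨738412375, 387672760⟩,
         ⟨-90049083, -878328033⟩, ⟨2104256375, -494300306⟩⟩,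
       ⟨⟨603563186, -556303922⟩, ⟨-925517259, -210381709⟩,
         ⟨1374255098, 6927297378⟩, ⟨-1275712627, -888221094⟩⟩,
       ⟨⟨-2783906609, -2978650817⟩, ⟨-464415617, 480748157⟩,
         ⟨-253372589, 1090594652⟩, ⟨-2031571667, 526193143⟩⟩]⟩),
    ((2, 1, 1), ⟨⟨⟨-13, 25, 58, 23⟩, ⟨18, -39, 12, -7⟩, ⟨99, 18, -3, 14⟩, ⟨-65, 34, 80, -44⟩⟩,
      [⟨-3820745827, -652522958, -847503560, 6179312953⟩,
       ⟨222588161, -1379049102, -387709729, -1422349456⟩,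
       ⟨-30065001, -3015531427, -1522095855, -1492491587⟩,
       ⟨-947277825, 2138575715, 21228422, 660523940⟩],
      [⟨⟨-2973952028, -3851209432⟩, ⟨-91764429, 332922812⟩,
         ⟨1898886086, 841578086⟩, ⟨4701894436, -1329426607⟩⟩,
       ⟨⟨-3263319218, -927532408⟩, ⟨-483518617, 893980325⟩,
         ⟨-2158204109, 1983262003⟩, ⟨6400636098, 2134159461⟩⟩,
       ⟨⟨524259907, 216325540⟩, ⟨-658556766, 583229495⟩,
         ⟨-94205844, 719032305⟩, ⟨-1380411350, -550798311⟩⟩]⟩),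
    ((2, 2, 0), ⟨⟨⟨-18, -5, 13, 1⟩, ⟨-13, -2, -9, 2⟩, ⟨25, 18, 3, 9⟩, ⟨-15, 99, 10, -26⟩⟩,
      [⟨40067657, -3403925992, 1539430129, -2678831930⟩,
       ⟨-257559350, 3662881226, -2523673079, -2943676708⟩,
       ⟨25521595, 2374204930, -1982036554, -1493713312⟩,
       ⟨-1861600942, -3177419253, 4108023432, -3659641849⟩],
      [⟨⟨-1793074870, 5003088833⟩, ⟨2070534880, 191057262⟩,
         ⟨527087999, -880607250⟩, ⟨1313858587, 1783053372⟩⟩,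
       ⟨⟨-2942493316, -2104410543⟩, ⟨527080470, -2261645866⟩,
         ⟨703026010, 2624944365⟩, ⟨997456179, -1820199294⟩⟩,
       ⟨⟨645743758, 1983467738⟩, ⟨1662174210, -2834181697⟩,
         ⟨-297771443, 143738377⟩, ⟨-1035661635, 2119123717⟩⟩]⟩),
    ((3, 0, 1), ⟨⟨⟨58, 49, 70, 7⟩, ⟨15, 11, -8, -7⟩, ⟨61, -37, -27, 25⟩, ⟨37, -23, 99, -17⟩⟩,
      [⟨-573630714, 2470445334, -218680875, 1601021633⟩,
       ⟨3501562958, -525862052, 1026519654, -1958081564⟩,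
       ⟨6016349093, -241690901, 344500471, -1617286773⟩,
       ⟨405997633, -1135382039, 5883879101, -791362098⟩],
      [⟨⟨-280890317, -356532770⟩, ⟨-454714345, -1114248274⟩,
         ⟨1785064517, 3933535002⟩, ⟨2741087492, -88909485⟩⟩,
       ⟨⟨-860024015, -326111694⟩, ⟨607036148, -1570103009⟩,
         ⟨-1175943996, 2395088781⟩, ⟨2658939424, 1800509652⟩⟩,
       ⟨⟨-2069177217, -2280131108⟩, ⟨370818752, -730629928⟩,
         ⟨-855203370, -134735717⟩, ⟨-826116156, 1645075722⟩⟩]⟩),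
    ((3, 1, 0), ⟨⟨⟨99, 73, 81, 20⟩, ⟨24, -3, 17, -6⟩, ⟨69, -39, -35, 28⟩, ⟨48, -17, 97, -14⟩⟩,
      [⟨642247262, -388693961, 4064649694, 737828057⟩,
       ⟨1872868770, 68490390, -145066656, -458929515⟩,
       ⟨-447455260, -7490001370, -811477969, 1241441586⟩,
       ⟨1480803522, -202296403, 2121334007, -1947597096⟩],
      [⟨⟨-833352667, -703536244⟩, ⟨107924898, -590451901⟩,
         ⟨1377846983, 1273556852⟩, ⟨2128395817, 315977042⟩⟩,
       ⟨⟨-1984663207, -2908696⟩, ⟨65591366, -204475667⟩,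
         ⟨-1577447355, -962348070⟩, ⟨-1929388598, 2626629655⟩⟩,
       ⟨⟨-202792620, 223417386⟩, ⟨-2610077900, -1159744748⟩,
         ⟨-6777025339, 1623777268⟩, ⟨4085404221, 4467150912⟩⟩]⟩),
    ((4, 0, 0), ⟨⟨⟨-9, -7, 23, 4⟩, ⟨-12, 2, -8, 3⟩, ⟨18, 18, -1, 3⟩, ⟨-23, 99, -3, -8⟩⟩,
      [⟨3060673438, -3528578325, 123081121, -1437348721⟩,
       ⟨1453070307, -909812895, -169358848, -4614172828⟩,
       ⟨2278357292, -1845294498, -107348537, -2579995872⟩,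
       ⟨-1721464093, -754141225, 5080945252, -692771444⟩],
      [⟨⟨1891630742, -5278993576⟩, ⟨1229883628, 528530477⟩,
         ⟨1149668154, 1070134223⟩, ⟨1739782842, -2166030317⟩⟩,
       ⟨⟨-2336758188, -1585735846⟩, ⟨453738692, -2499182286⟩,
         ⟨-2019818036, 5134098161⟩, ⟨2288177780, -141519174⟩⟩,
       ⟨⟨72029249, -836582443⟩, ⟨1363137749, -1587942796⟩,
         ⟨-4877602104, 2697099183⟩, ⟨-353830213, 3092178310⟩⟩]⟩)]

def realizationsSix : List ((ℕ × ℕ × ℕ) × Witness) :=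
  [((0, 0, 6), ⟨⟨⟨-15, 46, 73, 6⟩, ⟨75, -3, -13, -94⟩, ⟨99, 53, -2, 84⟩, ⟨4, -53, 51, 11⟩⟩,
      [⟨-410120887, 549967982, 487720331, 2147126695⟩,
       ⟨-711056040, 870590054, -423331999, 3251445387⟩,
       ⟨316662168, 1736968632, -548570737, 809282868⟩,
       ⟨-743533586, 1426413864, -1054418432, 1945215581⟩,
       ⟨274273238, 609062341, 270023736, 903936912⟩,
       ⟨-41075015, 445023482, 507018300, 1326206736⟩],
      [⟨⟨836392363, 144257338⟩, ⟨1311807675, -912066769⟩,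
         ⟨-456071799, 489334321⟩, ⟨563448543, -244701669⟩⟩,
       ⟨⟨146124493, 735426986⟩, ⟨-1101357874, 141030874⟩,
         ⟨82313658, 673147112⟩, ⟨-797692453, -100691246⟩⟩]⟩),
    ((0, 1, 5), ⟨⟨⟨-8, 41, 75, -4⟩, ⟨66, -23, -34, -94⟩, ⟨99, 37, -57, 71⟩, ⟨36, -43, 56, 31⟩⟩,
      [⟨163972000, 403264435, 974571229, 1382142014⟩,
       ⟨580842058, 762460277, 359093858, 853376052⟩,
       ⟨-438037048, 2180500798, -1230812683, 1682117544⟩,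
       ⟨-787109404, 886515356, -149107968, -8826268364⟩,
       ⟨396440033, 2214539747, -679172941, 1001160315⟩,
       ⟨-151640759, 421428889, 1433799837, 2182738657⟩],
      [⟨⟨1018811876, 42814344⟩, ⟨1388299381, -941565433⟩,
         ⟨-303881543, 549418363⟩, ⟨606579161, -197694197⟩⟩,
       ⟨⟨387908178, 696706693⟩, ⟨-1162447316, 394988622⟩,
         ⟨30604247, 455178058⟩, ⟨-507218123, -30478028⟩⟩]⟩),
    ((0, 2, 4), ⟨⟨⟨25, 42, 99, 9⟩, ⟨-21, 9, 26, -20⟩, ⟨15, 46, -6, 60⟩, ⟨98, 11, 1, -74⟩⟩,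
      [⟨-2734809573, -958707835, 1103536520, 1983483360⟩,
       ⟨-216147586, 2468804037, -629821660, 370214667⟩,
       ⟨-470755877, 878219457, -1106554064, 951069196⟩,
       ⟨-778885613, 722000730, -1425081370, 1268156301⟩,
       ⟨-97677541, 1311336617, -804179773, 651537261⟩,
       ⟨-6414641415, -2327306322, 820205820, 1245583903⟩],
      [⟨⟨-394296268, -1922751247⟩, ⟨-485956011, -303571137⟩,
         ⟨204219030, 1085583806⟩, ⟨-750458469, -39911359⟩⟩,
       ⟨⟨-2687417938, 520613153⟩, ⟨3997055970, -1495609993⟩,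
         ⟨-10880835363, 2776085889⟩, ⟨4004535018, 2145356454⟩⟩]⟩),
    ((0, 3, 3), ⟨⟨⟨-41, 66, 99, -34⟩, ⟨-7, 44, 7, 4⟩, ⟨40, -10, -15, 8⟩, ⟨-7, -84, -72, -66⟩⟩,
      [⟨1912491410, 10197113003, 3646153757, 1294503283⟩,
       ⟨772822841, 526603859, -14189681, 746479929⟩,
       ⟨-652377609, 1780062188, -640699369, -189861234⟩,
       ⟨-265820302, 322796231, -1196688793, 1180012091⟩,
       ⟨420369881, 491355953, -320116986, 669969956⟩,
       ⟨5670275809, 1851350120, 1628217065, 1722648171⟩],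
      [⟨⟨-10482570573, -1802554493⟩, ⟨5071735259, -2331652601⟩,
         ⟨3622855752, 1012908504⟩, ⟨-5592251499, -2722371039⟩⟩,
       ⟨⟨-550237254, -1973189047⟩, ⟨-359794912, 131840785⟩,
         ⟨-691697582, 1041550806⟩, ⟨-644571319, -176784640⟩⟩]⟩),
    ((0, 4, 2), ⟨⟨⟨-11, 12, 99, -13⟩, ⟨-12, 17, 18, -1⟩, ⟨94, 11, -6, 27⟩, ⟨10, -38, 6, -37⟩⟩,
      [⟨-993134713, 10186914270, 9843332114, 1102938561⟩,
       ⟨-10141595269, -2787878910, 1892410538, 2860887851⟩,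
       ⟨-274213621, 1181991438, -194157554, 683158817⟩,
       ⟨-312938315, 1917206105, -204582030, 365755792⟩,
       ⟨6224861814, 1655962670, 1586633636, 2334796355⟩,
       ⟨-1113345979, 8149771656, 10200367226, -2133313369⟩],
      [⟨⟨127775344, -2226126420⟩, ⟨-153337060, -394879519⟩,
         ⟨-335434271, 1425031244⟩, ⟨-1462483267, -1024937623⟩⟩,
       ⟨⟨-761181662, 1933444584⟩, ⟨-13873230, 365881160⟩,
         ⟨-719687988, 1171222033⟩, ⟨-108457465, -2442275285⟩⟩]⟩),
    ((0, 5, 1), ⟨⟨⟨69, -22, 45, 31⟩, ⟨90, -42, 67, 27⟩, ⟨-45, 36, 15, -17⟩, ⟨-81, 99, 84, -24⟩⟩,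
      [⟨-42904938, 359528645, 6838374300, -8421588566⟩,
       ⟨3531638184, 343160444, 956940280, 1117475481⟩,
       ⟨-67480429, 321299864, 7572758050, 3028599349⟩,
       ⟨-32403835, 399028512, -649664303, -387326645⟩,
       ⟨2971244220, -1781166158, 906655447, 1081693154⟩,
       ⟨1263196391, 8965673035, 666562037, 948304217⟩],
      [⟨⟨3187779707, -563328007⟩, ⟨-8119434, -1919674120⟩,
         ⟨-2274596312, -611950459⟩, ⟨-927047518, 2810180866⟩⟩,
       ⟨⟨3167066858, -644534077⟩, ⟨-123955312, -1936234421⟩,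
         ⟨-2248563968, 1266136214⟩, ⟨-1620781523, -2321835556⟩⟩]⟩),
    ((0, 6, 0), ⟨⟨⟨2, -1, 99, -40⟩, ⟨68, 29, 7, 8⟩, ⟨-29, 64, 9, 49⟩, ⟨-52, 17, -92, -45⟩⟩,
      [⟨-1213645839, -510721060, 831498477, 1603874573⟩,
       ⟨-285907425, -577900677, 462131591, 905923983⟩,
       ⟨-19612642, 727268881, -2373428780, -782177107⟩,
       ⟨-314123733, 837928339, -4199173973, -320871441⟩,
       ⟨567352844, 1064817965, -434146856, -596987837⟩,
       ⟨-2156787121, 39715790, 373155579, 2257315423⟩],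
      [⟨⟨-838126487, 45823505⟩, ⟨1430592840, -656358194⟩,
         ⟨3083447170, 6320494037⟩, ⟨-2358697677, -608458381⟩⟩,
       ⟨⟨2132682330, -2235958262⟩, ⟨-1641464439, 277298355⟩,
         ⟨-501200415, 290523821⟩, ⟨934349898, -405860677⟩⟩]⟩),
    ((1, 0, 5), ⟨⟨⟨24, 47, 99, -11⟩, ⟨18, 11, -21, -18⟩, ⟨50, 6, -38, 31⟩, ⟨40, -17, 63, -14⟩⟩,
      [⟨-830060544, 719784389, -174146288, 5705631214⟩,
       ⟨1868487102, -570872434, 719537120, -626764022⟩,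
       ⟨-214793016, 1113748936, -693415604, 1403364217⟩,
       ⟨941771468, 2483488074, -475545336, 425339392⟩,
       ⟨-502496054, 961428757, -850458179, 2222359585⟩,
       ⟨-737173657, 829435546, -900707457, 3983312393⟩],
      [⟨⟨547437260, -464924161⟩, ⟨-379604566, -619258004⟩,
         ⟨1992135517, 1473665220⟩, ⟨1091422737, 72850379⟩⟩,
       ⟨⟨1334890574, -786482687⟩, ⟨-755872652, -742646399⟩,
         ⟨1107809394, 1632643240⟩, ⟨-908672705, -507444065⟩⟩]⟩),
    ((1, 1, 4), ⟨⟨⟨13, 52, 99, -19⟩, ⟨15, 14, -35, -26⟩, ⟨43, 11, -40, 38⟩, ⟨30, -10, 52, -13⟩⟩,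
      [⟨2231444904, -1130920883, 699208805, -623332246⟩,
       ⟨-984151290, 856671984, 4370365862, -10559352550⟩,
       ⟨319114091, 1361228636, -708871518, 611392230⟩,
       ⟨4088536, 1182923167, -922192347, 928049018⟩,
       ⟨688635878, 1729950671, -580037679, 388433215⟩,
       ⟨-795295466, 567297275, 2701906961, 10371127886⟩],
      [⟨⟨561915853, -492249893⟩, ⟨-260893202, -573354985⟩,
         ⟨1382568293, 1194524625⟩, ⟨833334627, 181482753⟩⟩,
       ⟨⟨1580084874, -1149556389⟩, ⟨-778072555, -1020841128⟩,
         ⟨365777211, 1594128763⟩, ⟨-597668342, -624494501⟩⟩]⟩),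
    ((1, 2, 3), ⟨⟨⟨-5, 63, 99, -27⟩, ⟨-9, 37, 4, 2⟩, ⟨67, 3, -21, 6⟩, ⟨71, -67, -40, -37⟩⟩,
      [⟨-378172049, 9958594584, 4243820352, -94543811⟩,
       ⟨-10222998167, 3138706071, 5603460386, -10310771949⟩,
       ⟨822494541, 1465499988, -578268699, 475178495⟩,
       ⟨-174475014, 355926097, -1953571601, 2987525751⟩,
       ⟨852638338, 798507179, -618992779, 1081934464⟩,
       ⟨-3431917817, 8850768441, 3831441366, -3085655917⟩],
      [⟨⟨1780942925, 2947560593⟩, ⟨376028670, 434297257⟩,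
         ⟨1647066232, 1581258904⟩, ⟨2503576336, 2037690780⟩⟩,
       ⟨⟨262072727, -1813387473⟩, ⟨-190236739, -93760888⟩,
         ⟨-308412277, 1270762551⟩, ⟨-1362625604, 54410824⟩⟩]⟩),
    ((1, 3, 2), ⟨⟨⟨-31, 76, 99, -46⟩, ⟨-2, 32, 11, 2⟩, ⟨43, -8, -20, 16⟩, ⟨4, -75, -60, -52⟩⟩,
      [⟨1229145212, 9165232676, 2934779115, 737241483⟩,
       ⟨-2871442621, 5634378250, 2178438738, -2635172938⟩,
       ⟨-35530866, 2401160706, -599878535, -114686303⟩,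
       ⟨-247515678, 363290568, -1467243112, 1643859861⟩,
       ⟨37073299, 419888413, -1080762754, 1210834990⟩,
       ⟨-4258321242, 930299829, 6536512711, -10697530997⟩],
      [⟨⟨1800634922, 2498921918⟩, ⟨446712525, 518463947⟩,
         ⟨1125393988, 835658248⟩, ⟨1313392700, 475305955⟩⟩,
       ⟨⟨2938803, -1995049485⟩, ⟨-190992371, -68777760⟩,
         ⟨-605557411, 858690773⟩, ⟨-646459051, -314235203⟩⟩]⟩),
    ((1, 4, 1), ⟨⟨⟨-24, 99, 39, -13⟩, ⟨7, -3, -6, 1⟩, ⟨99, 0, 0, 11⟩, ⟨14, -4, 1, -9⟩⟩,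
      [⟨-362661304, -8907300129, 4567672474, 1363499066⟩,
       ⟨2057913198, -169659577, 1840023916, 3378706190⟩,
       ⟨-956109846, 8897010057, 3172910251, -8838966451⟩,
       ⟨464646435, 4664816621, -1703876283, -60009574⟩,
       ⟨-428354905, 611575175, -2865278714, 7716422014⟩,
       ⟨-2537406645, 215401998, 2450713557, 5725615328⟩],
      [⟨⟨293005479, -2722664042⟩, ⟨-242803378, 155780512⟩,
         ⟨-789831335, 1904903239⟩, ⟨-2824147899, -2969931292⟩⟩,
       ⟨⟨-308234763, -1941125993⟩, ⟨239197876, 99218180⟩,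
         ⟨-1268000501, -1611389665⟩, ⟨-881650744, 4298586351⟩⟩]⟩),
    ((1, 5, 0), ⟨⟨⟨-10, 28, 99, -24⟩, ⟨6, 64, -9, -6⟩, ⟨-54, 71, 9, 34⟩, ⟨-30, 10, -35, -43⟩⟩,
      [⟨-2168409583, 6087373202, 5484639869, 1083250226⟩,
       ⟨-1768118572, -21648022, 142496963, 7642913025⟩,
       ⟨738857493, -351919864, -694105763, 1061559846⟩,
       ⟨402643134, 985214492, -815033952, -664331167⟩,
       ⟨111534634, -640147984, 7196345, 910526552⟩,
       ⟨-636289482, -7550479570, 3389675838, -915237457⟩],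
      [⟨⟨-560067088, -546093520⟩, ⟨-673591220, -46506109⟩,
         ⟨760932663, 653710497⟩, ⟨1156891712, 729325417⟩⟩,
       ⟨⟨470101095, 650417631⟩, ⟨773154112, 118223007⟩,
         ⟨-655795178, 815384167⟩, ⟨-740297091, 239466497⟩⟩]⟩),
    ((2, 0, 4), ⟨⟨⟨21, 16, 56, 8⟩, ⟨21, 25, -7, -15⟩, ⟨48, 4, -29, 4⟩, ⟨19, -99, 34, -20⟩⟩,
      [⟨1804804687, -885413821, 2959796998, -1681325066⟩,
       ⟨91263033, 1239722259, 101322197, 1692418859⟩,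
       ⟨809874532, 2308236363, 45581147, 739159145⟩,
       ⟨-3255622238, -1125846066, -1380791159, -2289885740⟩,
       ⟨-621892736, 1372166897, -726457671, 2282002566⟩,
       ⟨241188474, 774194119, 765208227, 2224320852⟩],
      [⟨⟨1049976677, -622297684⟩, ⟨-1285719472, -480697807⟩,
         ⟨1831906065, 5734650055⟩, ⟨-1429607587, -1824589038⟩⟩,
       ⟨⟨-2893813009, -1816292388⟩, ⟨-851338531, 383035562⟩,
         ⟨-764863626, 1172613370⟩, ⟨-2329375258, 500383979⟩⟩]⟩),
    ((2, 1, 3), ⟨⟨⟨44, 50, 43, 28⟩, ⟨99, 2, 44, -37⟩, ⟨83, 43, -11, 12⟩, ⟨21, -99, 19, 30⟩⟩,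
      [⟨410328726, -418774036, 1346906965, -912667395⟩,
       ⟨1541311391, 3845886225, -53060128, 1290884818⟩,
       ⟨-1648716914, -7568845649, -695574896, 1053213999⟩,
       ⟨-22770630, -506564798, 362599929, -1915139859⟩,
       ⟨-1050074555, 2515928073, -524641419, 2469836541⟩,
       ⟨783537431, 2530654268, 99542870, 1567997035⟩],
      [⟨⟨-746866116, -1392875551⟩, ⟨1033734604, 657333336⟩,
         ⟨2360976173, -1558904055⟩, ⟨3505767497, 4335836451⟩⟩,
       ⟨⟨611449679, -1539795285⟩, ⟨916098791, -1669383591⟩,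
         ⟨380929054, 686869117⟩, ⟨637260330, 839718953⟩⟩]⟩),
    ((2, 2, 2), ⟨⟨⟨5, 27, 99, -10⟩, ⟨4, 6, 4, -3⟩, ⟨99, 15, -6, 13⟩, ⟨3, -16, 15, -21⟩⟩,
      [⟨-341381961, -6190384322, 8819245852, 2036742730⟩,
       ⟨-50143902, -7664798169, 8358800506, -3684515439⟩,
       ⟨-108448045, 1676865323, -392775928, 665332504⟩,
       ⟨-12456191, 2720881388, -352107161, 419673142⟩,
       ⟨1928072052, 94894283, 1829663920, 3240784922⟩,
       ⟨-2386665934, -89050012, 2612471931, 8778768616⟩],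
      [⟨⟨2748740973, -1358033451⟩, ⟨-9098916, -171580555⟩,
         ⟨-343823345, 1710541617⟩, ⟨-1569896133, -2123141534⟩⟩,
       ⟨⟨-2607373317, -658264617⟩, ⟨8192087, -105366660⟩,
         ⟨-1339646752, -2124067528⟩, ⟨-1347874210, 6020972929⟩⟩]⟩),
    ((2, 3, 1), ⟨⟨⟨-13, 22, 64, 28⟩, ⟨9, -30, 20, -9⟩, ⟨99, 21, 5, 21⟩, ⟨-61, 26, 65, -47⟩⟩,
      [⟨-31496277, -1686229787, -641213861, -1420953727⟩,
       ⟨-979661336, 2199587494, -25971633, 484685823⟩,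
       ⟨-2261673106, -1096277169, -1724074434, 4190717548⟩,
       ⟨-82919845, -2535784825, -1440547158, -1608105929⟩,
       ⟨-3145479311, -607967978, -233760120, 3898019996⟩,
       ⟨8176863318, 209260682, 1525045450, 2819113766⟩],
      [⟨⟨669959411, -225461200⟩, ⟨-270941862, -552100516⟩,
         ⟨-174959897, -1022268311⟩, ⟨-1110495600, 929407637⟩⟩,
       ⟨⟨-2337314632, -706525151⟩, ⟨-206572888, 618299211⟩,
         ⟨-3290948520, 3997736003⟩, ⟨7637635496, 2965540095⟩⟩]⟩),
    ((2, 4, 0), ⟨⟨⟨-28, 27, 69, -15⟩, ⟨-14, 20, -19, 6⟩, ⟨56, 42, -2, 26⟩, ⟨-18, 99, -13, -39⟩⟩,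
      [⟨-7230242860, 916765618, 996638490, 3428946719⟩,
       ⟨-487084694, -1827412895, 1203791740, -1443195895⟩,
       ⟨131557949, -1853004301, 429933267, -1049318327⟩,
       ⟨-820722101, 1428250566, -7139655539, 344301972⟩,
       ⟨-601108084, 6258649047, 7319444926, 2454125292⟩,
       ⟨6499263059, -414461406, 1007243900, 1842829018⟩],
      [⟨⟨-1718705113, -535318001⟩, ⟨417131970, -1133932885⟩,
         ⟨1333529812, 2517858377⟩, ⟨13791511, -1440074702⟩⟩,
       ⟨⟨1273621142, 191408342⟩, ⟨-411577926, -825978804⟩,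
         ⟨-539734923, -530398624⟩, ⟨-556287498, 1074856192⟩⟩]⟩),
    ((3, 0, 3), ⟨⟨⟨90, 82, 73, 7⟩, ⟨27, 3, -10, -5⟩, ⟨92, -37, -59, 38⟩, ⟨47, -40, 99, -22⟩⟩,
      [⟨251633751, -800956318, 4249405305, 467808480⟩,
       ⟨-563399365, 1532038234, 679132753, 3126935357⟩,
       ⟨-350840460, 2954721962, -365264457, 2775070086⟩,
       ⟨2896190992, 18995199, 220651532, -910240684⟩,
       ⟨2114693226, -337951095, 1292975709, -1615481451⟩,
       ⟨-59003339, 5039407367, -871383912, 2236031034⟩],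
      [⟨⟨-126813236, -231500632⟩, ⟨-579023339, -967104430⟩,
         ⟨3403727028, 2470532858⟩, ⟨2216778028, -1372869868⟩⟩,
       ⟨⟨-3901723197, 966379471⟩, ⟨261704061, 486463444⟩,
         ⟨-234323893, 702364707⟩, ⟨-1657071282, -1263170702⟩⟩]⟩),
    ((3, 1, 2), ⟨⟨⟨-14, 61, 99, -6⟩, ⟨-10, 11, 8, -26⟩, ⟨49, 7, -2, 11⟩, ⟨45, -5, 12, -40⟩⟩,
      [⟨1033539182, -2049392464, 5136050587, 1977726206⟩,
       ⟨1951458216, 192444434, 1026938844, 1034007006⟩,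
       ⟨-377347618, 355874716, -912996856, 1084332471⟩,
       ⟨2183740847, -9335477151, -554970770, -199069201⟩,
       ⟨-90957476, 582008134, -754541007, 761301606⟩,
       ⟨2191352798, -2668405024, 2988133408, -3306724427⟩],
      [⟨⟨-946537522, -139867880⟩, ⟨-76483091, 52228504⟩,
         ⟨962727435, 1312813020⟩, ⟨-1146324498, 2012719745⟩⟩,
       ⟨⟨3211426843, -451291256⟩, ⟨170822690, -497894841⟩,
         ⟨-382625896, 1065028905⟩, ⟨-598797288, -986258725⟩⟩]⟩),
    ((3, 2, 1), ⟨⟨⟨26, 42, 28, -7⟩, ⟨-21, -1, 3, -3⟩, ⟨99, 8, -3, 8⟩, ⟨23, 0, 2, -5⟩⟩,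
      [⟨-2222858665, -127637246, 2752386388, 7879969819⟩,
       ⟨2075341357, -8657891033, 4167755528, -1370098609⟩,
       ⟨-475472231, 952455323, -1897262727, 4502038354⟩,
       ⟨1053317984, -3900165707, -978965863, -128844550⟩,
       ⟨1775168908, -7658714522, 3577244505, -3768151398⟩,
       ⟨5341551864, 284887152, 2332373817, 5419050070⟩],
      [⟨⟨3017703332, 618660624⟩, ⟨140285984, 145131523⟩,
         ⟨-772779930, 1935574738⟩, ⟨-2010249884, -3718034435⟩⟩,
       ⟨⟨-1783939336, -232574420⟩, ⟨-110449957, -79908969⟩,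
         ⟨-950085717, 2579948142⟩, ⟨-3881049665, -6006587695⟩⟩]⟩),
    ((3, 3, 0), ⟨⟨⟨-34, 39, 99, -10⟩, ⟨-6, 31, -21, -2⟩, ⟨66, 51, -5, 28⟩, ⟨-12, 62, -13, -40⟩⟩,
      [⟨-236669151, -8063518509, 8248883267, 4034724834⟩,
       ⟨1854143150, -103721572, 1007929573, 1423082471⟩,
       ⟨-200731458, -1123389119, 538596592, -1034918766⟩,
       ⟨-805803520, 1107744055, -4014791330, 894474621⟩,
       ⟨-670988117, -967653219, 1479178684, -1551675530⟩,
       ⟨-2557097076, 306762499, 1695570845, 7628120556⟩],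
      [⟨⟨-1552024038, 42846227⟩, ⟨-52244250, -909368640⟩,
         ⟨2126861447, 3398809713⟩, ⟨-944340447, -2363001653⟩⟩,
       ⟨⟨878901041, -50406333⟩, ⟨-207726992, 453479482⟩,
         ⟨-507773042, 690982938⟩, ⟨-523355969, -994795947⟩⟩]⟩),
    ((4, 0, 2), ⟨⟨⟨30, 16, 73, 12⟩, ⟨18, 28, -8, -18⟩, ⟨41, -3, -26, 2⟩, ⟨20, -99, 24, -20⟩⟩,
      [⟨2294736301, -663994485, 2010792730, -1353544174⟩,
       ⟨-447149245, 825754555, -445070989, 2546902127⟩,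
       ⟨-1992667459, -1620438740, -2643012142, -1462033332⟩,
       ⟨-352560225, -1539316942, -6010291676, -288152957⟩,
       ⟨1027365663, 2012257995, 192027137, 601915120⟩,
       ⟨1168791771, -906369094, 7065820689, -2318094929⟩],
      [⟨⟨110380685, 349683515⟩, ⟨759524582, -435254266⟩,
         ⟨63952620, 837561764⟩, ⟨1791526838, 422159342⟩⟩,
       ⟨⟨-1354467657, -5343162819⟩, ⟨-889629800, 21521287⟩,
         ⟨-75260323, 894810169⟩, ⟨-1581957032, 273795290⟩⟩]⟩),
    ((4, 1, 1), ⟨⟨⟨27, 62, 99, 15⟩, ⟨5, 12, -14, -16⟩, ⟨63, 14, -18, -3⟩, ⟨18, -41, 17, -41⟩⟩,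
      [⟨2870194336, -1282559421, 4299930200, -4755696414⟩,
       ⟨3407174125, -1111100840, 2155006545, -3069908094⟩,
       ⟨989515521, -2996145314, -9194821434, 4138252802⟩,
       ⟨381111656, -3250941115, -6933371959, 1491727462⟩,
       ⟨-430096646, 1317663453, -932119003, 1036132122⟩,
       ⟨1149184686, 7961926, 1586581634, 2447682870⟩],
      [⟨⟨-1784734436, -1567984517⟩, ⟨54708263, 323559315⟩,
         ⟨402736756, 1129424400⟩, ⟨-1399948258, 1081980812⟩⟩,
       ⟨⟨-130545502, 357172601⟩, ⟨1313157932, 648559065⟩,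
         ⟨-724696081, 157553223⟩, ⟨808830482, -340297830⟩⟩]⟩),
    ((4, 2, 0), ⟨⟨⟨-36, 51, 43, 0⟩, ⟨24, 7, -34, -16⟩, ⟨-52, 99, 3, -11⟩, ⟨-66, 72, -52, -54⟩⟩,
      [⟨1903898523, -2525285973, 2705558912, -574762810⟩,
       ⟨1200950548, -1305528505, 52019058, 2847585203⟩,
       ⟨-2559698178, -73279875, -1578519856, -2335459545⟩,
       ⟨-4175514472, -1688323466, -2007807440, -1969445731⟩,
       ⟨-559402805, 2937101453, -1628783544, -1010782061⟩,
       ⟨1422637945, -2349425246, 4277548785, -2377555402⟩],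
      [⟨⟨1278251776, -402074450⟩, ⟨-1876890251, -114780591⟩,
         ⟨1181992726, 2367504908⟩, ⟨862082480, -2178497861⟩⟩,
       ⟨⟨-901089197, 5190654062⟩, ⟨1205818985, 4030427289⟩,
         ⟨-2046197099, 747682359⟩, ⟨-1703695593, 309081743⟩⟩]⟩),
    ((5, 0, 1), ⟨⟨⟨76, 55, 68, 7⟩, ⟨19, 5, -10, -6⟩, ⟨71, -43, -54, 25⟩, ⟨32, -41, 99, -18⟩⟩,
      [⟨215069742, -880290655, 6281479854, 786658⟩,
       ⟨-495593783, 2521218356, -15066582, 2431235656⟩,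
       ⟨-4246852549, 440149332, 146901633, -2798541701⟩,
       ⟨-5797213311, 85568562, -249376326, -1806707295⟩,
       ⟨6402741865, 377388508, -163607872, -882983355⟩,
       ⟨1675345484, -644525851, 2784120434, -2482539213⟩],
      [⟨⟨-253148761, -274721155⟩, ⟨-388304037, -871718592⟩,
         ⟨3556903003, 3550630950⟩, ⟨3079451126, -659693071⟩⟩,
       ⟨⟨-664626539, -206450185⟩, ⟨1253494666, -1449442674⟩,
         ⟨-134521061, 1721460199⟩, ⟨3144732504, 1098507999⟩⟩]⟩),
    ((5, 1, 0), ⟨⟨⟨16, 28, 99, 12⟩, ⟨27, 8, -7, -3⟩, ⟨45, -4, -22, 2⟩, ⟨12, 8, 83, -12⟩⟩,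
      [⟨1455766360, -190993058, 7428788216, -5958550225⟩,
       ⟨7549606385, 873965120, -33360498, -1246634189⟩,
       ⟨-2738632801, -4793081994, -7654645011, -1518120167⟩,
       ⟨-2435150115, -5433847198, -8299297789, 2903360005⟩,
       ⟨-3398238642, 625344799, -2588353700, 8194682558⟩,
       ⟨1004330036, -116762689, 8368872274, 4330906889⟩],
      [⟨⟨531455967, -1453811717⟩, ⟨649835164, -1110495122⟩,
         ⟨-194538958, 41089986⟩, ⟨-43087154, 369756676⟩⟩,
       ⟨⟨-4570648552, -1068186986⟩, ⟨343454658, -45990185⟩,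
         ⟨156486414, 857205756⟩, ⟨-5318458026, 4098437679⟩⟩]⟩),
    ((6, 0, 0), ⟨⟨⟨14, 53, 55, -2⟩, ⟨34, -7, -10, 7⟩, ⟨49, -12, -30, 16⟩, ⟨11, 21, 99, -14⟩⟩,
      [⟨-439794284, -1508922838, 6304721654, 1953569709⟩,
       ⟨-2951144460, -5925215396, 7782304266, -8413036950⟩,
       ⟨1189468317, -53831961, -170361391, -348540842⟩,
       ⟨-4697179873, -7225523880, -790982800, -205058185⟩,
       ⟨1140763721, -239337705, 3462500824, -2923321338⟩,
       ⟨67641278, -952129227, 5661559022, 1963583572⟩],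
      [⟨⟨-1014326362, -1964646243⟩, ⟨927517691, -624784902⟩,
         ⟨2220552096, 1812684080⟩, ⟨3159855587, 57065741⟩⟩,
       ⟨⟨-5307654784, 397894891⟩, ⟨503096556, 257258908⟩,
         ⟨-301080026, 1115310505⟩, ⟨-1588931998, -1673962037⟩⟩]⟩)]

def realizationsEight : List ((ℕ × ℕ × ℕ) × Witness) :=
  [((0, 0, 8), ⟨⟨⟨-1, 49, 68, 12⟩, ⟨80, 4, -19, -99⟩, ⟨86, 43, -7, 93⟩, ⟨5, -44, 49, 7⟩⟩,
      [⟨157162648, 345278159, 539562506, 910391719⟩,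
       ⟨-956184425, 1057429649, -1343123644, 5056415778⟩,
       ⟨735617164, 1064201660, -136294937, 474293142⟩,
       ⟨540599727, 2717754858, -750649818, 746726882⟩,
       ⟨-1050498298, 1667565282, -1479532252, 2303244109⟩,
       ⟨797885703, 1804720836, -491941564, 571750522⟩,
       ⟨505301511, 619632795, 214413581, 583873734⟩,
       ⟨-513415172, 510510838, 761071633, 2312994876⟩],
      [⟨⟨91537371, 644129240⟩, ⟨-1003660067, 129319831⟩,
         ⟨79065324, 588981870⟩, ⟨-720709878, -51800382⟩⟩]⟩),
    ((0, 1, 7), ⟨⟨⟨0, 45, 72, 1⟩, ⟨71, -4, -33, -99⟩, ⟨84, 32, -49, 79⟩, ⟨21, -46, 56, 25⟩⟩,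
      [⟨-271049807, 431062409, 1401912785, 2204739989⟩,
       ⟨574192273, 667422359, 357931810, 646562619⟩,
       ⟨837006408, 1810485072, -419886404, 610473757⟩,
       ⟨-563753264, 2616312642, -1260187250, 1405369784⟩,
       ⟨-870449177, 918469822, 443563070, -10146321906⟩,
       ⟨270833730, 2850347925, -871928241, 919826566⟩,
       ⟨789981753, 1093180761, -17741387, 526927209⟩,
       ⟨273618439, 410257128, 734809633, 952067997⟩],
      [⟨⟨209570710, 557142486⟩, ⟨-1040446110, 234905393⟩,
         ⟨74855943, 370572088⟩, ⟨-528394714, -4712376⟩⟩]⟩),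
    ((0, 2, 6), ⟨⟨⟨4, 37, 48, 18⟩, ⟨57, 18, -27, -99⟩, ⟨68, 15, -19, 83⟩, ⟨31, -25, 27, -16⟩⟩,
      [⟨171263876, -119128957, 953274212, 789668438⟩,
       ⟨955157399, 573035260, 237397783, 200873919⟩,
       ⟨1475778969, 2380598556, -571667667, 324146785⟩,
       ⟨-1626582822, 3668171031, -1495425707, 1337751491⟩,
       ⟨-1015348720, 696973630, -634739900, -13125524322⟩,
       ⟨-1020196337, 7692702920, -1182222926, 870420551⟩,
       ⟨1093076643, 793736439, 69013213, 141247088⟩,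
       ⟨-762012919, 413493920, 2552147212, 6091571410⟩],
      [⟨⟨177657183, 404721920⟩, ⟨-1181783613, 66898962⟩,
         ⟨38940446, 323526449⟩, ⟨-633126831, -42048935⟩⟩]⟩),
    ((0, 3, 5), ⟨⟨⟨-9, 60, 64, 2⟩, ⟨84, 49, -30, -93⟩, ⟨99, -1, 3, 96⟩, ⟨50, -10, 31, -33⟩⟩,
      [⟨-885816682, 491940140, 1145641942, 6858168835⟩,
       ⟨410715922, -192334353, 879298874, 548846991⟩,
       ⟨1170893265, 740838270, -138310938, -105665648⟩,
       ⟨150793419, 3176951913, -1226835662, 848225809⟩,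
       ⟨-892392208, 2417286368, -1567367051, 1478160507⟩,
       ⟨688602422, 2814745460, -1083366760, 650661140⟩,
       ⟨621336587, -12027787, 694562555, 367488752⟩,
       ⟨-988970575, 657153834, -654775227, 14812999361⟩],
      [⟨⟨128500450, 372387748⟩, ⟨-1370455012, 6700277⟩,
         ⟨-26018713, 314662267⟩, ⟨-1002344032, -132986651⟩⟩]⟩),
    ((0, 4, 4), ⟨⟨⟨17, 31, 99, 17⟩, ⟨-19, 6, 25, -22⟩, ⟨6, 38, -3, 59⟩, ⟨70, 10, 1, -64⟩⟩,
      [⟨-2060700514, -749719824, 1026563660, 1853664634⟩,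
       ⟨241404087, 1724196041, -500562736, 347554210⟩,
       ⟨-545165509, 625030806, -1139544016, 917205962⟩,
       ⟨-2213758171, 2669578467, -5599377630, 1918774025⟩,
       ⟨-2519918807, 3409846192, -6222511992, 1093983623⟩,
       ⟨-817176608, 568378017, -1451814942, 1190834234⟩,
       ⟨-69893556, 2286331050, -479964469, 243429817⟩,
       ⟨-7403906159, -2898397075, 643978085, 904029611⟩],
      [⟨⟨-364185464, -1694025609⟩, ⟨-443449268, -228338645⟩,
         ⟨196513277, 1017039902⟩, ⟨-647076245, 5541915⟩⟩]⟩),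
    ((0, 5, 3), ⟨⟨⟨-9, 35, 99, 9⟩, ⟨-18, 11, 29, -13⟩, ⟨8, 27, 6, 48⟩, ⟨55, 7, -8, -54⟩⟩,
      [⟨-3495324049, -1351510061, 863084507, 1231232414⟩,
       ⟨640321434, 787821132, -638244351, 498393071⟩,
       ⟨6118236, 482129668, -925285441, 746555795⟩,
       ⟨-1969255378, 2386283598, -7060313451, 4690855749⟩,
       ⟨-3658586660, 7910228443, -11855727392, -2806533552⟩,
       ⟨-469591830, 335989687, -1249690922, 1068398770⟩,
       ⟨-895744360, 4414668376, -460258398, -110263665⟩,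
       ⟨-6805384495, -2607826459, 696320784, 916296588⟩],
      [⟨⟨-551561765, -1874916604⟩, ⟨-462189433, -413641826⟩,
         ⟨59878464, 943845428⟩, ⟨-635396412, -116047352⟩⟩]⟩),
    ((0, 6, 2), ⟨⟨⟨-11, 32, 99, 7⟩, ⟨-17, 13, 33, -7⟩, ⟨8, 24, 11, 38⟩, ⟨47, 12, 9, -50⟩⟩,
      [⟨-4313845819, -1869574346, 752723535, 1253772015⟩,
       ⟨654317053, 654141475, -577146758, 442595201⟩,
       ⟨175710598, 380535718, -755869011, 606792772⟩,
       ⟨-2241763127, 2982784570, -9059074053, 5740022159⟩,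
       ⟨-3582900062, 8786066962, -12802520436, -3232595597⟩,
       ⟨-795374395, -62696, -1286019156, 1235894051⟩,
       ⟨-556197090, 4220620355, -412228263, -113745947⟩,
       ⟨-7073415609, -3021926466, 684000701, 1024831829⟩],
      [⟨⟨-468691450, -1942757454⟩, ⟨-494416884, -583461746⟩,
         ⟨92563600, 1041356364⟩, ⟨-718000558, -124231891⟩⟩]⟩),
    ((0, 7, 1), ⟨⟨⟨5, 10, 99, 5⟩, ⟨-12, 3, 6, -3⟩, ⟨5, 15, 6, 23⟩, ⟨55, 8, 0, -51⟩⟩,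
      [⟨-5423895415, -834065828, 445294170, 1498180018⟩,
       ⟨5407121857, 2659630283, -28942570, 353460506⟩,
       ⟨-1186886029, 93180806, -1432465591, 1423092328⟩,
       ⟨-2985099307, 4815405803, -13197056851, 2742775861⟩,
       ⟨-3162577826, 6063542114, -14101980494, -366915174⟩,
       ⟨-1615600452, 82825418, -1700865361, 1817706643⟩,
       ⟨2159653811, 3440844562, -109850881, 146458591⟩,
       ⟨-11212444025, -2042214307, 363178837, 1024063883⟩],
      [⟨⟨-522144532, -2012212814⟩, ⟨-235912068, -80787887⟩,
         ⟨231980496, 1180575365⟩, ⟨-915194711, 158638762⟩⟩]⟩),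
    ((0, 8, 0), ⟨⟨⟨3, -3, 94, -48⟩, ⟨61, 34, 10, 6⟩, ⟨-39, 97, 1, 62⟩, ⟨-61, 15, -99, -36⟩⟩,
      [⟨-468759364, 2528417452, 4278013637, -1971188940⟩,
       ⟨-1783345673, -210420325, 413417206, 2077597639⟩,
       ⟨1629145, -732104908, 232401856, 912396895⟩,
       ⟨479385598, 1122716768, -829765764, -666067308⟩,
       ⟨68684020, 922210904, -2647919681, -982709571⟩,
       ⟨-804562338, -639912815, 586754718, 1331413731⟩,
       ⟨789273190, -881358646, -134538006, 870592686⟩,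
       ⟨1889501044, -808625040, -486352017, 1140168283⟩],
      [⟨⟨-414338559, 286809848⟩, ⟨1014003380, -307146475⟩,
         ⟨-1800961376, 4900928278⟩, ⟨-882569267, 156099170⟩⟩]⟩),
    ((2, 0, 6), ⟨⟨⟨15, 67, 99, 5⟩, ⟨60, 3, -26, -82⟩, ⟨62, 30, -20, 71⟩, ⟨17, -48, 59, 9⟩⟩,
      [⟨-268061870, 471355322, 564301444, 1749047494⟩,
       ⟨-681159470, 888136973, -765093402, 3298031862⟩,
       ⟨311835867, -814822515, 321017554, -494180557⟩,
       ⟨-274688258, -1053533105, -145934129, -455024193⟩,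
       ⟨-613055638, 1284943505, -1067008010, 1895097591⟩,
       ⟨448216786, 1371443634, -464932548, 750991588⟩,
       ⟨406427223, 673246625, 74550973, 731266540⟩,
       ⟨141058585, 444617135, 394587926, 984692206⟩],
      [⟨⟨830466792, -132356594⟩, ⟨815871262, -749803424⟩,
         ⟨-275456345, 552128772⟩, ⟨466644645, -114283525⟩⟩]⟩),
    ((2, 1, 5), ⟨⟨⟨9, 56, 99, -4⟩, ⟨70, 5, -35, -88⟩, ⟨83, 40, -65, 76⟩, ⟨35, -63, 64, 19⟩⟩,
      [⟨-109729908, 373202148, 1253817216, 1902959542⟩,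
       ⟨453320828, 561664370, 500978463, 888297967⟩,
       ⟨-213226145, -1307081776, -27982085, -423168272⟩,
       ⟨-373724098, 2062377424, -1254124670, 1550537829⟩,
       ⟨-904858202, 934680771, 1646229877, -9515498598⟩,
       ⟨355073420, 2084698438, -747745695, 963085734⟩,
       ⟨420172215, -945162333, 357873220, -441623473⟩,
       ⟨191052003, 384070361, 872710739, 1231025125⟩],
      [⟨⟨1010159906, -77721183⟩, ⟨1076239600, -882222855⟩,
         ⟨-235732416, 601629238⟩, ⟨508339250, -151765380⟩⟩]⟩),
    ((2, 2, 4), ⟨⟨⟨1, 41, 59, 18⟩, ⟨55, 16, -33, -99⟩, ⟨65, 23, -25, 85⟩, ⟨45, -37, 39, -14⟩⟩,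
      [⟨194594882, -133634013, 940330130, 781370653⟩,
       ⟨451623451, -1404497532, 202350554, -539551980⟩,
       ⟨888737526, 4121746372, -865190458, 601401843⟩,
       ⟨-1161671891, 4058196819, -1352391584, 1127759280⟩,
       ⟨-1065750406, 780091696, -595484978, -12085564351⟩,
       ⟨-257908780, 5172662117, -1108670251, 822834694⟩,
       ⟨56664127, -1520717560, -65172867, -516036784⟩,
       ⟨-785625370, 471852398, 2565365036, 6306929310⟩],
      [⟨⟨1098686797, -401042533⟩, ⟨588972647, -640919233⟩,
         ⟨158172137, 448098512⟩, ⟨107608875, 176984458⟩⟩]⟩),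
    ((2, 3, 3), ⟨⟨⟨-39, 66, 99, -33⟩, ⟨-4, 44, 8, 5⟩, ⟨43, -14, -16, 8⟩, ⟨-10, -84, -71, -61⟩⟩,
      [⟨4409974182, 1524114339, 1536727163, 1652511542⟩,
       ⟨-8470312928, 3628087098, 5727644081, -9743575198⟩,
       ⟨802617116, 546413216, 61680000, 808251142⟩,
       ⟨-509384270, 1727092445, -617232702, -140599356⟩,
       ⟨-480128255, 312729229, -1479562991, 1546036022⟩,
       ⟨446678539, 519279475, -249833319, 707549679⟩,
       ⟨-7319229087, 5301702862, 4108060103, -6052368836⟩,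
       ⟨1804407830, 8446859954, 3673995773, 1257339179⟩],
      [⟨⟨-383810979, -1897098461⟩, ⟨-306236881, 107491237⟩,
         ⟨-763114801, 1040824101⟩, ⟨-662898796, -249530308⟩⟩]⟩),
    ((2, 4, 2), ⟨⟨⟨-14, 49, 99, -14⟩, ⟨-3, 16, 8, -24⟩, ⟨40, 13, -9, 35⟩, ⟨41, -11, 14, -45⟩⟩,
      [⟨-1324206565, -91421484, 2580454380, 8984849336⟩,
       ⟨6316029835, -12238146769, 3313842117, -2708613073⟩,
       ⟨1913729668, 315591704, 767054330, 629711052⟩,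
       ⟨857444261, 12649565697, -468888214, -104004203⟩,
       ⟨-654981938, 413240744, -1083528149, 1431511853⟩,
       ⟨-237077443, 604580011, -791485157, 850318114⟩,
       ⟨-1309454018, 90165554, -3312104984, 12665041809⟩,
       ⟨655742895, -3067142054, 4094517269, 1292889681⟩],
      [⟨⟨5859177246, -4458303410⟩, ⟨-290808581, -1706430297⟩,
         ⟨-269785865, 935288445⟩, ⟨-443636016, -647849879⟩⟩]⟩),
    ((2, 5, 1), ⟨⟨⟨-18, 48, 99, -16⟩, ⟨-7, 16, 11, -25⟩, ⟨41, 11, -1, 34⟩, ⟨45, -7, 11, -46⟩⟩,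
      [⟨-1315091644, -144212081, 1366945024, 8868537274⟩,
       ⟨5686688303, -11552229144, 3044484864, -2669714900⟩,
       ⟨2258900726, 426642875, 736054738, 630246668⟩,
       ⟨316308797, 885634109, -549072945, 401256116⟩,
       ⟨92312785, 11639795907, -449656376, -137853746⟩,
       ⟨-1160682587, 33876853, -1645648592, 4129634306⟩,
       ⟨-1264659492, -35201767, -1711788667, 7480694614⟩,
       ⟨949018377, -3658191327, 3944328709, 1335909492⟩],
      [⟨⟨5717260299, -3795325903⟩, ⟨120688484, -1490130176⟩,
         ⟨-373486943, 909889813⟩, ⟨-450511227, -689130032⟩⟩]⟩),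
    ((2, 6, 0), ⟨⟨⟨-29, 58, 93, -22⟩, ⟨23, 7, -10, -24⟩, ⟨4, 45, -6, 12⟩, ⟨-12, 35, -99, -40⟩⟩,
      [⟨-8923624083, 4778505278, 1613257635, -482103973⟩,
       ⟨1230629991, -417400181, -108126492, 321084507⟩,
       ⟨2444615450, -209324781, -758256190, 794425995⟩,
       ⟨435226565, 729486831, -1552562194, -482825675⟩,
       ⟨-111431463, 395681981, -2443887975, -174381224⟩,
       ⟨767676522, 1152638459, -1050535119, -454689587⟩,
       ⟨1843763930, -424059633, -428210787, 474001072⟩,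
       ⟨8149806962, -8777840589, 1730893639, -1504743880⟩],
      [⟨⟨-1588229053, -12292885⟩, ⟨-894659049, 487475300⟩,
         ⟨-293435256, 8885513853⟩, ⟨-2210183450, 6275052272⟩⟩]⟩),
    ((3, 0, 5), ⟨⟨⟨17, 57, 54, -7⟩, ⟨99, 42, -13, -74⟩, ⟨55, 15, 4, 89⟩, ⟨93, 22, 40, -26⟩⟩,
      [⟨-1010107617, 825121548, -1716293109, 8096148937⟩,
       ⟨390021732, -977553845, 354620339, -456457965⟩,
       ⟨6552433, -1201974331, -60230726, -508375176⟩,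
       ⟨48159494, 3323361035, -1324891815, 1156679321⟩,
       ⟨-905912244, 2166608588, -1675687003, 1855408444⟩,
       ⟨982797360, 2742561836, -1122024928, 873439686⟩,
       ⟨513551628, -734060299, 524363498, -206329376⟩,
       ⟨-954334872, 676575284, -230211979, 6442359080⟩],
      [⟨⟨1027745127, -496950983⟩, ⟨-126608760, -554409216⟩,
         ⟨467162658, 642483917⟩, ⟨-211493745, 470545720⟩⟩]⟩),
    ((3, 1, 4), ⟨⟨⟨-10, 41, 99, -17⟩, ⟨4, 38, 5, -2⟩, ⟨46, -3, -26, 12⟩, ⟨-2, -61, -23, -29⟩⟩,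
      [⟨-4948245012, -3063170571, 6078976636, 3883309088⟩,
       ⟨-4670601007, 12613338946, 5806119371, -3719009382⟩,
       ⟨817828976, 540004862, 689310520, 1411684912⟩,
       ⟨70138650, 1372142201, -468170064, 278902375⟩,
       ⟨-697813011, 439233924, -2272931463, 3207519216⟩,
       ⟨57792034, 613727767, -535634176, 1180598432⟩,
       ⟨-3625183301, 989888089, 7818994953, -11722583534⟩,
       ⟨-4353260577, -10411670545, 6260457997, 1787543616⟩],
      [⟨⟨148820327, -1642697320⟩, ⟨-221305122, -92517478⟩,
         ⟨-416754367, 1054496215⟩, ⟨-770694497, -380439682⟩⟩]⟩),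
    ((3, 2, 3), ⟨⟨⟨3, 20, 99, -13⟩, ⟨-5, 7, 6, -22⟩, ⟨12, 24, 0, 30⟩, ⟨35, 14, -9, -41⟩⟩,
      [⟨-1368592125, -152218797, 3816554008, 16898626853⟩,
       ⟨-12624017606, 17715795704, 3831782216, -959318169⟩,
       ⟨3067153114, 959598392, 99589234, 355203552⟩,
       ⟨1532659113, 2282710646, -262606548, 127549287⟩,
       ⟨-299083641, 364899296, -1279565088, 827233367⟩,
       ⟨1760667583, 1473669016, -252117445, 205359801⟩,
       ⟨-1521425069, 230523369, 5087460722, -5317777177⟩,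
       ⟨9364008553, -16815657365, 4012823359, 81022564⟩],
      [⟨⟨234338503, -3209974042⟩, ⟨-675418462, -189064054⟩,
         ⟨-3518577, 972253563⟩, ⟨-393744459, -236699989⟩⟩]⟩),
    ((3, 3, 2), ⟨⟨⟨-6, 60, 99, -7⟩, ⟨-13, 12, 8, -38⟩, ⟨26, 17, 1, 46⟩, ⟨64, 6, -15, -57⟩⟩,
      [⟨5446892071, -9196311965, 3699837895, 687240871⟩,
       ⟨-10805347799, 13135556864, 2872443366, -2528463278⟩,
       ⟨5192871089, 1079157125, 499745652, 472690923⟩,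
       ⟨93746509, 766462182, -954856857, 666706907⟩,
       ⟨-507594333, 421490701, -1393810108, 1234256099⟩,
       ⟨-3320561623, 13284190723, -583405320, -67098817⟩,
       ⟨-1266863617, 4420408, 5663973213, -13050577884⟩,
       ⟨-1192412967, -190663799, 4599577734, 12023505062⟩],
      [⟨⟨-5709628877, -4563548854⟩, ⟨-1678708846, 473426350⟩,
         ⟨-350800061, 910149373⟩, ⟨-395621424, -637768153⟩⟩]⟩),
    ((3, 4, 1), ⟨⟨⟨-15, 57, 99, -11⟩, ⟨-12, 8, 17, -37⟩, ⟨43, 18, -8, 45⟩, ⟨59, 13, 23, -54⟩⟩,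
      [⟨2047749289, -4382199433, 3543489576, 1091802105⟩,
       ⟨4661331299, -8130525642, 2602637165, -2364974739⟩,
       ⟨-1168987475, -27833040, -2595352056, 7759782878⟩,
       ⟨3353606716, -10567460437, -448312159, -195104715⟩,
       ⟨-577381176, 451371141, -1039081008, 1081224640⟩,
       ⟨-1131452974, 16027061, -2263282228, 4766617129⟩,
       ⟨3212452120, 403337847, 838698855, 680005940⟩,
       ⟨-1187723806, -80437937, -743474723, 10750321917⟩],
      [⟨⟨5827810480, 254782600⟩, ⟨874788962, -576003575⟩,
         ⟨-238468582, 795576451⟩, ⟨-287811981, -543050776⟩⟩]⟩),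
    ((3, 5, 0), ⟨⟨⟨-16, 46, 99, -13⟩, ⟨4, 17, 13, -11⟩, ⟨9, 43, 5, 22⟩, ⟨-3, 36, -44, -42⟩⟩,
      [⟨-2167395845, 389239709, 11492169293, -1505099004⟩,
       ⟨-2124694247, -523476742, 3940167368, 11729278988⟩,
       ⟨1973368572, 203674758, -99705468, 469535862⟩,
       ⟨420923345, 979415404, -995779513, -101079694⟩,
       ⟨-471034885, 472444923, -1919444137, 88899740⟩,
       ⟨737348471, 1510727950, -738398642, -132034742⟩,
       ⟨2170179027, -11714768663, 5734868057, -4035129481⟩,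
       ⟨-1090522668, -2710612882, 6090155379, 2152338675⟩],
      [⟨⟨1873435055, -1278259407⟩, ⟨-72299908, -270223537⟩,
         ⟨-199333699, 633461034⟩, ⟨90855134, -268669325⟩⟩]⟩),
    ((4, 0, 4), ⟨⟨⟨30, 16, 72, 12⟩, ⟨20, 24, -11, -19⟩, ⟨43, 4, -31, 3⟩, ⟨16, -99, 38, -22⟩⟩,
      [⟨1103037849, -799067678, 5432605174, -1825724290⟩,
       ⟨155241878, 628724476, 759167027, 2240898293⟩,
       ⟨955089846, 2372150161, 75221471, 617159162⟩,
       ⟨-1700491016, -1578200016, -2994926669, -1574730838⟩,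
       ⟨-283936551, -1633862482, -6827943153, 219089547⟩,
       ⟨-640427162, 1180265235, -636288239, 2084658111⟩,
       ⟨-69125489, 1011749316, 65746802, 1779629445⟩,
       ⟨1579549449, -601795953, 2435265439, -1135688720⟩],
      [⟨⟨-3141892048, -2941007309⟩, ⟨-498332696, 306589078⟩,
         ⟨-249786172, 897468234⟩, ⟨-1639705630, 505579744⟩⟩]⟩),
    ((4, 1, 3), ⟨⟨⟨24, 57, 99, 14⟩, ⟨8, 9, -19, -13⟩, ⟨64, 11, -16, -2⟩, ⟨22, -40, 13, -32⟩⟩,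
      [⟨1081596403, -37711545, 1646072902, 2749505796⟩,
       ⟨3474055529, -1054828860, 1791045954, -3055986841⟩,
       ⟨437057307, 1991354669, -588574044, 633783235⟩,
       ⟨696215209, -3296343755, -8261918784, 3398666562⟩,
       ⟨110915644, -3495777005, -6866001489, 1033382947⟩,
       ⟨-723751503, 803723072, -1271679418, 1780999239⟩,
       ⟨126494544, 1181881966, -660939293, 985380214⟩,
       ⟨2788735035, -1184918278, 4404101528, -5250816083⟩],
      [⟨⟨-1986615500, -1818130594⟩, ⟨159540104, 399691672⟩,
         ⟨329084537, 1202094872⟩, ⟨-1755564521, 1274816909⟩⟩]⟩),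
    ((4, 2, 2), ⟨⟨⟨-24, 47, 99, -23⟩, ⟨-7, 10, -1, -17⟩, ⟨46, -2, -31, 20⟩, ⟨30, -44, -30, -72⟩⟩,
      [⟨7582394996, -10361204619, 2327194496, -2348560925⟩,
       ⟨641341569, -5380798717, 4382998304, 1564409651⟩,
       ⟨-363513936, 591227615, -1083711047, 1086845867⟩,
       ⟨-2624823063, -41654387, -828204453, -1577184734⟩,
       ⟨-2314905237, -126248627, -1989378956, -2507900104⟩,
       ⟨-36470106, 712100149, -796111967, 772941782⟩,
       ⟨2280976320, 355877246, 988706213, 945039141⟩,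
       ⟨-772329061, 10193454714, -412131486, -190491520⟩],
      [⟨⟨6488271482, -6529352589⟩, ⟨-1558094269, -414647536⟩,
         ⟨91950756, 875234180⟩, ⟨-953358315, -650985538⟩⟩]⟩),
    ((4, 3, 1), ⟨⟨⟨-16, 51, 99, -24⟩, ⟨-3, 12, 5, -18⟩, ⟨32, -4, -10, 29⟩, ⟨32, -31, -11, -54⟩⟩,
      [⟨-1815604968, -264125339, 11133532412, 12195250322⟩,
       ⟨609563912, -4777721086, 3839346242, 1024220593⟩,
       ⟨570962574, 789246768, -381522788, 366553096⟩,
       ⟨-1417936592, 106032341, -2683827343, 5123271751⟩,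
       ⟨-2151248473, -129261193, -313860862, -2771756269⟩,
       ⟨568326396, 12188656490, -443663781, -123496968⟩,
       ⟨2178876202, 408218802, 684604653, 537760227⟩,
       ⟨4967406881, -12218439401, 2773582423, -2360221715⟩],
      [⟨⟨5753576937, -3859366722⟩, ⟨-45867121, -946514838⟩,
         ⟨-301264630, 785655250⟩, ⟨-520691502, -572865990⟩⟩]⟩),
    ((4, 4, 0), ⟨⟨⟨-24, 77, 99, -7⟩, ⟨28, 27, -6, -21⟩, ⟨-34, 93, 24, -2⟩, ⟨-53, 36, -39, -89⟩⟩,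
      [⟨5964875967, -6910603738, 4373552040, -278398324⟩,
       ⟨472016793, -716697443, 387280901, 767396878⟩,
       ⟨1538095995, -494076291, -836025002, 1485125795⟩,
       ⟨-2373088511, -471415743, -417834830, -2631559271⟩,
       ⟨-6962468683, -4618775146, -3123540257, -2403682038⟩,
       ⟨-636321362, 1719361472, -1071260275, -261423418⟩,
       ⟨1064544048, -709756539, -316019698, 976852166⟩,
       ⟨1405238319, -4573477943, 6954988384, -5733374394⟩],
      [⟨⟨-163425882, 2097631825⟩, ⟨265316930, 1347203576⟩,
         ⟨-941917047, 836007281⟩, ⟨-877255850, 111157112⟩⟩]⟩),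
    ((5, 0, 3), ⟨⟨⟨71, 73, 63, 6⟩, ⟨21, 5, -13, -6⟩, ⟨77, -42, -57, 27⟩, ⟨35, -45, 99, -20⟩⟩,
      [⟨170945974, -985545189, 6157250258, 178195721⟩,
       ⟨2151971011, -724143272, 2324097764, -2445894115⟩,
       ⟨-201131315, 4832168768, -996462706, 2230621729⟩,
       ⟨-5169037120, 631899227, 347669083, -2727920469⟩,
       ⟨-6847436009, 224864094, -110889168, -1815126657⟩,
       ⟨5339258474, 220184463, -76338969, -899278245⟩,
       ⟨-548781644, 2407545424, -174453260, 3207751642⟩,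
       ⟨-687744952, 1395440951, 968985181, 3646353156⟩],
      [⟨⟨-148146503, -183245021⟩, ⟨-574400730, -889849005⟩,
         ⟨4238248666, 3239508993⟩, ⟨2532798683, -1291386857⟩⟩]⟩),
    ((5, 1, 2), ⟨⟨⟨20, 39, 99, 12⟩, ⟨29, 9, -4, -3⟩, ⟨52, -4, -27, 2⟩, ⟨7, 5, 91, -13⟩⟩,
      [⟨1506212098, -158268950, 7760217307, -6474157086⟩,
       ⟨-3203557688, 587631823, -2630401985, 7899161489⟩,
       ⟨464403884, 2189363799, -351748274, 454377915⟩,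
       ⟨2991532663, 478871238, -30177898, -789996820⟩,
       ⟨-2246697621, -5280359212, -8256852354, 3220348638⟩,
       ⟨-2560664141, -4629676222, -7599052866, -1113690413⟩,
       ⟨-271573106, 1527218448, -369128149, 780115219⟩,
       ⟨1007593312, -80504301, 8666701635, 5017824791⟩],
      [⟨⟨-4651611007, -823043775⟩, ⟨130281561, -83615414⟩,
         ⟨-314713263, 704795768⟩, ⟨-5270730267, 2653822906⟩⟩]⟩),
    ((5, 2, 1), ⟨⟨⟨-29, 25, 99, 11⟩, ⟨18, 5, -5, -2⟩, ⟨43, -3, -15, 1⟩, ⟨4, 7, 66, -9⟩⟩,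
      [⟨2260948502, -227773913, 8383006729, -9293998506⟩,
       ⟨-2777428121, 480361718, -1100952615, 4425360017⟩,
       ⟨1698150427, 2642782146, -256739260, -260440392⟩,
       ⟨-1705795501, -8653987605, -9507408336, 6806332172⟩,
       ⟨-2766228309, -6761677651, -8037379899, -4513743499⟩,
       ⟨5456943735, 297163802, -11714052, -1537412895⟩,
       ⟨-91797196, 795506258, -228569886, 353180756⟩,
       ⟨1388515102, -120679057, 9450238188, 6839855873⟩],
      [⟨⟨-4324322930, -1456412132⟩, ⟨329207490, 5258151⟩,
         ⟨1070487315, 1026075267⟩, ⟨-4313978131, 6304184088⟩⟩]⟩),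
    ((5, 3, 0), ⟨⟨⟨33, -99, 9, 20⟩, ⟨93, 5, -79, -3⟩, ⟨-3, -4, 71, 3⟩, ⟨98, 46, 29, -43⟩⟩,
      [⟨-72136407, -1277035597, 3981762094, 1044231109⟩,
       ⟨2253864491, 211388614, 98268859, -814930951⟩,
       ⟨1896355486, -1172937138, -405760137, -1008413422⟩,
       ⟨5751259934, 2359743408, -9205326104, 6191093906⟩,
       ⟨1386360785, 2331649726, -3549199152, -5193069997⟩,
       ⟨-563844449, 3021869054, -1478499389, -3962985897⟩,
       ⟨-409067306, -258396498, -671772266, 686256486⟩,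
       ⟨7724786038, -9199064920, 2973868578, -7935115839⟩],
      [⟨⟨-517863593, 288705906⟩, ⟨-739209306, -373904677⟩,
         ⟨3585192141, 681517646⟩, ⟨192693580, 1842160529⟩⟩]⟩),
    ((6, 0, 2), ⟨⟨⟨32, 12, 72, 12⟩, ⟨17, 30, -9, -16⟩, ⟨41, 2, -25, 2⟩, ⟨20, -99, 23, -17⟩⟩,
      [⟨2733394806, -681123845, 1849024158, -1362467083⟩,
       ⟨-425240683, 782205788, -430577704, 2870848296⟩,
       ⟨1089183671, 2142889833, 218557548, 611293848⟩,
       ⟨-696187310, -1558692061, -5022304648, -809267118⟩,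
       ⟨-2333218906, -1400110848, -2460316899, -1933877690⟩,
       ⟨-4251546122, -1008287408, -1248863092, -2115492629⟩,
       ⟨5189835355, -750828467, 1077307378, -1437906885⟩,
       ⟨1254080390, -825009892, 6279542513, -2050122712⟩],
      [⟨⟨10497524, 398264097⟩, ⟨746848772, -392465933⟩,
         ⟨-25875690, 916022203⟩, ⟨2154816028, 442040568⟩⟩]⟩),
    ((6, 1, 1), ⟨⟨⟨17, 54, 64, -1⟩, ⟨39, 2, -8, 6⟩, ⟨48, -5, -38, 15⟩, ⟨9, 47, 99, -17⟩⟩,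
      [⟨-1910862676, -2952597071, 9132657750, 2738784640⟩,
       ⟨-1961195605, -3042750970, 8028483030, -7998091374⟩,
       ⟨821878868, -200256145, 3926462981, -3199109966⟩,
       ⟨828998597, -186389829, -301253954, -269559802⟩,
       ⟨-2024713761, -3076364046, -590073215, -277650281⟩,
       ⟨-1112739023, 1494619957, -460888248, 2960680242⟩,
       ⟨-3070175508, 613927383, 2090399900, 3932327634⟩,
       ⟨804870175, -207347138, 5020159929, 1800232049⟩],
      [⟨⟨-3199989403, 15612785⟩, ⟨574476342, 15512284⟩,
         ⟨-296001441, 1647569788⟩, ⟨-1477009330, -2272264155⟩⟩]⟩),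
    ((6, 2, 0), ⟨⟨⟨16, -40, -9, 8⟩, ⟨29, 2, -20, -5⟩, ⟨31, 6, 45, -1⟩, ⟨99, 22, 5, -14⟩⟩,
      [⟨987015090, -2335560077, 5525334221, -8204645710⟩,
       ⟨2266309638, 238121100, 42761220, -348487357⟩,
       ⟨982618493, -2507237555, -958334066, -366266177⟩,
       ⟨2245818115, 100770927, -7452256831, -4801701758⟩,
       ⟨2199007857, 164094859, -8330950224, 4498419632⟩,
       ⟨775053116, 3462297640, -1569846443, -3426338664⟩,
       ⟨-1049246699, -106966540, -842259532, 1928867082⟩,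
       ⟨1069047520, -2399792360, 7155861038, 2097432605⟩],
      [⟨⟨-1025203028, -17052816⟩, ⟨-91895065, 27433237⟩,
         ⟨4064780535, 1308631501⟩, ⟨-1922410446, 5984755148⟩⟩]⟩),
    ((7, 0, 1), ⟨⟨⟨21, 43, 75, 11⟩, ⟨29, 19, -10, -6⟩, ⟨48, 4, -29, 4⟩, ⟨34, 4, 99, -16⟩⟩,
      [⟨1599230558, -533813462, 7153665356, -4343925057⟩,
       ⟨6359470528, 1089088033, 167142679, -906075475⟩,
       ⟨-7356695519, 644572125, 698131320, -3556146634⟩,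
       ⟨-1807063002, -3969951983, -6307896799, -650384257⟩,
       ⟨-1320089851, -4813400351, -6979846946, 2357853684⟩,
       ⟨-4353938383, 703721096, 392786440, -7439791644⟩,
       ⟨-736748565, 1655595478, -880338827, 1443487543⟩,
       ⟨895046963, -281895284, 7482595263, 2818873420⟩],
      [⟨⟨168706220, -1273888128⟩, ⟨1710424002, -501036029⟩,
         ⟨-485482733, -220067670⟩, ⟨559220516, 623306064⟩⟩]⟩),
    ((7, 1, 0), ⟨⟨⟨38, -46, 88, 1⟩, ⟨60, 1, -99, -17⟩, ⟨-30, -3, 99, 8⟩, ⟨-6, 99, -16, -25⟩⟩,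
      [⟨-600082160, -302799529, 6237434482, 2057192640⟩,
       ⟨8277549730, 2699916805, 68948674, -363525453⟩,
       ⟨-615099723, -330714693, -978864024, -482593586⟩,
       ⟨6798887125, 2309089484, -8380862139, 4389503222⟩,
       ⟨5015551382, 1246394663, -6848479484, -4891900769⟩,
       ⟨1757758286, -792318725, -4367647102, -4009059780⟩,
       ⟨5717470977, -6313349027, -2250252806, 5421587241⟩,
       ⟨-577929266, -344478687, 4826850917, -8413547525⟩],
      [⟨⟨6495025580, -1075482995⟩, ⟨-6983104291, 1172582840⟩,
         ⟨30322284, 1947558775⟩, ⟨-1232023152, 2264198173⟩⟩]⟩),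
    ((8, 0, 0), ⟨⟨⟨40, -34, 45, 24⟩, ⟨44, -10, -99, -14⟩, ⟨-11, 3, 75, 10⟩, ⟨12, 63, -21, -34⟩⟩,
      [⟨2919846244, -3426088102, 5805381001, -9910220639⟩,
       ⟨-510774615, -310732627, 2980818682, 290646505⟩,
       ⟨8282859107, 2969651878, -33651801, -251134715⟩,
       ⟨4773525589, 1789609370, -5718425577, 2629255834⟩,
       ⟨5723105662, 1767469037, -4896501252, -2663572689⟩,
       ⟨-544820585, -357531730, -862542646, -128686243⟩,
       ⟨-426468371, -409354089, 2003617309, -3133454555⟩,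
       ⟨5170675369, -5194739001, 9712851579, 7752647521⟩],
      [⟨⟨-3121560418, -5381963997⟩, ⟨2928073121, 5472786407⟩,
         ⟨-512741864, -1264018⟩, ⟨-1518166001, 189806895⟩⟩]⟩)]

def realizationsTen : List ((ℕ × ℕ × ℕ) × Witness) :=
  [((5, 0, 5), ⟨⟨⟨28, 54, 99, -3⟩, ⟨22, 9, -5, -16⟩, ⟨51, 4, -38, 26⟩, ⟨34, -8, 62, -24⟩⟩,
      [⟨344997778, -803434074, 3993149025, 1063042161⟩,
       ⟨606808291, -1315163434, 4154052359, -1873948111⟩,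
       ⟨-1224458155, 638667128, -1289732788, 7198391008⟩,
       ⟨1416155887, -371349637, 1132763031, -835825363⟩,
       ⟨-512807247, 1196491550, -792500356, 1437528891⟩,
       ⟨5340092848, 15325407735, -521395878, 246387881⟩,
       ⟨1580382489, -215623836, 680121191, -632227878⟩,
       ⟨-1193042948, 675333396, -1370779423, 5937000147⟩,
       ⟨-1248736067, 596043749, -937621947, 8814059058⟩,
       ⟨534020286, -553647472, 3105681286, 1064947816⟩],
      []⟩),
    ((5, 1, 4), ⟨⟨⟨30, 67, 63, 6⟩, ⟨82, 48, -32, -86⟩, ⟨86, -6, -24, 84⟩, ⟨99, 6, 21, -21⟩⟩,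
      [⟨-807133363, 387155703, 2838834268, 7258783494⟩,
       ⟨937661899, -225017511, 679470324, 22973558⟩,
       ⟨1202571517, 58814937, 405037202, -115089764⟩,
       ⟨-397356010, -1575958601, -476509704, -459322563⟩,
       ⟨-1265418030, 2035950797, -2393009467, 2670018595⟩,
       ⟨-1101668933, 808496892, 2127684666, -9618132254⟩,
       ⟨2583363003, 4533933032, -965908756, 456649619⟩,
       ⟨790581173, -1020717888, 521494711, -723435913⟩,
       ⟨1064944183, -86810476, 553349679, -38723892⟩,
       ⟨2856105247, 8244282537, -1104715178, 590054195⟩],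
      []⟩),
    ((5, 2, 3), ⟨⟨⟨31, 51, 54, 14⟩, ⟨69, 38, -14, -99⟩, ⟨70, -6, -22, 81⟩, ⟨78, 6, 18, -24⟩⟩,
      [⟨863224179, -256862368, 667305362, 29151625⟩,
       ⟨997363369, -114814705, 541989499, -28883134⟩,
       ⟨658509658, -811088924, 427691633, -533406995⟩,
       ⟨2305962810, 2237735707, -642151992, 225341188⟩,
       ⟨-1239177694, 1465521977, -2024519595, 2431703818⟩,
       ⟨-920386838, 519063834, 525751762, -17904954836⟩,
       ⟨-3792794476, -23089618563, -995634821, 543328257⟩,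
       ⟨-94377729, -1187665379, -393750151, -363758630⟩,
       ⟨1130801553, 22285233, 392654901, -103419377⟩,
       ⟨-811389469, 377455010, 3849466493, 13832786810⟩],
      []⟩),
    ((5, 3, 2), ⟨⟨⟨23, 60, 99, 6⟩, ⟨29, 13, -5, -5⟩, ⟨60, -12, -30, 10⟩, ⟨27, 1, 76, -21⟩⟩,
      [⟨-2248804101, 478992194, -607874692, 26272192315⟩,
       ⟨924604382, -162004607, 4117695458, 1991210743⟩,
       ⟨1932843561, -260185054, 2586241367, -2809644455⟩,
       ⟨3564344837, 450952255, 44035254, -975859931⟩,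
       ⟨-530463310, -3760603507, -26560590422, 13754337387⟩,
       ⟨-959177401, -2753090081, -26493353575, -3225294863⟩,
       ⟨749803057, 2410744108, -556432656, 476340934⟩,
       ⟨-836217130, 1006413803, -643920250, 1857493916⟩,
       ⟨-2070965801, 565316645, -1242249961, 11239417540⟩,
       ⟨-2226917124, 494987356, -955553293, 22233268724⟩],
      []⟩),
    ((5, 4, 1), ⟨⟨⟨27, 48, 99, 6⟩, ⟨20, 6, -2, -11⟩, ⟨37, 8, -31, 16⟩, ⟨5, -4, 53, -21⟩⟩,
      [⟨-464886173, -1127772845, 35363177614, 7534421397⟩,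
       ⟨-1597409870, 415049038, -4275372384, 27016397413⟩,
       ⟨-1596275194, 428721686, -4392196119, 21182959761⟩,
       ⟨921695350, -207882424, 1501375456, -1047515848⟩,
       ⟨-528672305, 1298702155, -661194325, 976490113⟩,
       ⟨-2871071370, -5896953698, -421173751, 108160426⟩,
       ⟨1074930906, -89228410, 480289163, -532697520⟩,
       ⟨-1593387856, 437305066, -4198326248, 17917056184⟩,
       ⟨546203250, -194200290, 2975179279, 1617640636⟩,
       ⟨-284546399, -1380612927, 36607428411, -15179817547⟩],
      []⟩),
    ((5, 5, 0), ⟨⟨⟨-53, 94, 88, -29⟩, ⟨16, 18, -15, -26⟩, ⟨-16, 55, 21, 17⟩, ⟨-14, 53, -99, -55⟩⟩,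
      [⟨-3458710994, 1628538598, 2139282916, 324820069⟩,
       ⟨2616298692, -6151426702, 1450675270, -2710070506⟩,
       ⟨1661002962, -799442970, -643634967, 2632282⟩,
       ⟨473159915, 929488406, -1266882331, -681201986⟩,
       ⟨-87041098, 449750451, -1777442482, -683315674⟩,
       ⟨-1567706554, -492171313, -4248159984, -6368002799⟩,
       ⟨174258722, 630990893, -1529010566, -703923553⟩,
       ⟨3146331318, 305973574, -1707850184, 1412002111⟩,
       ⟨465935784, -439664201, 225045300, 119353050⟩,
       ⟨-1548492058, -1257208845, 9481311841, 6143169164⟩],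
      []⟩),
    ((6, 0, 4), ⟨⟨⟨29, 20, 75, 13⟩, ⟨22, 30, -13, -16⟩, ⟨46, 2, -29, 3⟩, ⟨16, -99, 38, -22⟩⟩,
      [⟨124692851, 575356312, 773172891, 2358268090⟩,
       ⟨3127427320, -616879134, 1443983560, -1338674328⟩,
       ⟨924389785, 2108293779, 74181784, 600752710⟩,
       ⟨-658993186, 1103879245, -699025116, 2286120254⟩,
       ⟨-2080284803, -1794267922, -3147524993, -1816354603⟩,
       ⟨-700068569, -2108988535, -5399566474, -60917609⟩,
       ⟨-4754219036, -725855250, -1081161627, -2311442109⟩,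
       ⟨6899704644, -733288362, 803327949, -1425462225⟩,
       ⟨-111742088, 912232569, 46402734, 1942195546⟩,
       ⟨1600918458, -803319205, 4109516171, -2006081230⟩],
      []⟩),
    ((6, 1, 3), ⟨⟨⟨30, 77, 99, 15⟩, ⟨14, 14, -21, -13⟩, ⟨69, 14, -27, 5⟩, ⟨19, -44, 22, -32⟩⟩,
      [⟨927252470, -596245, 1785636835, 2450784972⟩,
       ⟨10636189325, -2586921795, 1179543193, -2481414562⟩,
       ⟨-235591361, 1472491775, -1136561736, 1346139828⟩,
       ⟨-794648385, 1254617895, -1611029329, 2003169577⟩,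
       ⟨-134608365, -3608855308, -7074790873, 1378425850⟩,
       ⟨450117711, -3930537858, -8111978482, 3360467501⟩,
       ⟨-4563073604, 641018923, -229789531, -3098604185⟩,
       ⟨-6961281416, 1129939399, 194764979, -2683092679⟩,
       ⟨325990000, 2396954894, -901805506, 772974521⟩,
       ⟨4536689705, -1765331936, 3162677036, -3925553694⟩],
      []⟩),
    ((6, 2, 2), ⟨⟨⟨-19, 27, 99, -29⟩, ⟨-6, 6, 0, -13⟩, ⟨35, -4, -48, 12⟩, ⟨9, -56, -47, -63⟩⟩,
      [⟨181387065, -6320565256, 3979739828, 1383618915⟩,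
       ⟨4640942832, -5351247488, 2109537078, -1681945291⟩,
       ⟨11877225831, -2107430374, 386769720, -867565699⟩,
       ⟨-87733197, 668131585, -858439053, 855565624⟩,
       ⟨-383548821, 562341205, -1249439433, 1141573461⟩,
       ⟨-2572093476, -264130248, -4804059797, -3088194365⟩,
       ⟨-4044348587, 214328442, -348095228, -634844066⟩,
       ⟨-2347707633, 11876655551, -222789359, -169398012⟩,
       ⟨8299065269, -1938080812, 713966799, -1065459184⟩,
       ⟨2274608165, 447687858, 1262940795, 1237992578⟩],
      []⟩),
    ((6, 3, 1), ⟨⟨⟨-17, 30, 93, -26⟩, ⟨-3, 10, -4, -9⟩, ⟨44, -36, -38, 10⟩, ⟨12, -70, -65, -99⟩⟩,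
      [⟨3211919728, -12158167924, 2921738998, -2195216793⟩,
       ⟨2475981471, 636900396, 1122163502, 832303715⟩,
       ⟨-631872552, 9593473887, -247308838, -132617158⟩,
       ⟨12730297413, -602704646, -273442588, -1134490534⟩,
       ⟨-8967897061, -140980600, -1013738445, -1025077425⟩,
       ⟨-5115819740, -463033725, -3585482457, -2362294970⟩,
       ⟨-1821827443, 310323744, -2059590511, 2488609715⟩,
       ⟨9402224299, -608748182, -53557119, -1312070582⟩,
       ⟨554203057, 1206967801, -742902, 328780650⟩,
       ⟨-568421723, -12822940599, 4238985356, 1293921458⟩],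
      []⟩),
    ((6, 4, 0), ⟨⟨⟨59, -99, 3, 13⟩, ⟨52, 2, -41, -1⟩, ⟨-8, -5, 49, 9⟩, ⟨45, 26, 12, -21⟩⟩,
      [⟨-815349074, -892707122, 7352201064, 1490833278⟩,
       ⟨-413664651, -1326741823, 6084708904, 2628324126⟩,
       ⟨-585572408, -187791654, -545834069, 537138932⟩,
       ⟨-1961882972, 3587885765, -543562369, -6132175977⟩,
       ⟨600686592, 2292079761, -2581523414, -4527785464⟩,
       ⟨-9572967963, -3265561923, -9564626269, 5102430495⟩,
       ⟨-722869643, 2692501264, -1526495487, -4878712566⟩,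
       ⟨1612151228, -743411206, -592294575, -1208238351⟩,
       ⟨1814584388, 103009997, 75728260, -772549391⟩,
       ⟨-1103590655, -680638870, 9104469042, -1326839767⟩],
      []⟩),
    ((7, 0, 3), ⟨⟨⟨21, 43, 76, 11⟩, ⟨29, 19, -9, -6⟩, ⟨46, 4, -32, 4⟩, ⟨33, 5, 99, -16⟩⟩,
      [⟨1497222682, -474484882, 7263367724, -4086228043⟩,
       ⟨3970540365, 1038776853, 57724328, -557183163⟩,
       ⟨-256385372, 1818178250, -725726948, 1046177035⟩,
       ⟨-8540042184, 217131446, 518057794, -2579895333⟩,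
       ⟨-1730365425, -3685187110, -6463123112, -770067791⟩,
       ⟨-1262033784, -4503413653, -7169251336, 2463228606⟩,
       ⟨-3787122655, 575505393, -198757514, -8445158009⟩,
       ⟨-1007575459, 1594700083, -1018493999, 1689430061⟩,
       ⟨496750631, 2163064451, -567158964, 644993928⟩,
       ⟨894556899, -258965470, 7536904281, 2657807692⟩],
      []⟩),
    ((7, 1, 2), ⟨⟨⟨19, 39, 99, 12⟩, ⟨28, 10, -4, -3⟩, ⟨52, -4, -29, 2⟩, ⟨10, 5, 96, -14⟩⟩,
      [⟨1615438434, -164124666, 7835712041, -6366231572⟩,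
       ⟨-3259581476, 613291117, -2809578962, 7802447030⟩,
       ⟨358928416, 2112949539, -356932583, 478779719⟩,
       ⟨-7244305640, -213545855, -196761463, -3355795230⟩,
       ⟨-2604712403, -4968084066, -7646981705, -988027663⟩,
       ⟨-2273981925, -5694843594, -8260379346, 3055647772⟩,
       ⟨-4802232952, 72638124, -1186816293, -6873687865⟩,
       ⟨3952405891, 686752495, -35623666, -844627058⟩,
       ⟨-420736043, 1458930815, -388653866, 857867017⟩,
       ⟨1054411227, -75420426, 8606397789, 4784040173⟩],
      []⟩),
    ((7, 2, 1), ⟨⟨⟨-24, 30, 99, 12⟩, ⟨19, 5, -10, -3⟩, ⟨49, -3, -22, 1⟩, ⟨8, 6, 74, -12⟩⟩,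
      [⟨2553500196, -400184417, 9081395776, -9657037854⟩,
       ⟨-503439637, 798514028, -330072452, 803706676⟩,
       ⟨2309586692, 4401474574, -316354317, -240688824⟩,
       ⟨-9254326215, 493265746, -256326414, -3528307325⟩,
       ⟨-1329750533, -9582872272, -8762466411, 6106271030⟩,
       ⟨-2546877127, -7159017001, -7375010823, -3654586900⟩,
       ⟨-5953183986, 443171307, -944104277, -5660159515⟩,
       ⟨7209291176, 110591124, 3429092, -1482745677⟩,
       ⟨-3273444321, 667384377, -2858961964, 6969042247⟩,
       ⟨1445690354, -178297293, 9124150420, 6485221463⟩],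
      []⟩),
    ((7, 3, 0), ⟨⟨⟨54, -99, 5, 16⟩, ⟨88, 10, -64, -4⟩, ⟨-17, -3, 72, 3⟩, ⟨65, 40, 36, -31⟩⟩,
      [⟨-155038341, -1147410927, 5290463322, 2316660520⟩,
       ⟨-624511813, -595453782, 4613030416, -461249200⟩,
       ⟨-494862471, -177089692, -501664462, 420913753⟩,
       ⟨1620376353, -929808451, -383017819, -1211881056⟩,
       ⟨5432378473, 1695458337, -9424147575, 6663046457⟩,
       ⟨1637647794, 2278641830, -3949865651, -5880016495⟩,
       ⟨-769649583, 3801163278, -1584854842, -4695733848⟩,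
       ⟨7057707491, -9103888174, 3221742489, -10316278943⟩,
       ⟨1969907757, 103779623, 106963484, -924042334⟩,
       ⟨-446243087, -806971952, 4988669187, 1124711085⟩],
      []⟩),
    ((8, 0, 2), ⟨⟨⟨25, 48, 99, 8⟩, ⟨21, 8, -7, -3⟩, ⟨29, -1, -34, 3⟩, ⟨5, 6, 38, -13⟩⟩,
      [⟨924108598, 24074175, 4939700198, 2361717877⟩,
       ⟨1558030900, 201736206, -20749609, -399670465⟩,
       ⟨1520775683, 2944613277, -471408979, 278821306⟩,
       ⟨-2704125950, 168465293, -11445654931, 13161240655⟩,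
       ⟨-1712008417, -2603195987, -12847047495, 14660936⟩,
       ⟨-2663418243, -102492532, -9728279518, -13142342879⟩,
       ⟨-1634451252, -2783264224, -13219155428, 4216020506⟩,
       ⟨-4998689145, -439201374, 8591574, -1092246560⟩,
       ⟨834237339, 2058528527, -502661756, 382430378⟩,
       ⟨1121136573, -11881967, 4071461770, -2855061869⟩],
      []⟩),
    ((8, 1, 1), ⟨⟨⟨43, 69, 99, 9⟩, ⟨44, 3, -3, -7⟩, ⟨60, -5, -48, 9⟩, ⟨2, -9, 98, -24⟩⟩,
      [⟨670152957, -83101658, 4944774889, 2753355952⟩,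
       ⟨-1280327209, 1284752776, -873540773, 2630928651⟩,
       ⟨-2386373091, 599817721, -4764545204, 12543001991⟩,
       ⟨-2636995340, 172416870, -1117849866, -6114186774⟩,
       ⟨-1190733441, -2436555993, -13811153719, 8552257737⟩,
       ⟨-1458115107, -1962412141, -12270404398, -2628975454⟩,
       ⟨-2530573776, 186047012, -2493595574, -9141328717⟩,
       ⟨-2989920438, -4076252391, -650855256, -37954118⟩,
       ⟨1106960090, 76312739, 119830139, -416020087⟩,
       ⟨920190231, -142721301, 3833615609, -2624039660⟩],
      []⟩),
    ((8, 2, 0), ⟨⟨⟨21, -93, 30, 28⟩, ⟨44, 8, -99, -9⟩, ⟨-6, -11, 42, 5⟩, ⟨9, 68, 10, -38⟩⟩,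
      [⟨9643234581, -6508250671, 8270224302, -10606032123⟩,
       ⟨-239402869, -358225349, 2508985121, 285359147⟩,
       ⟨4223089014, 1550044771, 306024875, -298791502⟩,
       ⟨-235856454, -235097346, -854222334, -37890481⟩,
       ⟨588308429, 1645855884, -2669900642, -2950550667⟩,
       ⟨8645266561, 2982492639, -6662043255, 2683322348⟩,
       ⟨1465021157, 1869703104, -3310284086, -3239216060⟩,
       ⟨3670093747, -2586010276, -515426534, -641981047⟩,
       ⟨-345643968, -197972340, 1251139853, -1850413343⟩,
       ⟨2156570597, -2274863572, 6034173909, 2984549536⟩],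
      []⟩),
    ((9, 0, 1), ⟨⟨⟨21, 76, 99, 15⟩, ⟨30, 7, -5, -5⟩, ⟨57, 1, -87, 2⟩, ⟨5, 11, 89, -17⟩⟩,
      [⟨1119714708, 35009723, 10160308895, 5244044790⟩,
       ⟨1117480512, 34076206, -22090329, -309279189⟩,
       ⟨-1298389811, -2590252521, -593208180, -128175846⟩,
       ⟨-1304461618, -2591307840, -8236240627, 5695413936⟩,
       ⟨-2357651215, -76657725, -8629673511, -10523175181⟩,
       ⟨-1302455044, -2597570111, -7304393708, -1254250717⟩,
       ⟨-2355185607, -80349396, -10799159884, 10624061150⟩,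
       ⟨-852531584, 1920761419, -1722298778, 2311773129⟩,
       ⟨-2354124358, -75617001, -11476611, -1187542905⟩,
       ⟨1118178530, 35545503, 9040949284, -5449776546⟩],
      []⟩),
    ((9, 1, 0), ⟨⟨⟨22, -76, 28, 27⟩, ⟨46, 6, -99, -9⟩, ⟨-6, -10, 43, 5⟩, ⟨9, 94, 12, -37⟩⟩,
      [⟨-253651906, -308931229, 2700569171, 189675166⟩,
       ⟨5237063847, -4127827318, 8636999397, 5083243928⟩,
       ⟨6360148017, 2633148270, 265098718, -307826893⟩,
       ⟨-254336778, -312570610, -1001404385, -79503451⟩,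
       ⟨6204112901, 2576867694, -6295517868, 2560685680⟩,
       ⟨6387893263, 2601104563, -5196646884, -4145281622⟩,
       ⟨-680131148, 965678801, -832387743, -2575917946⟩,
       ⟨5203347477, -4136601120, -488728924, -713288929⟩,
       ⟨-247687878, -316794133, 1565735067, -2841409778⟩,
       ⟨4997462525, -3990267690, 6741392960, -8834247730⟩],
      []⟩),
    ((10, 0, 0), ⟨⟨⟨45, -30, 46, 27⟩, ⟨44, -10, -99, -17⟩, ⟨-5, 8, 75, 12⟩, ⟨12, 55, -18, -35⟩⟩,
      [⟨-455387150, -367618062, 3189051781, 297175055⟩,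
       ⟨3298116711, -3649015875, 9047544359, 7503858809⟩,
       ⟨4732090577, 1821093046, -49428781, -211629748⟩,
       ⟨5699839898, -6173784664, -444289245, -1400678456⟩,
       ⟨4424333326, 1708921249, -4870455690, 2121172198⟩,
       ⟨4517805123, 1705409574, -3965397677, -1925354681⟩,
       ⟨8781085121, -9368045280, -437633683, -1468680467⟩,
       ⟨-461203255, -375240258, -827543410, -93577770⟩,
       ⟨-443524986, -380715234, 2178867356, -2911814139⟩,
       ⟨3039721495, -3445561897, 6482472444, -10823597426⟩],
      []⟩)]

/-- Matrices with integer entries for all the signatures, with the lines scaled by `10 ^ 9`. -/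
def realizations : List ((ℕ × ℕ × ℕ) × Witness) :=
  realizationsZero ++ realizationsTwo ++ realizationsFour ++ realizationsSix ++
    (realizationsEight ++ realizationsTen)

theorem realizations_valid :
    realizations.all (Witness.realizesSignature 1000000000 54 99 5) := by
  decide +kernel

def isAdmissible (nt np nm : ℕ) : Bool :=
  [0, 2, 4, 6].contains (nt + np + nm) || (nt + np + nm == 8 && nt != 1) ||
    (nt + np + nm == 10 && decide (5 ≤ nt))

theorem mem_realizations_of_isAdmissible (nt np nm : Fin 11) :
    isAdmissible nt np nm → (nt.1, np.1, nm.1) ∈ realizations.map Prod.fst := by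
  revert nt np nm
  decide +kernel

theorem exists_witness {nt np nm : ℕ} (h : isAdmissible nt np nm) :
    ∃ W : Witness, W.isValid 1000000000 54 99 5 ∧ W.signature 1000000000 = (nt, np, nm) := by
  have hle : nt + np + nm ≤ 10 := by
    simp [isAdmissible] at h
    omega
  have hmem := mem_realizations_of_isAdmissible ⟨nt, by omega⟩ ⟨np, by omega⟩ ⟨nm, by omega⟩ h
  obtain ⟨⟨p, W⟩, hW, rfl⟩ := List.mem_map.1 hmem
  have h := List.all_eq_true.1 realizations_valid _ hW
  simp only [Witness.realizesSignature, Bool.and_eq_true, decide_eq_true_eq] at h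
  exact ⟨W, h⟩

/-- Every admissible triple `(n_t, n_p, n_m)` with `n_ℝ = n_t + n_p + n_m` satisfying
`n_ℝ ∈ {0, 2, 4, 6}`, or `n_ℝ = 8` and `n_t ≠ 1`, or `n_ℝ = 10` and `n_t ∈ {5, …, 10}`,
is realizable by a pair of real twisted cubic curves. -/
theorem main_realizability (nt np nm : ℕ)
    (h : nt + np + nm ∈ ({0, 2, 4, 6} : Set ℕ) ∨
         (nt + np + nm = 8 ∧ nt ≠ 1) ∨
         (nt + np + nm = 10 ∧ nt ∈ ({5, 6, 7, 8, 9, 10} : Set ℕ))) :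
    ∃ M : Matrix (Fin 4) (Fin 4) ℝ, IsUnit M.det ∧
      (Ssol (cm M)).ncard = 40 ∧
      (∀ x ∈ Ssol (cm M), IsUnit (Jac (cm M) x)) ∧
      {x ∈ Ssol (cm M) | TotallyReal x}.ncard = 4 * nt ∧
      {x ∈ Ssol (cm M) | PartiallyReal x}.ncard = 4 * np ∧
      {x ∈ Ssol (cm M) | MinimallyReal x}.ncard = 4 * nm := by
  obtain ⟨W, hW, hsig⟩ := exists_witness (nt := nt) (np := np) (nm := nm) (by
    simp only [Set.mem_insert_iff, Set.mem_singleton_iff] at h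
    simp [isAdmissible]
    omega)
  have h := W.realizes (by norm_num) hW
  rw [hsig] at h
  exact ⟨W.realMat, h⟩
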